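/- arXiv:2203.02256 — 3 statements merged into one kernel-verified Lean document; each statement's English description precedes it below -/
import Mathlib

section
/- Let d ≥ 1, let 1 ≤ p, q ≤ ∞, and let s, k₁, k₂ ∈ ℝ with k := k₁ + k₂. Assume k₁ > d·max(0, 1/q − 1/p) and p ≤ 2q. Then there exists a constant C > 0 such that for all Schwartz functions a, b on ℝ^d, ‖T_a b‖_{Ḃ^{s−k+d/q−d/p}_{q,∞}} ≤ C·‖a‖_{Ḃ^{d/p−k₁}_{p,∞}}·‖b‖_{Ḃ^{s−k₂}_{p,∞}}. -/
open MeasureTheory SchwartzMap Real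
open scoped FourierTransform ENNReal NNReal

noncomputable section

abbrev Rd (d : ℕ) := EuclideanSpace ℝ (Fin d)

/-- Homogeneous Littlewood–Paley block Δ_j f = 𝓕⁻¹(φ(2^{-j}·)·𝓕 f). -/
def LPblock (d : ℕ) (φ : Rd d → ℝ) (j : ℤ) (f : Rd d → ℂ) : Rd d → ℂ :=
  𝓕⁻ fun ξ => (φ (((2:ℝ) ^ (-j)) • ξ) : ℂ) * 𝓕 f ξ

/-- ℓ^r norm (over ℤ) of a sequence of extended nonnegative reals. -/
def seqNorm (r : ℝ≥0∞) (u : ℤ → ℝ≥0∞) : ℝ≥0∞ :=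
  if r = ∞ then ⨆ j, u j else (∑' j, u j ^ r.toReal) ^ (1 / r.toReal)

/-- Homogeneous Besov norm ‖f‖_{Ḃ^s_{p,r}}. -/
def besovNorm (d : ℕ) (φ : Rd d → ℝ) (s : ℝ) (p r : ℝ≥0∞) (f : Rd d → ℂ) : ℝ≥0∞ :=
  seqNorm r fun j =>
    ENNReal.ofReal ((2:ℝ) ^ ((j : ℝ) * s)) * eLpNorm (LPblock d φ j f) p volume

/-- Low-frequency cut-off Ṡ_{j-1} f = ∑_{k ≤ j-2} Δ_k f. -/
def lowFreq (d : ℕ) (φ : Rd d → ℝ) (j : ℤ) (f : Rd d → ℂ) : Rd d → ℂ :=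
  fun x => ∑' k : ℤ, if k ≤ j - 2 then LPblock d φ k f x else 0

/-- Bony paraproduct T_a b = ∑_j Ṡ_{j-1}a · Δ_j b. -/
def para (d : ℕ) (φ : Rd d → ℝ) (a b : Rd d → ℂ) : Rd d → ℂ :=
  fun x => ∑' j : ℤ, lowFreq d φ j a x * LPblock d φ j b x

/-- Bony remainder R(a,b) = ∑_j (Δ_{j-1}a + Δ_j a + Δ_{j+1}a)·Δ_j b. -/
def remainder (d : ℕ) (φ : Rd d → ℝ) (a b : Rd d → ℂ) : Rd d → ℂ :=
  fun x => ∑' j : ℤ,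
    (LPblock d φ (j-1) a x + LPblock d φ j a x + LPblock d φ (j+1) a x) * LPblock d φ j b x

theorem eLpNorm_tsum_le {α ι E : Type*} [MeasurableSpace α] [Countable ι] [NormedAddCommGroup E]
    [CompleteSpace E] {μ : Measure α} {q : ℝ≥0∞} (hq : 1 ≤ q) {f : ι → α → E}
    (hf : ∀ i, AEStronglyMeasurable (f i) μ) :
    eLpNorm (fun x => ∑' i, f i x) q μ ≤ ∑' i, eLpNorm (f i) q μ := by
  by_cases htop : ∑' i, eLpNorm (f i) q μ = ∞
  · simp [htop]
  obtain ⟨S, hS⟩ := (Filter.atTop : Filter (Finset ι)).exists_seq_tendsto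
  have hlim : ∀ᵐ x ∂μ, Filter.Tendsto (fun n => (∑ i ∈ S n, f i) x) Filter.atTop
      (nhds (∑' i, f i x)) := by
    filter_upwards [summable_norm_of_tsum_eLpNorm_ne_top hq hf htop] with x hx
    simpa [Function.comp_def] using hx.of_norm.hasSum.comp hS
  refine (Lp.eLpNorm_lim_le_liminf_eLpNorm
    (fun n => Finset.aestronglyMeasurable_sum _ fun i _ => hf i) _ hlim).trans ?_
  refine Filter.liminf_le_of_frequently_le' (Filter.Frequently.of_forall fun n => ?_)
  exact (eLpNorm_sum_le (fun i _ => hf i) hq).trans (ENNReal.sum_le_tsum _)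

/-- Interpolation between `L^m` and `L^∞`. -/
theorem eLpNorm_le_eLpNorm_rpow_mul_eLpNorm_top_rpow {α E : Type*} [MeasurableSpace α]
    [NormedAddCommGroup E] {μ : Measure α} {m q : ℝ≥0∞} (hm : 1 ≤ m) (hmq : m ≤ q)
    {f : α → E} (hf : AEStronglyMeasurable f μ) :
    eLpNorm f q μ ≤ eLpNorm f m μ ^ (m.toReal / q.toReal) *
      eLpNorm f ∞ μ ^ (1 - m.toReal / q.toReal) := by
  rcases eq_or_ne q ∞ with rfl | hq
  · simp
  have hm' : m ≠ ∞ := ne_top_of_le_ne_top hq hmq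
  have hm0 : m ≠ 0 := (zero_lt_one.trans_le hm).ne'
  have hq0 : q ≠ 0 := (zero_lt_one.trans_le (hm.trans hmq)).ne'
  have hmpos : 0 < m.toReal := ENNReal.toReal_pos hm0 hm'
  have hqpos : 0 < q.toReal := ENNReal.toReal_pos hq0 hq
  have hle : m.toReal ≤ q.toReal := ENNReal.toReal_mono hq hmq
  rw [eLpNorm_eq_lintegral_rpow_enorm_toReal hq0 hq,
    eLpNorm_eq_lintegral_rpow_enorm_toReal hm0 hm']
  have key : ∫⁻ x, ‖f x‖ₑ ^ q.toReal ∂μ ≤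
      (∫⁻ x, ‖f x‖ₑ ^ m.toReal ∂μ) * eLpNorm f ∞ μ ^ (q.toReal - m.toReal) := by
    rw [← lintegral_mul_const'' _ (hf.enorm.pow_const _)]
    refine lintegral_mono_ae ?_
    filter_upwards [ae_le_eLpNormEssSup (f := f) (μ := μ)] with x hx
    calc ‖f x‖ₑ ^ q.toReal = ‖f x‖ₑ ^ m.toReal * ‖f x‖ₑ ^ (q.toReal - m.toReal) := by
          rw [← ENNReal.rpow_add_of_nonneg _ _ hmpos.le (sub_nonneg.2 hle)]; ring_nf
      _ ≤ _ := by
          gcongr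
          simpa [eLpNorm_exponent_top] using hx
  calc _ ≤ ((∫⁻ x, ‖f x‖ₑ ^ m.toReal ∂μ) * eLpNorm f ∞ μ ^ (q.toReal - m.toReal)) ^
        (1 / q.toReal) := by gcongr
    _ = _ := by
      rw [ENNReal.mul_rpow_of_nonneg _ _ (by positivity), ← ENNReal.rpow_mul, ← ENNReal.rpow_mul]
      congr 2 <;> field_simp

section Convolution

variable {G : Type*} [AddCommGroup G] [MeasurableSpace G] [MeasurableAdd₂ G] [MeasurableNeg G]
  {μ : Measure G} [μ.IsAddLeftInvariant] [μ.IsNegInvariant]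

/-- Jensen's inequality for convolution against a nonnegative kernel. -/
theorem lintegral_sub_mul_rpow_le {K g : G → ℝ≥0∞} (hK : Measurable K) (hg : AEMeasurable g μ)
    {m : ℝ} (hm : 1 ≤ m) (x : G) :
    (∫⁻ y, K (x - y) * g y ∂μ) ^ m ≤
      (∫⁻ y, K y ∂μ) ^ (m - 1) * ∫⁻ y, K (x - y) * g y ^ m ∂μ := by
  have hm0 : 0 < m := by linarith
  have hKx : AEMeasurable (fun y => K (x - y)) μ :=
    (hK.comp (measurable_const.sub measurable_id)).aemeasurable
  have h := ENNReal.lintegral_mul_norm_pow_le (μ := μ) (f := fun y => K (x - y))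
    (g := fun y => K (x - y) * g y ^ m) hKx (hKx.mul (hg.pow_const m)) (p := 1 - 1 / m)
    (q := 1 / m) (sub_nonneg.2 ((div_le_one hm0).2 hm)) (by positivity) (by ring)
  have h2 : ∀ y, K (x - y) ^ (1 - 1 / m) * (K (x - y) * g y ^ m) ^ (1 / m) =
      K (x - y) * g y := by
    intro y
    rw [ENNReal.mul_rpow_of_nonneg _ _ (by positivity), ← ENNReal.rpow_mul, ← mul_assoc,
      ← ENNReal.rpow_add_of_nonneg _ _ (sub_nonneg.2 ((div_le_one hm0).2 hm)) (by positivity)]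
    simp [hm0.ne']
  simp only [h2] at h
  rw [lintegral_sub_left_eq_self K x] at h
  calc _ ≤ ((∫⁻ y, K y ∂μ) ^ (1 - 1 / m) * (∫⁻ y, K (x - y) * g y ^ m ∂μ) ^ (1 / m)) ^ m := by
        gcongr
    _ = _ := by
        rw [ENNReal.mul_rpow_of_nonneg _ _ hm0.le, ← ENNReal.rpow_mul, ← ENNReal.rpow_mul]
        congr 2
        · field_simp
        · simp [hm0.ne']

variable {E : Type*} [NormedAddCommGroup E]

theorem lintegral_sub_mul_enorm_le_mul_eLpNorm_top {K : G → ℝ≥0∞} (hK : Measurable K)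
    (g : G → E) (x : G) :
    ∫⁻ y, K (x - y) * ‖g y‖ₑ ∂μ ≤ (∫⁻ y, K y ∂μ) * eLpNorm g ∞ μ := by
  have hKx : Measurable fun y => K (x - y) := by fun_prop
  rw [← lintegral_sub_left_eq_self K x, ← lintegral_mul_const _ hKx]
  refine lintegral_mono_ae ?_
  filter_upwards [ae_le_eLpNormEssSup (f := g) (μ := μ)] with y hy
  gcongr
  simpa [eLpNorm_exponent_top] using hy

theorem eLpNorm_le_of_enorm_le_lintegral_sub [SFinite μ] [μ.IsAddRightInvariant]
    {K : G → ℝ≥0∞} (hK : Measurable K)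
    {f : G → E} {g : G → E} (hg : AEStronglyMeasurable g μ)
    (hf : ∀ x, ‖f x‖ₑ ≤ ∫⁻ y, K (x - y) * ‖g y‖ₑ ∂μ) {m : ℝ≥0∞} (hm : 1 ≤ m) :
    eLpNorm f m μ ≤ (∫⁻ y, K y ∂μ) * eLpNorm g m μ := by
  rcases eq_or_ne m ∞ with rfl | hm'
  · refine eLpNormEssSup_le_of_ae_enorm_bound (ae_of_all _ fun x => (hf x).trans ?_)
    exact lintegral_sub_mul_enorm_le_mul_eLpNorm_top hK g x
  have hm0 : m ≠ 0 := (zero_lt_one.trans_le hm).ne'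
  have hm1 : 1 ≤ m.toReal := by simpa using ENNReal.toReal_mono hm' hm
  have hmpos : 0 < m.toReal := by linarith
  rw [eLpNorm_eq_lintegral_rpow_enorm_toReal hm0 hm',
    eLpNorm_eq_lintegral_rpow_enorm_toReal hm0 hm']
  have hgm : AEMeasurable (fun y => ‖g y‖ₑ ^ m.toReal) μ := hg.enorm.pow_const _
  have hprod : AEMeasurable (Function.uncurry fun x y => K (x - y) * ‖g y‖ₑ ^ m.toReal)
      (μ.prod μ) :=
    (hK.comp measurable_sub).aemeasurable.mul
      (hgm.comp_quasiMeasurePreserving Measure.quasiMeasurePreserving_snd)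
  have key : ∫⁻ x, ‖f x‖ₑ ^ m.toReal ∂μ ≤
      (∫⁻ y, K y ∂μ) ^ m.toReal * ∫⁻ y, ‖g y‖ₑ ^ m.toReal ∂μ := by
    calc _ ≤ ∫⁻ x, (∫⁻ y, K y ∂μ) ^ (m.toReal - 1) *
          ∫⁻ y, K (x - y) * ‖g y‖ₑ ^ m.toReal ∂μ ∂μ := by
          refine lintegral_mono fun x => ?_
          exact (ENNReal.rpow_le_rpow (hf x) hmpos.le).trans
            (lintegral_sub_mul_rpow_le hK hg.enorm hm1 x)
      _ = (∫⁻ y, K y ∂μ) ^ (m.toReal - 1) *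
          ∫⁻ y, ∫⁻ x, K (x - y) * ‖g y‖ₑ ^ m.toReal ∂μ ∂μ := by
          rw [← lintegral_lintegral_swap hprod]
          exact lintegral_const_mul'' _ hprod.lintegral_prod_right'
      _ = (∫⁻ y, K y ∂μ) ^ (m.toReal - 1) *
          ((∫⁻ y, K y ∂μ) * ∫⁻ y, ‖g y‖ₑ ^ m.toReal ∂μ) := by
          congr 1
          rw [← lintegral_const_mul'' _ hgm]
          refine lintegral_congr fun y => ?_
          have hKy : Measurable fun x => K (x - y) := by fun_prop
          rw [lintegral_mul_const _ hKy, lintegral_sub_right_eq_self K y]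
      _ = _ := by
          rw [← mul_assoc]
          congr 1
          nth_rw 2 [← ENNReal.rpow_one (∫⁻ y, K y ∂μ)]
          rw [← ENNReal.rpow_add_of_nonneg _ _ (by linarith) zero_le_one]
          simp
  calc _ ≤ ((∫⁻ y, K y ∂μ) ^ m.toReal * ∫⁻ y, ‖g y‖ₑ ^ m.toReal ∂μ) ^ (1 / m.toReal) := by
        gcongr
    _ = _ := by
        rw [ENNReal.mul_rpow_of_nonneg _ _ (by positivity), ← ENNReal.rpow_mul]
        simp [hmpos.ne']

theorem eLpNorm_top_le_of_enorm_le_lintegral_sub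
    {K : G → ℝ≥0∞} (hK : Measurable K) {B : ℝ≥0∞} (hB : ∀ x, K x ≤ B)
    {f : G → E} {g : G → E} (hg : AEStronglyMeasurable g μ)
    (hf : ∀ x, ‖f x‖ₑ ≤ ∫⁻ y, K (x - y) * ‖g y‖ₑ ∂μ) {m : ℝ≥0∞} (hm : 1 ≤ m) :
    eLpNorm f ∞ μ ≤
      (∫⁻ y, K y ∂μ) ^ (1 - m⁻¹.toReal) * B ^ m⁻¹.toReal * eLpNorm g m μ := by
  refine eLpNormEssSup_le_of_ae_enorm_bound (ae_of_all _ fun x => (hf x).trans ?_)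
  rcases eq_or_ne m ∞ with rfl | hm'
  · simp only [ENNReal.inv_top, ENNReal.toReal_zero, sub_zero, ENNReal.rpow_one,
      ENNReal.rpow_zero, mul_one]
    exact lintegral_sub_mul_enorm_le_mul_eLpNorm_top hK g x
  have hm0 : m ≠ 0 := (zero_lt_one.trans_le hm).ne'
  have hm1 : 1 ≤ m.toReal := by simpa using ENNReal.toReal_mono hm' hm
  have hmpos : 0 < m.toReal := by linarith
  rw [eLpNorm_eq_lintegral_rpow_enorm_toReal hm0 hm', ENNReal.toReal_inv]
  have hgm : AEMeasurable (fun y => ‖g y‖ₑ ^ m.toReal) μ := hg.enorm.pow_const _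
  have key : (∫⁻ y, K (x - y) * ‖g y‖ₑ ∂μ) ^ m.toReal ≤
      (∫⁻ y, K y ∂μ) ^ (m.toReal - 1) * (B * ∫⁻ y, ‖g y‖ₑ ^ m.toReal ∂μ) := by
    refine (lintegral_sub_mul_rpow_le hK hg.enorm hm1 x).trans ?_
    rw [← lintegral_const_mul'' _ hgm]
    gcongr
    exact hB _
  calc _ = ((∫⁻ y, K (x - y) * ‖g y‖ₑ ∂μ) ^ m.toReal) ^ (1 / m.toReal) := by
        rw [← ENNReal.rpow_mul]; simp [hmpos.ne']
    _ ≤ ((∫⁻ y, K y ∂μ) ^ (m.toReal - 1) * (B * ∫⁻ y, ‖g y‖ₑ ^ m.toReal ∂μ)) ^ (1 / m.toReal) := by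
        gcongr
    _ = _ := by
        rw [ENNReal.mul_rpow_of_nonneg _ _ (by positivity),
          ENNReal.mul_rpow_of_nonneg _ _ (by positivity), ← ENNReal.rpow_mul, ← mul_assoc]
        congr 3
        · field_simp
        · simp

end Convolution

section FourierMultiplier

variable {d : ℕ}

theorem integrable_mul_fourier {Ψ g : Rd d → ℂ} (hΨ : Integrable Ψ) (hg : Integrable g) :
    Integrable fun ξ => Ψ ξ * 𝓕 g ξ := by
  refine hΨ.mul_bdd (c := ∫ v, ‖g v‖) ?_ ?_
  · exact (VectorFourier.fourierIntegral_continuous Real.continuous_fourierChar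
      continuous_inner hg).aestronglyMeasurable
  · exact ae_of_all _ fun ξ => VectorFourier.norm_fourierIntegral_le_integral_norm _ _ _ _ _

theorem continuous_fourierInv {f : Rd d → ℂ} (hf : Integrable f) : Continuous (𝓕⁻ f) := by
  have : 𝓕⁻ f = fun w => 𝓕 f (-w) := funext (Real.fourierInv_eq_fourier_neg f)
  rw [this]
  exact (VectorFourier.fourierIntegral_continuous Real.continuous_fourierChar
    continuous_inner hf).comp continuous_neg

/-- A Fourier multiplier acts as convolution with the inverse Fourier transform of its symbol. -/
theorem fourierInv_mul_fourier_eq_integral {Ψ g : Rd d → ℂ} (hΨ : Integrable Ψ)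
    (hg : Integrable g) (x : Rd d) :
    𝓕⁻ (fun ξ => Ψ ξ * 𝓕 g ξ) x = ∫ y, 𝓕⁻ Ψ (x - y) * g y := by
  have hmod : Integrable fun ξ => 𝐞 (inner ℝ ξ x) • Ψ ξ := by
    refine (integrable_norm_iff ?_).1 (by simpa using hΨ.norm)
    exact (Continuous.aestronglyMeasurable (by fun_prop)).fun_smul hΨ.1
  have h := VectorFourier.integral_fourierIntegral_smul_eq_flip (L := innerₗ (Rd d))
    (μ := volume) (ν := volume) Real.continuous_fourierChar continuous_inner hg hmod
  rw [Real.fourierInv_eq]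
  refine Eq.trans (integral_congr_ae (ae_of_all _ fun ξ => ?_))
    (h.trans (integral_congr_ae (ae_of_all _ fun y => ?_)))
  · change _ = 𝓕 g ξ • _
    simp only [Circle.smul_def, smul_eq_mul]
    ring
  · simp only [smul_eq_mul]
    rw [mul_comm, Real.fourierInv_eq]
    congr 1
    refine integral_congr_ae (ae_of_all _ fun ξ => ?_)
    simp only [Circle.smul_def, smul_eq_mul, ← mul_assoc, ← Circle.coe_mul, ← AddChar.map_add_eq_mul,
      inner_sub_right]
    congr 3
    simp [real_inner_comm]
    ring

theorem fourierInv_comp_inv_smul (ψ : Rd d → ℂ) {R : ℝ} (hR : 0 < R) (x : Rd d) :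
    𝓕⁻ (fun ξ => ψ (R⁻¹ • ξ)) x = (R ^ d : ℝ) • 𝓕⁻ ψ (R • x) := by
  have h := Measure.integral_comp_inv_smul_of_nonneg volume
    (fun ξ : Rd d => 𝐞 (inner ℝ ξ (R • x)) • ψ ξ) hR.le
  simp only [finrank_euclideanSpace, Fintype.card_fin] at h
  rw [Real.fourierInv_eq, Real.fourierInv_eq, ← h]
  refine integral_congr_ae (ae_of_all _ fun ξ => ?_)
  simp [inner_smul_left, inner_smul_right, hR.ne']

theorem exists_eLpNorm_multiplier_le (ψ : 𝓢(Rd d, ℂ)) :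
    ∃ C : ℝ≥0, ∀ (n : ℤ) (g : Rd d → ℂ), Integrable g → ∀ m q : ℝ≥0∞, 1 ≤ m → m ≤ q →
      eLpNorm (𝓕⁻ fun ξ => ψ ((2 : ℝ) ^ (-n) • ξ) * 𝓕 g ξ) q volume ≤
        C * ENNReal.ofReal (2 ^ ((n : ℝ) * (d * (m⁻¹.toReal - q⁻¹.toReal)))) *
          eLpNorm g m volume := by
  set K : Rd d → ℂ := 𝓕⁻ (ψ : Rd d → ℂ) with hK
  have hKS : K = ⇑(𝓕⁻ ψ : 𝓢(Rd d, ℂ)) := (SchwartzMap.fourierInv_coe ψ).symm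
  have hKint : Integrable K := by rw [hKS]; exact (𝓕⁻ ψ : 𝓢(Rd d, ℂ)).integrable
  have hKcont : Continuous K := by rw [hKS]; exact (𝓕⁻ ψ : 𝓢(Rd d, ℂ)).continuous
  obtain ⟨B, hB⟩ : ∃ B : ℝ, ∀ x, ‖K x‖ ≤ B :=
    ⟨_, fun x => by rw [hKS]; exact (𝓕⁻ ψ : 𝓢(Rd d, ℂ)).norm_le_seminorm ℝ x⟩
  have hB0 : 0 ≤ B := (norm_nonneg _).trans (hB 0)
  set C : ℝ≥0 := max (∫ x, ‖K x‖).toNNReal (max B.toNNReal 1) with hC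
  have hC1 : 1 ≤ C := le_max_of_le_right (le_max_right _ _)
  refine ⟨C, fun n g hg m q hm hmq => ?_⟩
  set R : ℝ := 2 ^ n with hR
  have hR0 : 0 < R := by positivity
  have hRinv : (2 : ℝ) ^ (-n) = R⁻¹ := zpow_neg _ _
  rw [hRinv]
  have hψ : Integrable fun ξ => ψ (R⁻¹ • ξ) :=
    ψ.integrable.comp_smul (inv_ne_zero hR0.ne')
  set f : Rd d → ℂ := 𝓕⁻ fun ξ => ψ (R⁻¹ • ξ) * 𝓕 g ξ with hf
  set κ : Rd d → ℝ≥0∞ := fun x => ‖(R ^ d : ℝ) • K (R • x)‖ₑ with hκ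
  have hκm : Measurable κ := by fun_prop
  have hfκ : ∀ x, ‖f x‖ₑ ≤ ∫⁻ y, κ (x - y) * ‖g y‖ₑ := by
    intro x
    rw [hf, fourierInv_mul_fourier_eq_integral hψ hg]
    refine (enorm_integral_le_lintegral_enorm _).trans_eq ?_
    simp only [enorm_mul, fourierInv_comp_inv_smul _ hR0, hκ, hK]
  have hκ1 : ∫⁻ x, κ x ≤ C := by
    have h1 : Integrable fun x => (R ^ d : ℝ) • K (R • x) :=
      (hKint.comp_smul hR0.ne').fun_smul _
    have h2 : ∫ x, ‖(R ^ d : ℝ) • K (R • x)‖ = ∫ x, ‖K x‖ := by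
      have := Measure.integral_comp_smul_of_nonneg volume (fun x => ‖K x‖) R (hR := hR0.le)
      simp only [finrank_euclideanSpace, Fintype.card_fin, smul_eq_mul] at this
      simp only [norm_smul, integral_const_mul, this, norm_pow, Real.norm_of_nonneg hR0.le]
      field_simp
    rw [← ofReal_integral_norm_eq_lintegral_enorm h1, h2]
    exact ENNReal.coe_le_coe.2 (le_max_left _ _)
  have hκtop : ∀ x, κ x ≤ C * ENNReal.ofReal (R ^ d) := by
    intro x
    simp only [hκ, enorm_smul, mul_comm (C : ℝ≥0∞)]
    gcongr
    · rw [Real.enorm_of_nonneg (by positivity)]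
    · rw [← ofReal_norm]
      refine (ENNReal.ofReal_le_ofReal (hB _)).trans (ENNReal.coe_le_coe.2 ?_)
      exact le_max_of_le_right (le_max_left _ _)
  have hCtop : (C : ℝ≥0∞) ≠ ∞ := ENNReal.coe_ne_top
  have hC0 : (C : ℝ≥0∞) ≠ 0 := by simpa using (zero_lt_one.trans_le hC1).ne'
  have hminv : m⁻¹.toReal ≤ 1 := by
    simpa using ENNReal.toReal_mono ENNReal.one_ne_top (ENNReal.inv_le_one.2 hm)
  have hfm : eLpNorm f m volume ≤ C * eLpNorm g m volume := by
    refine (eLpNorm_le_of_enorm_le_lintegral_sub hκm hg.1 hfκ hm).trans ?_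
    gcongr
  have hftop : eLpNorm f ∞ volume ≤
      C * ENNReal.ofReal (R ^ d) ^ m⁻¹.toReal * eLpNorm g m volume := by
    refine (eLpNorm_top_le_of_enorm_le_lintegral_sub hκm hκtop hg.1 hfκ hm).trans ?_
    gcongr ?_ * _
    calc _ ≤ (C : ℝ≥0∞) ^ (1 - m⁻¹.toReal) * (C * ENNReal.ofReal (R ^ d)) ^ m⁻¹.toReal := by
          gcongr
      _ = _ := by
          rw [ENNReal.mul_rpow_of_nonneg _ _ ENNReal.toReal_nonneg, ← mul_assoc,
            ← ENNReal.rpow_add _ _ hC0 hCtop]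
          simp
  have hfcont : AEStronglyMeasurable f volume :=
    (continuous_fourierInv (integrable_mul_fourier hψ hg)).aestronglyMeasurable
  refine (eLpNorm_le_eLpNorm_rpow_mul_eLpNorm_top_rpow hm hmq hfcont).trans ?_
  set θ := m.toReal / q.toReal with hθ
  have hθ0 : 0 ≤ θ := by positivity
  have hθ1 : θ ≤ 1 := by
    rcases eq_or_ne q ∞ with rfl | hq
    · simp [hθ]
    · exact div_le_one_of_le₀ (ENNReal.toReal_mono hq hmq) ENNReal.toReal_nonneg
  have hexp : m⁻¹.toReal * (1 - θ) = m⁻¹.toReal - q⁻¹.toReal := by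
    rcases eq_or_ne q ∞ with rfl | hq
    · simp [hθ]
    · have hm' : m.toReal ≠ 0 :=
        (ENNReal.toReal_pos (zero_lt_one.trans_le hm).ne' (ne_top_of_le_ne_top hq hmq)).ne'
      simp only [hθ, ENNReal.toReal_inv]
      field_simp
  calc _ ≤ (C * eLpNorm g m volume) ^ θ *
        (C * ENNReal.ofReal (R ^ d) ^ m⁻¹.toReal * eLpNorm g m volume) ^ (1 - θ) := by
        gcongr
    _ = (C * eLpNorm g m volume) ^ θ * (C * eLpNorm g m volume) ^ (1 - θ) *
        (ENNReal.ofReal (R ^ d) ^ m⁻¹.toReal) ^ (1 - θ) := by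
        rw [mul_right_comm, ENNReal.mul_rpow_of_nonneg (C * eLpNorm g m volume) _ (by linarith),
          mul_assoc]
    _ = (C * eLpNorm g m volume) *
        ENNReal.ofReal (2 ^ ((n : ℝ) * (d * (m⁻¹.toReal - q⁻¹.toReal)))) := by
        rw [← ENNReal.rpow_add_of_nonneg _ _ hθ0 (by linarith), ← ENNReal.rpow_mul, hexp,
          ENNReal.ofReal_rpow_of_pos (by positivity)]
        congr 2
        · simp
        · rw [hR, ← Real.rpow_natCast, ← Real.rpow_intCast, ← Real.rpow_mul (by positivity),
            ← Real.rpow_mul (by positivity)]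
    _ = _ := by ring

theorem enorm_circle (c : Circle) : ‖(c : ℂ)‖ₑ = 1 := by
  rw [← ofReal_norm, Circle.norm_coe, ENNReal.ofReal_one]

theorem multiplier_tsum {ι : Type*} [Countable ι] {Ψ : Rd d → ℂ} (hΨ : Integrable Ψ)
    {F : ι → Rd d → ℂ} (hF : ∀ i, Integrable (F i))
    (hsum : ∑' i, eLpNorm (F i) 1 volume ≠ ∞) (x : Rd d) :
    𝓕⁻ (fun ξ => Ψ ξ * 𝓕 (fun y => ∑' i, F i y) ξ) x =
      ∑' i, 𝓕⁻ (fun ξ => Ψ ξ * 𝓕 (F i) ξ) x := by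
  have hfour : ∀ ξ, 𝓕 (fun y => ∑' i, F i y) ξ = ∑' i, 𝓕 (F i) ξ := by
    intro ξ
    simp only [Real.fourier_eq, Circle.smul_def, smul_eq_mul, ← tsum_mul_left]
    refine integral_tsum (fun i => ?_) ?_
    · exact (Continuous.aestronglyMeasurable (by fun_prop)).mul (hF i).1
    · simpa [enorm_mul, enorm_circle, eLpNorm_one_eq_lintegral_enorm] using hsum
  simp only [Real.fourierInv_eq, hfour, Circle.smul_def, smul_eq_mul, ← tsum_mul_left]
  refine integral_tsum (fun i => ?_) ?_
  · exact (Continuous.aestronglyMeasurable (by fun_prop)).mul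
      (integrable_mul_fourier hΨ (hF i)).1
  · refine ne_top_of_le_ne_top (ENNReal.mul_ne_top hΨ.2.ne hsum) ?_
    rw [← ENNReal.tsum_mul_left]
    gcongr with i
    rw [← lintegral_mul_const'' _ hΨ.1.enorm]
    refine lintegral_mono fun ξ => ?_
    simp only [enorm_mul, enorm_circle, one_mul]
    gcongr
    rw [Real.fourier_eq, eLpNorm_one_eq_lintegral_enorm]
    refine (enorm_integral_le_lintegral_enorm _).trans_eq ?_
    simp [Circle.smul_def, enorm_mul, enorm_circle]

theorem exists_fourier_ne_zero_of_fourier_mul_ne_zero (f g : 𝓢(Rd d, ℂ)) {ξ : Rd d}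
    (h : 𝓕 (fun x => f x * g x) ξ ≠ 0) :
    ∃ η, 𝓕 (f : Rd d → ℂ) η ≠ 0 ∧ 𝓕 (g : Rd d → ℂ) (ξ - η) ≠ 0 := by
  have hconv := fourierInv_mul_fourier_eq_integral g.integrable (𝓕⁻ f : 𝓢(Rd d, ℂ)).integrable (-ξ)
  have hinv : 𝓕 (⇑(𝓕⁻ f : 𝓢(Rd d, ℂ))) = f := by
    rw [← SchwartzMap.fourier_coe, FourierTransform.fourier_fourierInv_eq]
  rw [hinv, Real.fourierInv_eq_fourier_neg, neg_neg] at hconv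
  have hne : ∫ y, 𝓕⁻ (⇑g) (-ξ - y) * (𝓕⁻ f : 𝓢(Rd d, ℂ)) y ≠ 0 := by
    rw [← hconv]
    simpa only [mul_comm] using h
  obtain ⟨y, hy⟩ : ∃ y, 𝓕⁻ (⇑g) (-ξ - y) * (𝓕⁻ f : 𝓢(Rd d, ℂ)) y ≠ 0 := by
    by_contra! h0
    exact hne (by simp [h0])
  refine ⟨-y, ?_, ?_⟩
  · rw [← Real.fourierInv_eq_fourier_neg, ← SchwartzMap.fourierInv_coe]
    exact right_ne_zero_of_mul hy
  · have := left_ne_zero_of_mul hy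
    rw [Real.fourierInv_eq_fourier_neg] at this
    convert this using 2
    abel

end FourierMultiplier

section LittlewoodPaley

variable {d : ℕ} {φ : Rd d → ℝ}

theorem exists_schwartzMap_eq_ofReal (hφ1 : ContDiff ℝ (⊤ : ℕ∞) φ)
    (hφ3 : ∀ x : Rd d, φ x ≠ 0 → 3/4 ≤ ‖x‖ ∧ ‖x‖ ≤ 8/3) :
    ∃ ψ : 𝓢(Rd d, ℂ), ∀ ξ, ψ ξ = (φ ξ : ℂ) := by
  have hcs : HasCompactSupport fun ξ => (φ ξ : ℂ) := by
    refine HasCompactSupport.intro (isCompact_closedBall (0 : Rd d) (8 / 3)) fun x hx => ?_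
    by_contra h
    exact hx (by simpa using (hφ3 x (by simpa using h)).2)
  exact ⟨hcs.toSchwartzMap (Complex.ofRealCLM.contDiff.comp hφ1), fun ξ => rfl⟩

theorem exists_schwartzMap_eq_LPblock (hφ1 : ContDiff ℝ (⊤ : ℕ∞) φ)
    (hφ3 : ∀ x : Rd d, φ x ≠ 0 → 3/4 ≤ ‖x‖ ∧ ‖x‖ ≤ 8/3) (j : ℤ) (f : 𝓢(Rd d, ℂ)) :
    ∃ g : 𝓢(Rd d, ℂ), ⇑g = LPblock d φ j f ∧
      ∀ ξ, 𝓕 (g : Rd d → ℂ) ξ = (φ ((2 : ℝ) ^ (-j) • ξ) : ℂ) * 𝓕 (f : Rd d → ℂ) ξ := by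
  obtain ⟨ψ, hψ⟩ := exists_schwartzMap_eq_ofReal hφ1 hφ3
  have hgrowth : (fun ξ : Rd d => ψ ((2 : ℝ) ^ (-j) • ξ)).HasTemperateGrowth :=
    ψ.hasTemperateGrowth.comp
      ((2 : ℝ) ^ (-j) • ContinuousLinearMap.id ℝ (Rd d)).hasTemperateGrowth
  set h : 𝓢(Rd d, ℂ) := smulLeftCLM ℂ (fun ξ => ψ ((2 : ℝ) ^ (-j) • ξ)) (𝓕 f) with hh
  have hcoe : ⇑h = fun ξ => (φ ((2 : ℝ) ^ (-j) • ξ) : ℂ) * 𝓕 (f : Rd d → ℂ) ξ := by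
    funext ξ
    rw [hh, smulLeftCLM_apply_apply hgrowth, hψ, SchwartzMap.fourier_coe, smul_eq_mul]
  refine ⟨𝓕⁻ h, ?_, fun ξ => ?_⟩
  · rw [SchwartzMap.fourierInv_coe, hcoe]
    rfl
  · rw [← SchwartzMap.fourier_coe, FourierTransform.fourier_fourierInv_eq, hcoe]

theorem exists_eLpNorm_LPblock_le (hφ1 : ContDiff ℝ (⊤ : ℕ∞) φ)
    (hφ3 : ∀ x : Rd d, φ x ≠ 0 → 3/4 ≤ ‖x‖ ∧ ‖x‖ ≤ 8/3) :
    ∃ C : ℝ≥0, ∀ (n : ℤ) (g : Rd d → ℂ), Integrable g → ∀ m q : ℝ≥0∞, 1 ≤ m → m ≤ q →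
      eLpNorm (LPblock d φ n g) q volume ≤
        C * ENNReal.ofReal (2 ^ ((n : ℝ) * (d * (m⁻¹.toReal - q⁻¹.toReal)))) *
          eLpNorm g m volume := by
  obtain ⟨ψ, hψ⟩ := exists_schwartzMap_eq_ofReal hφ1 hφ3
  simpa only [LPblock, hψ] using exists_eLpNorm_multiplier_le ψ

/-- Bernstein's inequality for Littlewood–Paley blocks of Schwartz functions. -/
theorem exists_eLpNorm_LPblock_le_eLpNorm_LPblock (hφ1 : ContDiff ℝ (⊤ : ℕ∞) φ)
    (hφ3 : ∀ x : Rd d, φ x ≠ 0 → 3/4 ≤ ‖x‖ ∧ ‖x‖ ≤ 8/3) :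
    ∃ C : ℝ≥0, ∀ (k : ℤ) (f : 𝓢(Rd d, ℂ)) (p r : ℝ≥0∞), 1 ≤ p → p ≤ r →
      eLpNorm (LPblock d φ k f) r volume ≤
        C * ENNReal.ofReal (2 ^ ((k : ℝ) * (d * (p⁻¹.toReal - r⁻¹.toReal)))) *
          eLpNorm (LPblock d φ k f) p volume := by
  let χ : ContDiffBump (0 : Rd d) := ⟨8 / 3, 3, by norm_num, by norm_num⟩
  have hχ : HasCompactSupport fun ξ => (χ ξ : ℂ) :=
    χ.hasCompactSupport.comp_left (g := Complex.ofReal) Complex.ofReal_zero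
  obtain ⟨C, hC⟩ := exists_eLpNorm_multiplier_le
    (hχ.toSchwartzMap (Complex.ofRealCLM.contDiff.comp χ.contDiff))
  refine ⟨C, fun k f p r hp hpr => ?_⟩
  obtain ⟨g, hg, hgF⟩ := exists_schwartzMap_eq_LPblock hφ1 hφ3 k f
  rw [← hg]
  have hrep : (𝓕⁻ fun ξ => (χ ((2 : ℝ) ^ (-k) • ξ) : ℂ) * 𝓕 (g : Rd d → ℂ) ξ) = g := by
    have : (fun ξ => (χ ((2 : ℝ) ^ (-k) • ξ) : ℂ) * 𝓕 (g : Rd d → ℂ) ξ) =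
        ⇑(𝓕 g : 𝓢(Rd d, ℂ)) := by
      funext ξ
      rw [SchwartzMap.fourier_coe]
      by_cases h : φ ((2 : ℝ) ^ (-k) • ξ) = 0
      · rw [hgF, h]
        simp
      · rw [χ.one_of_mem_closedBall (by simpa using (hφ3 _ h).2)]
        simp
    rw [this, ← SchwartzMap.fourierInv_coe, FourierTransform.fourierInv_fourier_eq]
  have := hC k g g.integrable p r hp hpr
  change eLpNorm (𝓕⁻ fun ξ => (χ ((2 : ℝ) ^ (-k) • ξ) : ℂ) * 𝓕 (g : Rd d → ℂ) ξ) r volume ≤ _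
    at this
  rwa [hrep] at this

theorem LPblock_mul_LPblock_eq_zero (hφ1 : ContDiff ℝ (⊤ : ℕ∞) φ)
    (hφ3 : ∀ x : Rd d, φ x ≠ 0 → 3/4 ≤ ‖x‖ ∧ ‖x‖ ≤ 8/3) (a b : 𝓢(Rd d, ℂ)) {n j k : ℤ}
    (hkj : k ≤ j - 2) (hnj : ¬ (n - 2 ≤ j ∧ j ≤ n + 5)) :
    LPblock d φ n (fun x => LPblock d φ k a x * LPblock d φ j b x) = 0 := by
  obtain ⟨f, hf, hfF⟩ := exists_schwartzMap_eq_LPblock hφ1 hφ3 k a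
  obtain ⟨g, hg, hgF⟩ := exists_schwartzMap_eq_LPblock hφ1 hφ3 j b
  rw [← hf, ← hg]
  have hpow : ∀ (i : ℤ) (x : Rd d), φ ((2 : ℝ) ^ (-i) • x) ≠ 0 →
      3 / 4 * (2 : ℝ) ^ i ≤ ‖x‖ ∧ ‖x‖ ≤ 8 / 3 * (2 : ℝ) ^ i := by
    intro i x hx
    have h2 : (0 : ℝ) < 2 ^ i := by positivity
    obtain ⟨h3, h4⟩ := hφ3 _ hx
    rw [norm_smul, zpow_neg, norm_inv, Real.norm_of_nonneg h2.le] at h3 h4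
    rw [inv_mul_eq_div, le_div_iff₀ h2] at h3
    rw [inv_mul_eq_div, div_le_iff₀ h2] at h4
    exact ⟨h3, h4⟩
  have hzero : (fun ξ => (φ ((2 : ℝ) ^ (-n) • ξ) : ℂ) * 𝓕 (fun x => f x * g x) ξ) =
      fun _ => 0 := by
    funext ξ
    by_contra hne
    obtain ⟨η, hη, hζ⟩ := exists_fourier_ne_zero_of_fourier_mul_ne_zero f g
      (right_ne_zero_of_mul hne)
    rw [hfF] at hη
    rw [hgF] at hζ
    obtain ⟨h1, h2⟩ := hpow n ξ (by simpa using left_ne_zero_of_mul hne)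
    obtain ⟨-, h3⟩ := hpow k η (by simpa using left_ne_zero_of_mul hη)
    obtain ⟨h4, h5⟩ := hpow j (ξ - η) (by simpa using left_ne_zero_of_mul hζ)
    have hkj2 : (2 : ℝ) ^ k ≤ 2 ^ j / 4 := by
      calc (2 : ℝ) ^ k ≤ 2 ^ (j - 2) := zpow_le_zpow_right₀ one_le_two hkj
        _ = 2 ^ j / 4 := by rw [zpow_sub₀ two_ne_zero]; norm_num
    have h6 : ‖ξ - η‖ ≤ ‖ξ‖ + ‖η‖ := norm_sub_le _ _
    have h7 : ‖ξ‖ ≤ ‖ξ - η‖ + ‖η‖ := by simpa using norm_add_le (ξ - η) η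
    have hj0 : (0 : ℝ) < 2 ^ j := by positivity
    have h8 : (2 : ℝ) ^ j ≤ 2 ^ (n + 5) := by
      rw [zpow_add₀ two_ne_zero]; norm_num; linarith
    have h9 : (2 : ℝ) ^ n < 2 ^ (j + 3) := by
      rw [zpow_add₀ two_ne_zero]; norm_num; linarith
    have h10 := (zpow_le_zpow_iff_right₀ (one_lt_two (α := ℝ))).1 h8
    have h11 := (zpow_lt_zpow_iff_right₀ (one_lt_two (α := ℝ))).1 h9
    exact hnj ⟨by omega, h10⟩
  rw [LPblock, hzero]
  funext x
  simp [Real.fourierInv_eq]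

theorem summable_two_rpow_neg_abs_mul {c : ℝ} (hc : 0 < c) :
    Summable fun k : ℤ => (2 : ℝ) ^ (-|(k : ℝ)| * c) := by
  have hgeom : Summable fun k : ℕ => (2 : ℝ) ^ (-(k : ℝ) * c) := by
    have : Summable fun k : ℕ => ((2 : ℝ) ^ (-c)) ^ k :=
      summable_geometric_of_lt_one (by positivity)
        (Real.rpow_lt_one_of_one_lt_of_neg one_lt_two (by linarith))
    refine this.congr fun k => ?_
    rw [← Real.rpow_natCast, ← Real.rpow_mul zero_le_two]
    ring_nf
  exact Summable.of_nat_of_neg (by simpa using hgeom) (by simpa using hgeom)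

theorem eLpNorm_two_eq_eLpNorm_two_fourier (g : 𝓢(Rd d, ℂ)) :
    eLpNorm g 2 volume = eLpNorm (𝓕 (g : Rd d → ℂ)) 2 volume := by
  have h := SchwartzMap.norm_fourier_toL2_eq g
  rw [SchwartzMap.norm_toLp, SchwartzMap.norm_toLp, SchwartzMap.fourier_coe] at h
  refine ((ENNReal.toReal_eq_toReal_iff' ?_ ?_).1 h).symm
  · have := (𝓕 g : 𝓢(Rd d, ℂ)).eLpNorm_lt_top 2 volume
    rw [SchwartzMap.fourier_coe] at this
    exact this.ne
  · exact (g.eLpNorm_lt_top 2 volume).ne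

theorem tsum_eLpNorm_two_LPblock_ne_top (hd : 1 ≤ d) (hφ1 : ContDiff ℝ (⊤ : ℕ∞) φ)
    (hφ3 : ∀ x : Rd d, φ x ≠ 0 → 3/4 ≤ ‖x‖ ∧ ‖x‖ ≤ 8/3) (f : 𝓢(Rd d, ℂ)) :
    ∑' k : ℤ, eLpNorm (LPblock d φ k f) 2 volume ≠ ∞ := by
  obtain ⟨ψ, hψ⟩ := exists_schwartzMap_eq_ofReal hφ1 hφ3
  obtain ⟨M, hM⟩ : ∃ M : ℝ, ∀ ξ, ‖ψ ξ‖ ≤ M := ⟨_, fun ξ => ψ.norm_le_seminorm ℝ ξ⟩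
  have hM0 : 0 ≤ M := (norm_nonneg _).trans (hM 0)
  obtain ⟨D, hD0, hD⟩ : ∃ D : ℝ, 0 ≤ D ∧ ∀ (k : ℤ) (ξ : Rd d), 3 / 4 * (2 : ℝ) ^ k ≤ ‖ξ‖ →
      ‖𝓕 (f : Rd d → ℂ) ξ‖ ≤ D * min 1 ((2 : ℝ) ^ (-(k : ℝ) * d)) := by
    obtain ⟨D₀, hD₀⟩ : ∃ D : ℝ, ∀ ξ, ‖(𝓕 f : 𝓢(Rd d, ℂ)) ξ‖ ≤ D :=
      ⟨_, fun ξ => (𝓕 f : 𝓢(Rd d, ℂ)).norm_le_seminorm ℝ ξ⟩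
    obtain ⟨D₁, hD₁⟩ : ∃ D : ℝ, ∀ ξ, ‖ξ‖ ^ d * ‖(𝓕 f : 𝓢(Rd d, ℂ)) ξ‖ ≤ D :=
      ⟨_, fun ξ => (𝓕 f : 𝓢(Rd d, ℂ)).norm_pow_mul_le_seminorm ℝ d ξ⟩
    have hD₀0 : 0 ≤ D₀ := (norm_nonneg _).trans (hD₀ 0)
    have hD₁0 : 0 ≤ D₁ := le_trans (by positivity) (hD₁ 0)
    refine ⟨D₀ + D₁ * (4 / 3) ^ d, by positivity, fun k ξ hξ => ?_⟩
    rw [← SchwartzMap.fourier_coe, mul_min_of_nonneg _ _ (by positivity), mul_one]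
    refine le_min ((hD₀ ξ).trans (le_add_of_nonneg_right (by positivity))) ?_
    have hk : (0 : ℝ) < 3 / 4 * 2 ^ k := by positivity
    have h1 : (3 / 4 * (2 : ℝ) ^ k) ^ d * ‖(𝓕 f : 𝓢(Rd d, ℂ)) ξ‖ ≤ D₁ :=
      le_trans (by gcongr) (hD₁ ξ)
    have h2 : (2 : ℝ) ^ (-(k : ℝ) * d) = (((2 : ℝ) ^ k) ^ d)⁻¹ := by
      rw [Real.rpow_mul zero_le_two, Real.rpow_natCast, Real.rpow_neg zero_le_two,
        Real.rpow_intCast, inv_pow]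
    calc ‖(𝓕 f : 𝓢(Rd d, ℂ)) ξ‖ ≤ D₁ * ((3 / 4 * (2 : ℝ) ^ k) ^ d)⁻¹ := by
          rw [← div_eq_mul_inv, le_div_iff₀ (by positivity), mul_comm]
          exact h1
      _ = D₁ * (4 / 3) ^ d * (2 : ℝ) ^ (-(k : ℝ) * d) := by
          rw [h2, mul_pow, mul_inv, ← inv_pow (3 / 4 : ℝ)]
          norm_num
          ring
      _ ≤ _ := by
          gcongr
          exact le_add_of_nonneg_left hD₀0
  set V : ℝ≥0∞ := volume (Metric.ball (0 : Rd d) 1) with hV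
  have hVtop : V ≠ ∞ := measure_ball_lt_top.ne
  set L : ℝ≥0∞ := ENNReal.ofReal (M * D) *
    (ENNReal.ofReal ((8 / 3) ^ d) * V) ^ (1 / 2 : ℝ) with hL
  have hLtop : L ≠ ∞ := by
    refine ENNReal.mul_ne_top ENNReal.ofReal_ne_top (ENNReal.rpow_ne_top_of_nonneg (by norm_num) ?_)
    exact ENNReal.mul_ne_top ENNReal.ofReal_ne_top hVtop
  have hbound : ∀ k : ℤ, eLpNorm (LPblock d φ k f) 2 volume ≤
      L * ENNReal.ofReal ((2 : ℝ) ^ (-|(k : ℝ)| * (1 / 2))) := by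
    intro k
    obtain ⟨g, hg, hgF⟩ := exists_schwartzMap_eq_LPblock hφ1 hφ3 k f
    set c : ℝ := min 1 ((2 : ℝ) ^ (-(k : ℝ) * d)) with hc
    have hc0 : 0 ≤ c := le_min zero_le_one (by positivity)
    have h2k : (0 : ℝ) < 2 ^ k := by positivity
    rw [← hg, eLpNorm_two_eq_eLpNorm_two_fourier]
    have hle : ∀ ξ, ‖𝓕 (g : Rd d → ℂ) ξ‖ ≤
        ‖(Metric.closedBall (0 : Rd d) (8 / 3 * 2 ^ k)).indicator
          (fun _ => M * (D * c)) ξ‖ := by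
      intro ξ
      by_cases h : φ ((2 : ℝ) ^ (-k) • ξ) = 0
      · rw [hgF, h]
        simp
      obtain ⟨h3, h4⟩ := hφ3 _ h
      rw [norm_smul, zpow_neg, norm_inv, Real.norm_of_nonneg h2k.le] at h3 h4
      rw [inv_mul_eq_div, le_div_iff₀ h2k] at h3
      rw [inv_mul_eq_div, div_le_iff₀ h2k] at h4
      rw [Set.indicator_of_mem (by simpa using h4), hgF, norm_mul,
        Real.norm_of_nonneg (by positivity)]
      gcongr
      · rw [← hψ]
        exact hM _
      · exact hD k ξ h3
    refine (eLpNorm_mono hle).trans ?_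
    rw [eLpNorm_indicator_const Metric.isClosed_closedBall.measurableSet two_ne_zero
      ENNReal.ofNat_ne_top, Measure.addHaar_closedBall _ _ (by positivity), ← hV,
      finrank_euclideanSpace, Fintype.card_fin, Real.enorm_of_nonneg (by positivity)]
    have hsplit : ENNReal.ofReal ((8 / 3 * (2 : ℝ) ^ k) ^ d) * V =
        (ENNReal.ofReal ((8 / 3) ^ d) * V) * ENNReal.ofReal ((2 : ℝ) ^ ((k : ℝ) * d)) := by
      rw [mul_pow, ENNReal.ofReal_mul (by positivity), Real.rpow_mul zero_le_two,
        Real.rpow_natCast, Real.rpow_intCast]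
      ring
    have hreal : c * (2 : ℝ) ^ ((k : ℝ) * d * (1 / 2)) ≤ 2 ^ (-|(k : ℝ)| * (1 / 2)) := by
      have hd' : (1 : ℝ) ≤ d := by exact_mod_cast hd
      rcases le_total 0 (k : ℝ) with hk | hk
      · rw [abs_of_nonneg hk]
        calc _ ≤ (2 : ℝ) ^ (-(k : ℝ) * d) * (2 : ℝ) ^ ((k : ℝ) * d * (1 / 2)) := by
              gcongr; exact min_le_right _ _
          _ = (2 : ℝ) ^ (-(k : ℝ) * d + (k : ℝ) * d * (1 / 2)) :=
              (Real.rpow_add two_pos _ _).symm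
          _ ≤ _ := Real.rpow_le_rpow_of_exponent_le one_le_two (by nlinarith)
      · rw [abs_of_nonpos hk]
        calc _ ≤ 1 * (2 : ℝ) ^ ((k : ℝ) * d * (1 / 2)) := by
              gcongr; exact min_le_left _ _
          _ = (2 : ℝ) ^ ((k : ℝ) * d * (1 / 2)) := one_mul _
          _ ≤ _ := Real.rpow_le_rpow_of_exponent_le one_le_two (by nlinarith)
    rw [hsplit, ENNReal.mul_rpow_of_nonneg _ _ (by positivity), ← mul_assoc M,
      ENNReal.ofReal_mul (by positivity), ENNReal.ofReal_rpow_of_pos (by positivity),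
      ← Real.rpow_mul zero_le_two, ENNReal.toReal_ofNat]
    calc _ = L * (ENNReal.ofReal c * ENNReal.ofReal (2 ^ ((k : ℝ) * d * (1 / 2)))) := by
          rw [hL]; ring
      _ ≤ _ := by
          rw [← ENNReal.ofReal_mul hc0]
          gcongr
  refine ne_top_of_le_ne_top ?_ (ENNReal.tsum_le_tsum hbound)
  rw [ENNReal.tsum_mul_left]
  exact ENNReal.mul_ne_top hLtop (summable_two_rpow_neg_abs_mul (by norm_num)).tsum_ofReal_ne_top

end LittlewoodPaley

section Paraproduct

variable {d : ℕ} {φ : Rd d → ℝ}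

/-- The elementary product `Δ_k a · Δ_j b`, `k ≤ j - 2`, of the paraproduct, indexed by `(j, k)`. -/
def paraTerm (φ : Rd d → ℝ) (a b : Rd d → ℂ) (i : ℤ × ℤ) : Rd d → ℂ :=
  fun x => if i.2 ≤ i.1 - 2 then LPblock d φ i.2 a x * LPblock d φ i.1 b x else 0

theorem integrable_paraTerm (hφ1 : ContDiff ℝ (⊤ : ℕ∞) φ)
    (hφ3 : ∀ x : Rd d, φ x ≠ 0 → 3/4 ≤ ‖x‖ ∧ ‖x‖ ≤ 8/3) (a b : 𝓢(Rd d, ℂ)) (i : ℤ × ℤ) :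
    Integrable (paraTerm φ a b i) := by
  obtain ⟨f, hf, -⟩ := exists_schwartzMap_eq_LPblock hφ1 hφ3 i.2 a
  obtain ⟨g, hg, -⟩ := exists_schwartzMap_eq_LPblock hφ1 hφ3 i.1 b
  simp only [funext_iff] at hf hg
  unfold paraTerm
  split_ifs with h
  · simp only [← hf, ← hg]
    exact (f.memLp 2).integrable_mul (g.memLp 2)
  · exact integrable_zero _ _ _

theorem eLpNorm_paraTerm_le (hφ1 : ContDiff ℝ (⊤ : ℕ∞) φ)
    (hφ3 : ∀ x : Rd d, φ x ≠ 0 → 3/4 ≤ ‖x‖ ∧ ‖x‖ ≤ 8/3) (a b : 𝓢(Rd d, ℂ)) (i : ℤ × ℤ)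
    {p r m : ℝ≥0∞} [hprm : r.HolderTriple p m] :
    eLpNorm (paraTerm φ a b i) m volume ≤
      eLpNorm (LPblock d φ i.2 a) r volume * eLpNorm (LPblock d φ i.1 b) p volume := by
  obtain ⟨f, hf, -⟩ := exists_schwartzMap_eq_LPblock hφ1 hφ3 i.2 a
  obtain ⟨g, hg, -⟩ := exists_schwartzMap_eq_LPblock hφ1 hφ3 i.1 b
  unfold paraTerm
  split_ifs with h
  · rw [← hf, ← hg]
    have := eLpNorm_smul_le_mul_eLpNorm (p := r) (q := p) (r := m) (μ := volume)
      g.continuous.aestronglyMeasurable f.continuous.aestronglyMeasurable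
    rwa [smul_eq_mul] at this
  · simp

theorem tsum_eLpNorm_one_paraTerm_ne_top (hd : 1 ≤ d) (hφ1 : ContDiff ℝ (⊤ : ℕ∞) φ)
    (hφ3 : ∀ x : Rd d, φ x ≠ 0 → 3/4 ≤ ‖x‖ ∧ ‖x‖ ≤ 8/3) (a b : 𝓢(Rd d, ℂ)) :
    ∑' i, eLpNorm (paraTerm φ a b i) 1 volume ≠ ∞ := by
  refine ne_top_of_le_ne_top ?_
    (ENNReal.tsum_le_tsum fun i => eLpNorm_paraTerm_le hφ1 hφ3 a b i (p := 2) (r := 2))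
  rw [ENNReal.tsum_prod (f := fun j k =>
    eLpNorm (LPblock d φ k a) 2 volume * eLpNorm (LPblock d φ j b) 2 volume)]
  simp only [ENNReal.tsum_mul_right, ENNReal.tsum_mul_left]
  exact ENNReal.mul_ne_top (tsum_eLpNorm_two_LPblock_ne_top hd hφ1 hφ3 a)
    (tsum_eLpNorm_two_LPblock_ne_top hd hφ1 hφ3 b)

theorem para_ae_eq_tsum_paraTerm (hd : 1 ≤ d) (hφ1 : ContDiff ℝ (⊤ : ℕ∞) φ)
    (hφ3 : ∀ x : Rd d, φ x ≠ 0 → 3/4 ≤ ‖x‖ ∧ ‖x‖ ≤ 8/3) (a b : 𝓢(Rd d, ℂ)) :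
    para d φ a b =ᵐ[volume] fun x => ∑' i, paraTerm φ a b i x := by
  filter_upwards [summable_norm_of_tsum_eLpNorm_ne_top le_rfl
    (fun i => (integrable_paraTerm hφ1 hφ3 a b i).aestronglyMeasurable)
    (tsum_eLpNorm_one_paraTerm_ne_top hd hφ1 hφ3 a b)] with x hx
  rw [hx.of_norm.tsum_prod]
  refine tsum_congr fun j => ?_
  rw [lowFreq, ← tsum_mul_right]
  simp only [paraTerm, ite_mul, zero_mul]

theorem eLpNorm_LPblock_para_le (hd : 1 ≤ d) (hφ1 : ContDiff ℝ (⊤ : ℕ∞) φ)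
    (hφ3 : ∀ x : Rd d, φ x ≠ 0 → 3/4 ≤ ‖x‖ ∧ ‖x‖ ≤ 8/3) (a b : 𝓢(Rd d, ℂ)) (n : ℤ)
    {q : ℝ≥0∞} (hq : 1 ≤ q) :
    eLpNorm (LPblock d φ n (para d φ a b)) q volume ≤
      ∑' i, eLpNorm (LPblock d φ n (paraTerm φ a b i)) q volume := by
  obtain ⟨ψ, hψ⟩ := exists_schwartzMap_eq_ofReal hφ1 hφ3
  have hΨ : Integrable fun ξ : Rd d => (φ ((2 : ℝ) ^ (-n) • ξ) : ℂ) := by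
    simpa only [hψ] using ψ.integrable.comp_smul (R := (2 : ℝ) ^ (-n)) (by positivity)
  have hint := integrable_paraTerm hφ1 hφ3 a b
  have heq : LPblock d φ n (para d φ a b) =
      fun x => ∑' i, LPblock d φ n (paraTerm φ a b i) x := by
    funext x
    simp only [LPblock, Real.fourier_congr_ae (para_ae_eq_tsum_paraTerm hd hφ1 hφ3 a b)]
    exact multiplier_tsum hΨ hint (tsum_eLpNorm_one_paraTerm_ne_top hd hφ1 hφ3 a b) x
  rw [heq]
  exact eLpNorm_tsum_le hq fun i =>
    (continuous_fourierInv (integrable_mul_fourier hΨ (hint i))).aestronglyMeasurable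

theorem LPblock_paraTerm_eq_zero (hφ1 : ContDiff ℝ (⊤ : ℕ∞) φ)
    (hφ3 : ∀ x : Rd d, φ x ≠ 0 → 3/4 ≤ ‖x‖ ∧ ‖x‖ ≤ 8/3) (a b : 𝓢(Rd d, ℂ)) {n : ℤ} {i : ℤ × ℤ}
    (hi : ¬ (i.2 ≤ i.1 - 2 ∧ n - 2 ≤ i.1 ∧ i.1 ≤ n + 5)) :
    LPblock d φ n (paraTerm φ a b i) = 0 := by
  by_cases h : i.2 ≤ i.1 - 2
  · rw [show paraTerm φ a b i = fun x => LPblock d φ i.2 a x * LPblock d φ i.1 b x from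
      funext fun x => if_pos h]
    exact LPblock_mul_LPblock_eq_zero hφ1 hφ3 a b h fun h' => hi ⟨h, h'⟩
  · funext x
    simp [paraTerm, h, LPblock, Real.fourierInv_eq, Real.fourier_eq]

theorem eLpNorm_LPblock_le_besovNorm (s : ℝ) (p : ℝ≥0∞) (f : Rd d → ℂ) (j : ℤ) :
    eLpNorm (LPblock d φ j f) p volume ≤
      ENNReal.ofReal ((2 : ℝ) ^ (-(j : ℝ) * s)) * besovNorm d φ s p ∞ f := by
  have h : ENNReal.ofReal ((2 : ℝ) ^ ((j : ℝ) * s)) * eLpNorm (LPblock d φ j f) p volume ≤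
      besovNorm d φ s p ∞ f := by
    rw [besovNorm, seqNorm, if_pos rfl]
    exact le_iSup (fun j : ℤ =>
      ENNReal.ofReal ((2 : ℝ) ^ ((j : ℝ) * s)) * eLpNorm (LPblock d φ j f) p volume) j
  refine le_trans (le_of_eq ?_) (mul_le_mul_right h _)
  rw [← mul_assoc, ← ENNReal.ofReal_mul (by positivity), ← Real.rpow_add two_pos]
  simp

/-- Geometric decay in the low frequency `k` makes the sum over the pairs `(j, k)` that interact
with the dyadic level `n` bounded uniformly in `n`. -/
theorem exists_tsum_ofReal_two_rpow_le (t : ℝ) {δ : ℝ} (hδ : 0 < δ) :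
    ∃ S : ℝ≥0, ∀ n : ℤ, ∑' i : ℤ × ℤ,
      (if i.2 ≤ i.1 - 2 ∧ n - 2 ≤ i.1 ∧ i.1 ≤ n + 5 then
        ENNReal.ofReal ((2 : ℝ) ^ (-((i.1 : ℝ) - n) * t + ((i.2 : ℝ) - n) * δ)) else 0) ≤ S := by
  let u : ℤ → ℝ≥0∞ := fun l =>
    if l ∈ Finset.Icc (-2 : ℤ) 5 then ENNReal.ofReal ((2 : ℝ) ^ (-(l : ℝ) * t)) else 0
  let v : ℤ → ℝ≥0∞ := fun l =>
    ENNReal.ofReal ((2 : ℝ) ^ (6 * δ)) * ENNReal.ofReal ((2 : ℝ) ^ (-|(l : ℝ)| * δ))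
  have hu : ∑' l, u l ≠ ∞ := by
    rw [tsum_eq_sum (s := Finset.Icc (-2 : ℤ) 5) fun l hl => if_neg hl]
    refine (ENNReal.sum_lt_top.2 fun l hl => ?_).ne
    simp only [if_pos hl, ENNReal.ofReal_lt_top]
  have hv : ∑' l, v l ≠ ∞ := by
    rw [ENNReal.tsum_mul_left]
    exact ENNReal.mul_ne_top ENNReal.ofReal_ne_top
      (summable_two_rpow_neg_abs_mul hδ).tsum_ofReal_ne_top
  refine ⟨((∑' l, u l) * ∑' l, v l).toNNReal, fun n => ?_⟩
  rw [ENNReal.coe_toNNReal (ENNReal.mul_ne_top hu hv)]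
  calc _ ≤ ∑' i : ℤ × ℤ, u (i.1 - n) * v (i.2 - n) := by
        refine ENNReal.tsum_le_tsum fun i => ?_
        split_ifs with h
        · obtain ⟨h1, h2, h3⟩ := h
          have hk : ((i.2 - n : ℤ) : ℝ) ≤ 3 := by exact_mod_cast (by omega : i.2 - n ≤ 3)
          simp only [u, v]
          rw [if_pos (Finset.mem_Icc.2 ⟨by omega, by omega⟩), ← ENNReal.ofReal_mul (by positivity),
            ← ENNReal.ofReal_mul (by positivity), ← Real.rpow_add two_pos, ← Real.rpow_add two_pos]
          refine ENNReal.ofReal_le_ofReal (Real.rpow_le_rpow_of_exponent_le one_le_two ?_)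
          have habs : ((i.2 - n : ℤ) : ℝ) ≤ 6 - |((i.2 - n : ℤ) : ℝ)| := by
            rcases abs_cases ((i.2 - n : ℤ) : ℝ) with h | h <;> linarith
          push_cast at habs ⊢
          nlinarith [mul_le_mul_of_nonneg_right habs hδ.le]
        · exact zero_le
    _ = (∑' l, u (l - n)) * ∑' l, v (l - n) := by
        rw [ENNReal.tsum_prod (f := fun j k => u (j - n) * v (k - n))]
        simp only [ENNReal.tsum_mul_left, ENNReal.tsum_mul_right]
    _ ≤ _ := by
        exact (congrArg₂ _ ((Equiv.subRight n).tsum_eq u) ((Equiv.subRight n).tsum_eq v)).le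

end Paraproduct

/-- Paraproduct estimate: for 1 ≤ p,q ≤ ∞ with k₁ > d·max(0, 1/q − 1/p) and p ≤ 2q,
‖T_a b‖_{Ḃ^{s−k+d/q−d/p}_{q,∞}} ≲ ‖a‖_{Ḃ^{d/p−k₁}_{p,∞}}·‖b‖_{Ḃ^{s−k₂}_{p,∞}}
for Schwartz functions a, b (k = k₁ + k₂). -/
theorem paraproduct_estimate
    (d : ℕ) (hd : 1 ≤ d) (φ : Rd d → ℝ)
    (hφ1 : ContDiff ℝ (⊤ : ℕ∞) φ)
    (hφ2 : ∀ x y : Rd d, ‖x‖ = ‖y‖ → φ x = φ y)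
    (hφ3 : ∀ x : Rd d, φ x ≠ 0 → 3/4 ≤ ‖x‖ ∧ ‖x‖ ≤ 8/3)
    (hφ4 : ∀ ξ : Rd d, ξ ≠ 0 → ∑' j : ℤ, φ (((2:ℝ) ^ (-j)) • ξ) = 1)
    (p q : ℝ≥0∞) (hp : 1 ≤ p) (hq : 1 ≤ q)
    (s k₁ k₂ : ℝ)
    (hk₁ : (d : ℝ) * max 0 ((1/q).toReal - (1/p).toReal) < k₁)
    (hpq : p ≤ 2 * q) :
    ∃ C : ℝ, 0 < C ∧ ∀ a b : 𝓢(Rd d, ℂ),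
      besovNorm d φ (s - (k₁ + k₂) + (d : ℝ) * (1/q).toReal - (d : ℝ) * (1/p).toReal) q ∞
          (para d φ a b)
        ≤ ENNReal.ofReal C
            * besovNorm d φ ((d : ℝ) * (1/p).toReal - k₁) p ∞ a
            * besovNorm d φ (s - k₂) p ∞ b := by
  obtain ⟨C₁, hC₁⟩ := exists_eLpNorm_LPblock_le hφ1 hφ3
  obtain ⟨C₂, hC₂⟩ := exists_eLpNorm_LPblock_le_eLpNorm_LPblock hφ1 hφ3
  simp only [one_div] at hk₁ ⊢
  set r : ℝ≥0∞ := (q⁻¹ - p⁻¹)⁻¹ with hr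
  set m : ℝ≥0∞ := min p q with hm
  have hq' : q⁻¹ ≠ ∞ := ENNReal.inv_ne_top.2 (zero_lt_one.trans_le hq).ne'
  have hp' : p⁻¹ ≠ ∞ := ENNReal.inv_ne_top.2 (zero_lt_one.trans_le hp).ne'
  have hr' : r⁻¹ ≠ ∞ := by rw [hr, inv_inv]; exact ENNReal.sub_ne_top hq'
  have hholder : r⁻¹ + p⁻¹ = m⁻¹ := by
    rw [hr, inv_inv, tsub_add_eq_max, hm]
    rcases le_total p q with h | h
    · rw [min_eq_left h, max_eq_right (ENNReal.inv_le_inv.2 h)]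
    · rw [min_eq_right h, max_eq_left (ENNReal.inv_le_inv.2 h)]
  have : r.HolderTriple p m := ⟨hholder⟩
  have hm1 : 1 ≤ m := le_min hp hq
  have hpr : p ≤ r := by
    rw [← ENNReal.inv_le_inv, hr, inv_inv, tsub_le_iff_right, ← two_mul, ← div_eq_mul_inv]
    rw [ENNReal.inv_le_iff_inv_le, ENNReal.inv_div (by simp) (by simp)]
    exact ENNReal.div_le_of_le_mul' hpq
  have hmreal : m⁻¹.toReal = r⁻¹.toReal + p⁻¹.toReal := by
    rw [← hholder, ENNReal.toReal_add hr' hp']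
  have hrreal : r⁻¹.toReal = max 0 (q⁻¹.toReal - p⁻¹.toReal) := by
    rw [hr, inv_inv]
    rcases le_total p⁻¹ q⁻¹ with h | h
    · rw [ENNReal.toReal_sub_of_le h hq', max_eq_right]
      exact sub_nonneg.2 (ENNReal.toReal_mono hq' h)
    · rw [tsub_eq_zero_of_le h, max_eq_left, ENNReal.toReal_zero]
      exact sub_nonpos.2 (ENNReal.toReal_mono hp' h)
  rw [← hrreal] at hk₁
  obtain ⟨S, hS⟩ := exists_tsum_ofReal_two_rpow_le (s - k₂) (sub_pos.2 hk₁)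
  refine ⟨C₁ * C₂ * S + 1, by positivity, fun a b => ?_⟩
  set A := besovNorm d φ ((d : ℝ) * p⁻¹.toReal - k₁) p ∞ a
  set B := besovNorm d φ (s - k₂) p ∞ b
  set σ : ℝ := s - (k₁ + k₂) + (d : ℝ) * q⁻¹.toReal - (d : ℝ) * p⁻¹.toReal with hσ
  rw [besovNorm, seqNorm, if_pos rfl]
  refine iSup_le fun n => ?_
  have hterm : ∀ i : ℤ × ℤ, eLpNorm (LPblock d φ n (paraTerm φ a b i)) q volume ≤
      (C₁ * C₂ * A * B * ENNReal.ofReal ((2 : ℝ) ^ (-(n : ℝ) * σ))) *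
        (if i.2 ≤ i.1 - 2 ∧ n - 2 ≤ i.1 ∧ i.1 ≤ n + 5 then ENNReal.ofReal ((2 : ℝ) ^
          (-((i.1 : ℝ) - n) * (s - k₂) + ((i.2 : ℝ) - n) * (k₁ - d * r⁻¹.toReal))) else 0) := by
    intro i
    split_ifs with hi
    swap
    · simp [LPblock_paraTerm_eq_zero hφ1 hφ3 a b hi]
    calc _ ≤ C₁ * ENNReal.ofReal (2 ^ ((n : ℝ) * (d * (m⁻¹.toReal - q⁻¹.toReal)))) *
          ((C₂ * ENNReal.ofReal (2 ^ ((i.2 : ℝ) * (d * (p⁻¹.toReal - r⁻¹.toReal)))) *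
            (ENNReal.ofReal (2 ^ (-(i.2 : ℝ) * (d * p⁻¹.toReal - k₁))) * A)) *
            (ENNReal.ofReal (2 ^ (-(i.1 : ℝ) * (s - k₂))) * B)) := by
          refine (hC₁ n _ (integrable_paraTerm hφ1 hφ3 a b i) m q hm1 (min_le_right _ _)).trans ?_
          refine mul_le_mul_right ((eLpNorm_paraTerm_le hφ1 hφ3 a b i (p := p) (r := r)).trans ?_) _
          refine mul_le_mul' ((hC₂ i.2 a p r hp hpr).trans (mul_le_mul_right ?_ _)) ?_
          · exact eLpNorm_LPblock_le_besovNorm _ _ _ _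
          · exact eLpNorm_LPblock_le_besovNorm _ _ _ _
      _ = C₁ * C₂ * A * B * (ENNReal.ofReal (2 ^ ((n : ℝ) * (d * (m⁻¹.toReal - q⁻¹.toReal)))) *
            ENNReal.ofReal (2 ^ ((i.2 : ℝ) * (d * (p⁻¹.toReal - r⁻¹.toReal)))) *
            ENNReal.ofReal (2 ^ (-(i.2 : ℝ) * (d * p⁻¹.toReal - k₁))) *
            ENNReal.ofReal (2 ^ (-(i.1 : ℝ) * (s - k₂)))) := by ring
      _ = _ := by
          rw [mul_assoc (_ * B)]
          congr 1
          rw [← ENNReal.ofReal_mul (by positivity), ← ENNReal.ofReal_mul (by positivity),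
            ← ENNReal.ofReal_mul (by positivity), ← ENNReal.ofReal_mul (by positivity),
            ← Real.rpow_add two_pos, ← Real.rpow_add two_pos, ← Real.rpow_add two_pos,
            ← Real.rpow_add two_pos, hmreal, hσ]
          ring_nf
  have hCS : (C₁ * C₂ * S : ℝ≥0∞) ≤ ENNReal.ofReal (C₁ * C₂ * S + 1) := by
    rw [← ENNReal.ofReal_coe_nnreal (p := C₁), ← ENNReal.ofReal_coe_nnreal (p := C₂),
      ← ENNReal.ofReal_coe_nnreal (p := S), ← ENNReal.ofReal_mul (by positivity),
      ← ENNReal.ofReal_mul (by positivity)]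
    exact ENNReal.ofReal_le_ofReal (by linarith)
  calc _ ≤ ENNReal.ofReal ((2 : ℝ) ^ ((n : ℝ) * σ)) *
        ((C₁ * C₂ * A * B * ENNReal.ofReal ((2 : ℝ) ^ (-(n : ℝ) * σ))) * S) := by
        refine mul_le_mul_right ((eLpNorm_LPblock_para_le hd hφ1 hφ3 a b n hq).trans
          ((ENNReal.tsum_le_tsum hterm).trans ?_)) _
        rw [ENNReal.tsum_mul_left]
        exact mul_le_mul_right (hS n) _
    _ = (C₁ * C₂ * S) * A * B * (ENNReal.ofReal ((2 : ℝ) ^ ((n : ℝ) * σ)) *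
          ENNReal.ofReal ((2 : ℝ) ^ (-(n : ℝ) * σ))) := by ring
    _ = (C₁ * C₂ * S) * A * B := by
        rw [← ENNReal.ofReal_mul (by positivity), ← Real.rpow_add two_pos]
        simp
    _ ≤ _ := by gcongr
end
end

section
/- Let d ≥ 3 and let 1 ≤ q ≤ p ≤ 2q with p < d and 1/q < 1/p + 2/d. Then there exists a constant C > 0 such that for all Schwartz functions a, b on ℝ^d, ‖ab‖_{Ḃ^{d/q−2}_{q,∞}} ≤ C·( ‖a‖_{Ḃ^{d/p−2}_{p,∞}}·‖b‖_{Ḃ^{d/p}_{p,∞}} + ‖b‖_{Ḃ^{d/p−2}_{p,∞}}·‖a‖_{Ḃ^{d/p}_{p,∞}} ). -/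
open MeasureTheory SchwartzMap Real
open scoped FourierTransform ENNReal NNReal

noncomputable section

section Convolution

variable {d : ℕ}

/-- Jensen's inequality with respect to the (unnormalized) weight `K`. -/
theorem lintegral_mul_rpow_le {α : Type*} [MeasurableSpace α] {μ : Measure α} {K f : α → ℝ≥0∞}
    (hK : AEMeasurable K μ) (hf : AEMeasurable f μ) {p : ℝ} (hp : 1 ≤ p) :
    (∫⁻ y, K y * f y ∂μ) ^ p ≤ (∫⁻ y, K y ∂μ) ^ (p - 1) * ∫⁻ y, K y * f y ^ p ∂μ := by
  have hp0 : 0 < p := by linarith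
  have hinv : p⁻¹ ≤ 1 := inv_le_one_of_one_le₀ hp
  have h := ENNReal.lintegral_mul_norm_pow_le (μ := μ) hK (hK.mul (hf.pow_const p))
    (p := 1 - p⁻¹) (q := p⁻¹) (by linarith) (by positivity) (by ring)
  have heq : ∀ y, K y ^ (1 - p⁻¹) * (K * fun x => f x ^ p) y ^ p⁻¹ = K y * f y := by
    intro y
    rw [Pi.mul_apply, ENNReal.mul_rpow_of_nonneg _ _ (by positivity), ← mul_assoc,
      ← ENNReal.rpow_add_of_nonneg _ _ (by linarith) (by positivity), ENNReal.rpow_rpow_inv hp0.ne']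
    simp
  simp only [heq] at h
  calc _ ≤ _ := ENNReal.rpow_le_rpow h hp0.le
    _ = _ := by
      rw [ENNReal.mul_rpow_of_nonneg _ _ hp0.le, ← ENNReal.rpow_mul, ENNReal.rpow_inv_rpow hp0.ne']
      congr 2
      field_simp

/-- Interpolation between `L^p` and `L^∞`. -/
theorem eLpNorm_le_of_lintegral_rpow_le_of_rpow_le {α : Type*} [MeasurableSpace α] {μ : Measure α}
    {g : α → ℂ} {p : ℝ} (hp : 0 < p) {M N : ℝ≥0∞} (hM' : M ≠ ∞) (hM : ∀ x, ‖g x‖ₑ ^ p ≤ M)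
    (hN : ∫⁻ x, ‖g x‖ₑ ^ p ∂μ ≤ N) {θ : ℝ} (hθ0 : 0 ≤ θ) (hθ : θ ≤ p⁻¹) :
    eLpNorm g (ENNReal.ofReal θ)⁻¹ μ ≤ M ^ (p⁻¹ - θ) * N ^ θ := by
  rcases hθ0.eq_or_lt with rfl | hθpos
  · simp only [ENNReal.ofReal_zero, ENNReal.inv_zero, sub_zero, ENNReal.rpow_zero, mul_one,
      eLpNorm_exponent_top]
    refine eLpNormEssSup_le_of_ae_enorm_bound (.of_forall fun x => ?_)
    rw [ENNReal.le_rpow_inv_iff hp]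
    exact hM x
  · rw [← ENNReal.ofReal_inv_of_pos hθpos, eLpNorm_eq_lintegral_rpow_enorm_toReal (by simpa)
      ENNReal.ofReal_ne_top, ENNReal.toReal_ofReal (by positivity), one_div, inv_inv]
    have hr : 0 ≤ θ⁻¹ / p - 1 := by
      rw [sub_nonneg, one_le_div hp]
      exact (le_inv_comm₀ hp hθpos).2 hθ
    have hpt : ∀ x, ‖g x‖ₑ ^ θ⁻¹ ≤ M ^ (θ⁻¹ / p - 1) * ‖g x‖ₑ ^ p := by
      intro x
      calc ‖g x‖ₑ ^ θ⁻¹ = (‖g x‖ₑ ^ p) ^ (θ⁻¹ / p - 1) * ‖g x‖ₑ ^ p := by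
            rw [← ENNReal.rpow_mul, ← ENNReal.rpow_add_of_nonneg _ _ (by positivity) hp.le]
            congr 1
            field_simp
            ring
        _ ≤ _ := by gcongr; exact hM x
    have hgN : ∫⁻ x, ‖g x‖ₑ ^ θ⁻¹ ∂μ ≤ M ^ (θ⁻¹ / p - 1) * N := by
      calc _ ≤ ∫⁻ x, M ^ (θ⁻¹ / p - 1) * ‖g x‖ₑ ^ p ∂μ := lintegral_mono hpt
        _ = _ := lintegral_const_mul' _ _ (ENNReal.rpow_ne_top_of_nonneg hr hM')
        _ ≤ _ := by gcongr
    calc _ ≤ (M ^ (θ⁻¹ / p - 1) * N) ^ θ := by gcongr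
      _ = _ := by
        rw [ENNReal.mul_rpow_of_nonneg _ _ hθ0, ← ENNReal.rpow_mul]
        congr 2
        field_simp

theorem eLpNorm_convolution_le {K f g : Rd d → ℂ} (hK : Continuous K) (hf : Continuous f)
    (hg : ∀ x, g x = ∫ y, K y * f (x - y)) {p : ℝ} (hp : 1 ≤ p)
    (hfp : MemLp f (ENNReal.ofReal p)) {c w : ℝ≥0∞} (hc : c ≠ ∞) (hw : w ≠ ∞)
    (hc1 : ∫⁻ y, ‖K y‖ₑ ≤ c) (hcs : ∀ y, ‖K y‖ₑ ≤ c * w) {θ : ℝ} (hθ0 : 0 ≤ θ) (hθ : θ ≤ p⁻¹) :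
    eLpNorm g (ENNReal.ofReal θ)⁻¹ ≤ c * w ^ (p⁻¹ - θ) * eLpNorm f (ENNReal.ofReal p) := by
  have hp0 : 0 < p := by linarith
  have hfm := hf.measurable
  set F := ∫⁻ y, ‖f y‖ₑ ^ p with hF
  have hFt : F ≠ ∞ := by
    have := lintegral_rpow_enorm_lt_top_of_eLpNorm_lt_top (by simpa) ENNReal.ofReal_ne_top hfp.2
    rw [ENNReal.toReal_ofReal hp0.le] at this
    exact this.ne
  have hpt : ∀ x, ‖g x‖ₑ ^ p ≤ c ^ (p - 1) * ∫⁻ y, ‖K y‖ₑ * ‖f (x - y)‖ₑ ^ p := by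
    intro x
    calc ‖g x‖ₑ ^ p ≤ (∫⁻ y, ‖K y‖ₑ * ‖f (x - y)‖ₑ) ^ p := by
          gcongr
          rw [hg]
          refine (enorm_integral_le_lintegral_enorm _).trans_eq ?_
          simp only [enorm_mul]
      _ ≤ _ := lintegral_mul_rpow_le (by fun_prop) (by fun_prop) hp
      _ ≤ _ := by
        gcongr
  have hcc : ∀ u : ℝ≥0∞, c ^ (p - 1) * (c * u) = c ^ p * u := by
    intro u
    rw [← mul_assoc]
    congr 1
    conv_lhs => rw [← ENNReal.rpow_one c, ← ENNReal.rpow_mul, one_mul,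
      ← ENNReal.rpow_add_of_nonneg _ _ (by linarith) zero_le_one]
    simp
  have hM : ∀ x, ‖g x‖ₑ ^ p ≤ c ^ p * (w * F) := by
    intro x
    refine (hpt x).trans ?_
    rw [← hcc, ← mul_assoc c w]
    gcongr
    calc _ ≤ ∫⁻ y, (c * w) * ‖f (x - y)‖ₑ ^ p := by gcongr with y; exact hcs y
      _ = (c * w) * ∫⁻ y, ‖f (x - y)‖ₑ ^ p := lintegral_const_mul _ (by fun_prop)
      _ = _ := by rw [lintegral_sub_left_eq_self (fun y => ‖f y‖ₑ ^ p) x]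
  have hN : ∫⁻ x, ‖g x‖ₑ ^ p ≤ c ^ p * F := by
    calc _ ≤ ∫⁻ x, c ^ (p - 1) * ∫⁻ y, ‖K y‖ₑ * ‖f (x - y)‖ₑ ^ p := lintegral_mono hpt
      _ = c ^ (p - 1) * ∫⁻ x, ∫⁻ y, ‖K y‖ₑ * ‖f (x - y)‖ₑ ^ p := by
        refine lintegral_const_mul _ (Measurable.lintegral_prod_right' (f := fun z : Rd d × Rd d =>
          ‖K z.2‖ₑ * ‖f (z.1 - z.2)‖ₑ ^ p) ?_)
        fun_prop
      _ = c ^ (p - 1) * ∫⁻ y, ∫⁻ x, ‖K y‖ₑ * ‖f (x - y)‖ₑ ^ p := by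
        rw [lintegral_lintegral_swap]
        fun_prop
      _ = c ^ (p - 1) * ∫⁻ y, ‖K y‖ₑ * F := by
        congr 1
        refine lintegral_congr fun y => ?_
        rw [lintegral_const_mul _ (by fun_prop),
          lintegral_sub_right_eq_self (fun y => ‖f y‖ₑ ^ p) y]
      _ = c ^ (p - 1) * ((∫⁻ y, ‖K y‖ₑ) * F) := by
        rw [lintegral_mul_const _ (by fun_prop)]
      _ ≤ _ := by
        rw [← hcc]
        gcongr
  refine (eLpNorm_le_of_lintegral_rpow_le_of_rpow_le hp0
    (ENNReal.mul_ne_top (ENNReal.rpow_ne_top_of_nonneg hp0.le hc) (ENNReal.mul_ne_top hw hFt)) hM hN hθ0 hθ).trans_eq ?_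
  rw [eLpNorm_eq_lintegral_rpow_enorm_toReal (by simpa) ENNReal.ofReal_ne_top,
    ENNReal.toReal_ofReal hp0.le, ← hF]
  have h1 : 0 ≤ p⁻¹ - θ := by linarith
  simp only [ENNReal.mul_rpow_of_nonneg _ _ h1, ENNReal.mul_rpow_of_nonneg _ _ hθ0]
  calc _ = ((c ^ p) ^ (p⁻¹ - θ) * (c ^ p) ^ θ) * w ^ (p⁻¹ - θ) * (F ^ (p⁻¹ - θ) * F ^ θ) := by ring
    _ = _ := by
      rw [← ENNReal.rpow_add_of_nonneg _ _ h1 hθ0, ← ENNReal.rpow_add_of_nonneg _ _ h1 hθ0,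
        sub_add_cancel, ENNReal.rpow_rpow_inv hp0.ne', one_div]

end Convolution

/-- Smooth dyadic partition of unity generated by `φ`. -/
structure IsDyadicCutoff {d : ℕ} (φ : Rd d → ℝ) : Prop where
  contDiff : ContDiff ℝ (⊤ : ℕ∞) φ
  bounds_of_ne_zero : ∀ x, φ x ≠ 0 → 3/4 ≤ ‖x‖ ∧ ‖x‖ ≤ 8/3
  tsum_eq_one : ∀ ξ, ξ ≠ 0 → ∑' j : ℤ, φ (((2:ℝ) ^ (-j)) • ξ) = 1

section Blocks

variable {d : ℕ} {φ : Rd d → ℝ}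

/-- The symbol `φ(2^{-j}·)` of the `j`-th dyadic block. -/
def dyadicSymbol (φ : Rd d → ℝ) (j : ℤ) : Rd d → ℂ := fun ξ => (φ (((2:ℝ) ^ (-j)) • ξ) : ℂ)

/-- The `j`-th dyadic block as an operator on Schwartz functions. -/
def dyadicBlock (φ : Rd d → ℝ) (j : ℤ) : 𝓢(Rd d, ℂ) →L[ℂ] 𝓢(Rd d, ℂ) :=
  fourierMultiplierCLM ℂ (dyadicSymbol φ j)

namespace IsDyadicCutoff

theorem norm_bounds (hφ : IsDyadicCutoff φ) {j : ℤ} {ξ : Rd d} (h : dyadicSymbol φ j ξ ≠ 0) :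
    3/4 * (2:ℝ) ^ j ≤ ‖ξ‖ ∧ ‖ξ‖ ≤ 8/3 * (2:ℝ) ^ j := by
  have h2 : (0:ℝ) < 2 ^ j := by positivity
  obtain ⟨h3, h4⟩ := hφ.bounds_of_ne_zero ((2:ℝ) ^ (-j) • ξ)
    (by simpa only [dyadicSymbol, ne_eq, Complex.ofReal_eq_zero] using h)
  rw [norm_smul, norm_of_nonneg (by positivity), zpow_neg, inv_mul_eq_div] at h3 h4
  rw [le_div_iff₀ h2] at h3
  rw [div_le_iff₀ h2] at h4
  exact ⟨h3, h4⟩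

theorem hasCompactSupport_dyadicSymbol (hφ : IsDyadicCutoff φ) (j : ℤ) :
    HasCompactSupport (dyadicSymbol φ j) := by
  refine HasCompactSupport.of_support_subset_isCompact
    (isCompact_closedBall (0 : Rd d) (8/3 * (2:ℝ) ^ j)) fun ξ hξ => ?_
  simpa using (hφ.norm_bounds hξ).2

theorem contDiff_dyadicSymbol (hφ : IsDyadicCutoff φ) (j : ℤ) :
    ContDiff ℝ (⊤ : ℕ∞) (dyadicSymbol φ j) :=
  Complex.ofRealCLM.contDiff.comp (hφ.contDiff.comp (contDiff_const_smul _))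

/-- The symbol of the `j`-th dyadic block as a Schwartz function. -/
def symbol (hφ : IsDyadicCutoff φ) (j : ℤ) : 𝓢(Rd d, ℂ) :=
  (hφ.hasCompactSupport_dyadicSymbol j).toSchwartzMap (hφ.contDiff_dyadicSymbol j)

@[simp] theorem symbol_apply (hφ : IsDyadicCutoff φ) (j : ℤ) (ξ : Rd d) :
    hφ.symbol j ξ = dyadicSymbol φ j ξ := rfl

theorem hasTemperateGrowth_dyadicSymbol (hφ : IsDyadicCutoff φ) (j : ℤ) :
    (dyadicSymbol φ j).HasTemperateGrowth :=
  (hφ.symbol j).hasTemperateGrowth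

theorem fourier_dyadicBlock (hφ : IsDyadicCutoff φ) (j : ℤ) (f : 𝓢(Rd d, ℂ)) (ξ : Rd d) :
    𝓕 (dyadicBlock φ j f) ξ = dyadicSymbol φ j ξ * 𝓕 f ξ := by
  simp [dyadicBlock, fourierMultiplierCLM_apply,
    smulLeftCLM_apply_apply (hφ.hasTemperateGrowth_dyadicSymbol j)]

theorem LPblock_eq (hφ : IsDyadicCutoff φ) (j : ℤ) (f : 𝓢(Rd d, ℂ)) :
    LPblock d φ j f = dyadicBlock φ j f := by
  rw [dyadicBlock, fourierMultiplierCLM_apply, fourierInv_coe]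
  unfold LPblock
  congr 1
  ext ξ
  rw [smulLeftCLM_apply_apply (hφ.hasTemperateGrowth_dyadicSymbol j), fourier_coe, smul_eq_mul]
  rfl

/-- The convolution kernel of the `j`-th dyadic block. -/
def kernel (hφ : IsDyadicCutoff φ) (j : ℤ) : 𝓢(Rd d, ℂ) := 𝓕⁻ (hφ.symbol j)

theorem dyadicBlock_apply (hφ : IsDyadicCutoff φ) (j : ℤ) (f : 𝓢(Rd d, ℂ)) (x : Rd d) :
    dyadicBlock φ j f x = ∫ y, hφ.kernel j y * f (x - y) := by
  have h : dyadicBlock φ j f = convolution (ContinuousLinearMap.mul ℂ ℂ) (hφ.kernel j) f := by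
    rw [dyadicBlock, fourierMultiplierCLM_apply]
    change _ = 𝓕⁻ (pairing (ContinuousLinearMap.mul ℂ ℂ) (𝓕 (hφ.kernel j)) (𝓕 f))
    congr 1
    ext ξ
    simp [kernel, smulLeftCLM_apply_apply (hφ.hasTemperateGrowth_dyadicSymbol j)]
  rw [h, convolution_apply]
  rfl

theorem kernel_eq (hφ : IsDyadicCutoff φ) (j : ℤ) (x : Rd d) :
    hφ.kernel j x = (((2:ℝ) ^ j) ^ d : ℝ) * hφ.kernel 0 ((2:ℝ) ^ j • x) := by
  have h2 : (0:ℝ) < 2 ^ j := by positivity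
  simp only [kernel, fourierInv_coe, Real.fourierInv_eq]
  have h := Measure.integral_comp_smul (μ := (volume : Measure (Rd d)))
    (fun v => 𝐞 (inner ℝ v ((2:ℝ) ^ j • x)) • hφ.symbol 0 v) ((2:ℝ) ^ (-j))
  have hl : ∀ v : Rd d, 𝐞 (inner ℝ ((2:ℝ) ^ (-j) • v) ((2:ℝ) ^ j • x)) •
      hφ.symbol 0 ((2:ℝ) ^ (-j) • v) = 𝐞 (inner ℝ v x) • hφ.symbol j v := by
    intro v
    rw [inner_smul_left, inner_smul_right]
    simp [dyadicSymbol, h2.ne']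
  simp only [hl] at h
  rw [h, finrank_euclideanSpace_fin, abs_of_pos (by positivity), zpow_neg, inv_pow, inv_inv,
    Complex.real_smul]

theorem lintegral_enorm_kernel (hφ : IsDyadicCutoff φ) (j : ℤ) :
    ∫⁻ x, ‖hφ.kernel j x‖ₑ = ∫⁻ x, ‖hφ.kernel 0 x‖ₑ := by
  have h2 : (0:ℝ) < 2 ^ j := by positivity
  rw [← ofReal_integral_norm_eq_lintegral_enorm (hφ.kernel j).integrable,
    ← ofReal_integral_norm_eq_lintegral_enorm (hφ.kernel 0).integrable]
  simp only [hφ.kernel_eq j, norm_mul, Complex.norm_real]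
  rw [integral_const_mul, Measure.integral_comp_smul volume (fun y => ‖hφ.kernel 0 y‖),
    finrank_euclideanSpace_fin, abs_of_pos (by positivity), norm_of_nonneg (by positivity),
    smul_eq_mul, mul_inv_cancel_left₀ (by positivity)]

theorem enorm_kernel_le (hφ : IsDyadicCutoff φ) (j : ℤ) (x : Rd d) :
    ‖hφ.kernel j x‖ₑ ≤
      ENNReal.ofReal (SchwartzMap.seminorm ℝ 0 0 (hφ.kernel 0)) * 2 ^ ((j : ℝ) * d) := by
  have hp : (2:ℝ≥0∞) ^ ((j : ℝ) * d) = ENNReal.ofReal (((2:ℝ) ^ j) ^ d) := by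
    rw [← Real.rpow_intCast, ← Real.rpow_natCast, ← Real.rpow_mul zero_le_two,
      ← ENNReal.ofReal_rpow_of_pos zero_lt_two]
    simp
  rw [hp, ← ENNReal.ofReal_mul (by positivity), ← ofReal_norm]
  apply ENNReal.ofReal_le_ofReal
  rw [hφ.kernel_eq, norm_mul, Complex.norm_real, norm_of_nonneg (by positivity), mul_comm]
  gcongr
  exact norm_le_seminorm ℝ _ _

/-- Bernstein's inequality, uniformly in all parameters. -/
theorem exists_bernstein (hφ : IsDyadicCutoff φ) : ∃ c : ℝ≥0∞, c ≠ ∞ ∧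
    ∀ (j : ℤ) (f : 𝓢(Rd d, ℂ)) {ρ θ : ℝ}, 0 < ρ → ρ ≤ 1 → 0 ≤ θ → θ ≤ ρ →
      eLpNorm (dyadicBlock φ j f) (ENNReal.ofReal θ)⁻¹ volume ≤
        c * 2 ^ (j * (d * (ρ - θ))) * eLpNorm f (ENNReal.ofReal ρ)⁻¹ volume := by
  refine ⟨(∫⁻ x, ‖hφ.kernel 0 x‖ₑ) + ENNReal.ofReal (SchwartzMap.seminorm ℝ 0 0 (hφ.kernel 0)),
    ENNReal.add_ne_top.2 ⟨(hφ.kernel 0).integrable.2.ne, ENNReal.ofReal_ne_top⟩,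
    fun j f ρ θ hρ hρ1 hθ hθρ => ?_⟩
  rw [← ENNReal.ofReal_inv_of_pos hρ]
  convert eLpNorm_convolution_le (K := hφ.kernel j) (w := 2 ^ ((j : ℝ) * d))
    (hφ.kernel j).continuous f.continuous (hφ.dyadicBlock_apply j f) (one_le_inv₀ hρ |>.2 hρ1)
    (f.memLp _ volume) ?_ ?_ ?_ ?_ hθ (by simpa) using 3
  · rw [← ENNReal.rpow_mul, inv_inv, mul_assoc]
  · exact ENNReal.add_ne_top.2 ⟨(hφ.kernel 0).integrable.2.ne, ENNReal.ofReal_ne_top⟩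
  · exact ENNReal.rpow_ne_top_of_ne_zero two_ne_zero ENNReal.ofNat_ne_top
  · rw [hφ.lintegral_enorm_kernel]; exact le_self_add
  · exact fun y => (hφ.enorm_kernel_le j y).trans (by gcongr; exact le_add_self)

end IsDyadicCutoff

end Blocks

section Decomposition

theorem hasSum_mul_of_hasSum {ι κ : Type*} {f : ι → ℂ} {g : κ → ℂ} {s t : ℂ} (hf : HasSum f s)
    (hg : HasSum g t) (hfg : Summable fun x : ι × κ => f x.1 * g x.2) :
    HasSum (fun x : ι × κ => f x.1 * g x.2) (s * t) :=
  hf.mul hg hfg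

variable {d : ℕ} {φ : Rd d → ℝ}

namespace IsDyadicCutoff

theorem abs_sub_le_one (hφ : IsDyadicCutoff φ) {j k : ℤ} {ξ : Rd d}
    (hj : dyadicSymbol φ j ξ ≠ 0) (hk : dyadicSymbol φ k ξ ≠ 0) : |j - k| ≤ 1 := by
  have key : ∀ {j k : ℤ}, dyadicSymbol φ j ξ ≠ 0 → dyadicSymbol φ k ξ ≠ 0 → j ≤ k + 1 := by
    intro j k hj hk
    by_contra! h
    have h1 := (hφ.norm_bounds hj).1
    have h2 := (hφ.norm_bounds hk).2
    have h3 : (2:ℝ) ^ (k + 2) ≤ 2 ^ j := zpow_le_zpow_right₀ one_le_two (by omega)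
    rw [zpow_add₀ two_ne_zero] at h3
    have h4 : (0:ℝ) < 2 ^ k := by positivity
    norm_num at h3
    linarith
  have := key hj hk
  have := key hk hj
  rw [abs_le]
  omega

theorem dyadicSymbol_zero (hφ : IsDyadicCutoff φ) (j : ℤ) : dyadicSymbol φ j (0 : Rd d) = 0 := by
  by_contra h
  have := (hφ.norm_bounds h).1
  have h4 : (0:ℝ) < 2 ^ j := by positivity
  rw [norm_zero] at this
  linarith

theorem sum_dyadicSymbol_eq_one (hφ : IsDyadicCutoff φ) {k : ℤ} {ξ : Rd d}
    (hk : dyadicSymbol φ k ξ ≠ 0) : ∑ j ∈ Finset.Icc (k - 1) (k + 1), dyadicSymbol φ j ξ = 1 := by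
  have hξ : ξ ≠ 0 := by
    rintro rfl
    exact hk (hφ.dyadicSymbol_zero k)
  have h := congrArg (fun x : ℝ => (x : ℂ)) (hφ.tsum_eq_one ξ hξ)
  simp only [Complex.ofReal_tsum, Complex.ofReal_one] at h
  rw [← h]
  refine (tsum_eq_sum fun j hj => ?_).symm
  by_contra hj'
  have := hφ.abs_sub_le_one hj' hk
  rw [abs_le] at this
  simp only [Finset.mem_Icc] at hj
  omega

theorem sum_dyadicBlock_dyadicBlock (hφ : IsDyadicCutoff φ) (k : ℤ) (f : 𝓢(Rd d, ℂ)) :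
    ∑ j ∈ Finset.Icc (k - 1) (k + 1), dyadicBlock φ j (dyadicBlock φ k f) = dyadicBlock φ k f := by
  have h : 𝓕 (∑ j ∈ Finset.Icc (k - 1) (k + 1), dyadicBlock φ j (dyadicBlock φ k f)) =
      𝓕 (dyadicBlock φ k f) := by
    ext ξ
    rw [FourierTransform.fourier_sum, sum_apply]
    simp only [hφ.fourier_dyadicBlock, ← Finset.sum_mul]
    by_cases hk : dyadicSymbol φ k ξ = 0
    · simp [hk]
    · rw [hφ.sum_dyadicSymbol_eq_one hk, one_mul]
  simpa using congrArg (fun g : 𝓢(Rd d, ℂ) => 𝓕⁻ g) h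

/-- Bernstein's inequality for a function localized in a dyadic annulus. -/
theorem exists_bernstein_dyadicBlock (hφ : IsDyadicCutoff φ) : ∃ c : ℝ≥0∞, c ≠ ∞ ∧
    ∀ (k : ℤ) (f : 𝓢(Rd d, ℂ)) {ρ θ : ℝ}, 0 < ρ → ρ ≤ 1 → 0 ≤ θ → θ ≤ ρ →
      eLpNorm (dyadicBlock φ k f) (ENNReal.ofReal θ)⁻¹ volume ≤
        c * 2 ^ (k * (d * (ρ - θ))) *
          eLpNorm (dyadicBlock φ k f) (ENNReal.ofReal ρ)⁻¹ volume := by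
  obtain ⟨c, hc, h⟩ := hφ.exists_bernstein
  refine ⟨3 * (c * 2 ^ (d : ℝ)), by finiteness, fun k f ρ θ hρ hρ1 hθ hθρ => ?_⟩
  have hterm : ∀ j ∈ Finset.Icc (k - 1) (k + 1),
      eLpNorm (dyadicBlock φ j (dyadicBlock φ k f)) (ENNReal.ofReal θ)⁻¹ volume ≤
        c * 2 ^ (d : ℝ) * 2 ^ (k * (d * (ρ - θ))) *
          eLpNorm (dyadicBlock φ k f) (ENNReal.ofReal ρ)⁻¹ volume := by
    intro j hj
    refine (h j _ hρ hρ1 hθ hθρ).trans ?_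
    gcongr ?_ * _
    rw [mul_assoc c, ← ENNReal.rpow_add _ _ two_ne_zero ENNReal.ofNat_ne_top]
    gcongr
    · exact one_le_two
    · have hj' : (j : ℝ) ≤ k + 1 := by exact_mod_cast (Finset.mem_Icc.1 hj).2
      have hd : (0:ℝ) ≤ d := by positivity
      nlinarith [mul_nonneg hd (sub_nonneg.2 hθρ), mul_nonneg hd (sub_nonneg.2 hρ1),
        mul_nonneg hd hθ]
  have hθ' : 1 ≤ (ENNReal.ofReal θ)⁻¹ := by
    rw [ENNReal.one_le_inv, ENNReal.ofReal_le_one]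
    linarith
  conv_lhs => rw [← hφ.sum_dyadicBlock_dyadicBlock k f]
  rw [show ((∑ j ∈ Finset.Icc (k - 1) (k + 1), dyadicBlock φ j (dyadicBlock φ k f) :
    𝓢(Rd d, ℂ)) : Rd d → ℂ) = ∑ j ∈ Finset.Icc (k - 1) (k + 1),
      (dyadicBlock φ j (dyadicBlock φ k f) : Rd d → ℂ) by ext x; simp]
  refine (eLpNorm_sum_le (fun j _ => (SchwartzMap.continuous _).aestronglyMeasurable) hθ').trans ?_
  refine (Finset.sum_le_card_nsmul _ _ _ hterm).trans_eq ?_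
  have hcard : (Finset.Icc (k - 1) (k + 1)).card = 3 := by
    rw [Int.card_Icc]
    omega
  rw [hcard, nsmul_eq_mul]
  push_cast
  ring

theorem exists_norm_dyadicSymbol_le (hφ : IsDyadicCutoff φ) :
    ∃ M : ℝ≥0∞, M ≠ ∞ ∧ ∀ ξ : Rd d, ∑' j : ℤ, ‖dyadicSymbol φ j ξ‖ₑ ≤ M := by
  set s := SchwartzMap.seminorm ℝ 0 0 (hφ.symbol 0)
  have hs : ∀ j (ξ : Rd d), ‖dyadicSymbol φ j ξ‖ₑ ≤ ENNReal.ofReal s := by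
    intro j ξ
    rw [← ofReal_norm]
    apply ENNReal.ofReal_le_ofReal
    have := norm_le_seminorm ℝ (hφ.symbol 0) ((2:ℝ) ^ (-j) • ξ)
    simpa [dyadicSymbol] using this
  refine ⟨3 * ENNReal.ofReal s, by finiteness, fun ξ => ?_⟩
  by_cases h : ∃ k, dyadicSymbol φ k ξ ≠ 0
  · obtain ⟨k, hk⟩ := h
    rw [tsum_eq_sum (s := Finset.Icc (k - 1) (k + 1))]
    · refine (Finset.sum_le_card_nsmul _ _ _ fun j _ => hs j ξ).trans_eq ?_
      have hcard : (Finset.Icc (k - 1) (k + 1)).card = 3 := by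
        rw [Int.card_Icc]
        omega
      rw [hcard, nsmul_eq_mul]
      push_cast
      ring
    · intro j hj
      by_contra hj'
      have := hφ.abs_sub_le_one (enorm_ne_zero.1 hj') hk
      rw [abs_le] at this
      simp only [Finset.mem_Icc] at hj
      omega
  · push Not at h
    simp [h]

theorem dyadicBlock_apply_eq_integral (hφ : IsDyadicCutoff φ) (j : ℤ) (f : 𝓢(Rd d, ℂ))
    (x : Rd d) :
    dyadicBlock φ j f x = ∫ ξ, 𝐞 (inner ℝ ξ x) • (dyadicSymbol φ j ξ * 𝓕 f ξ) := by
  rw [dyadicBlock, fourierMultiplierCLM_apply, fourierInv_coe, Real.fourierInv_eq]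
  simp only [smulLeftCLM_apply_apply (hφ.hasTemperateGrowth_dyadicSymbol j), smul_eq_mul]

theorem integrable_dyadicSymbol_mul (hφ : IsDyadicCutoff φ) (j : ℤ) (f : 𝓢(Rd d, ℂ)) :
    Integrable fun ξ => dyadicSymbol φ j ξ * 𝓕 f ξ := by
  have := (smulLeftCLM ℂ (dyadicSymbol φ j) (𝓕 f)).integrable (μ := volume)
  simpa only [smulLeftCLM_apply (hφ.hasTemperateGrowth_dyadicSymbol j), smul_eq_mul] using this

theorem summable_integral_norm_dyadicSymbol_mul (hφ : IsDyadicCutoff φ) (f : 𝓢(Rd d, ℂ)) :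
    Summable fun j : ℤ => ∫ ξ, ‖dyadicSymbol φ j ξ * 𝓕 f ξ‖ := by
  obtain ⟨M, hM, h⟩ := hφ.exists_norm_dyadicSymbol_le
  have hfin : ∑' j : ℤ, ∫⁻ ξ, ‖dyadicSymbol φ j ξ * 𝓕 f ξ‖ₑ ≠ ∞ := by
    rw [← lintegral_tsum fun j => (hφ.integrable_dyadicSymbol_mul j f).1.enorm]
    simp only [enorm_mul, ENNReal.tsum_mul_right]
    refine ne_top_of_le_ne_top (ENNReal.mul_ne_top hM (𝓕 f).integrable.2.ne)
      (b := M * ∫⁻ ξ, ‖𝓕 f ξ‖ₑ) ?_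
    rw [← lintegral_const_mul' _ _ hM]
    gcongr with ξ
    exact h ξ
  refine (ENNReal.summable_toReal hfin).congr fun j => ?_
  rw [integral_norm_eq_lintegral_enorm (hφ.integrable_dyadicSymbol_mul j f).1]

theorem norm_dyadicBlock_apply_le (hφ : IsDyadicCutoff φ) (j : ℤ) (f : 𝓢(Rd d, ℂ)) (x : Rd d) :
    ‖dyadicBlock φ j f x‖ ≤ ∫ ξ, ‖dyadicSymbol φ j ξ * 𝓕 f ξ‖ := by
  rw [hφ.dyadicBlock_apply_eq_integral]
  refine (norm_integral_le_integral_norm _).trans_eq ?_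
  simp only [Circle.norm_smul]

theorem hasSum_dyadicBlock_apply (hd : 0 < d) (hφ : IsDyadicCutoff φ) (f : 𝓢(Rd d, ℂ))
    (x : Rd d) : HasSum (fun j : ℤ => dyadicBlock φ j f x) (f x) := by
  have : Nonempty (Fin d) := ⟨⟨0, hd⟩⟩
  have h := hasSum_integral_of_summable_integral_norm (μ := (volume : Measure (Rd d)))
    (F := fun (j : ℤ) ξ => 𝐞 (inner ℝ ξ x) • (dyadicSymbol φ j ξ * 𝓕 f ξ))
    (fun j => (hφ.integrable_dyadicSymbol_mul j f).congr' (by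
      simp only [Circle.smul_def]
      have hc : Continuous fun ξ : Rd d => (𝐞 (inner ℝ ξ x) : ℂ) := by fun_prop
      exact hc.aestronglyMeasurable.smul (hφ.integrable_dyadicSymbol_mul j f).1)
      (.of_forall fun ξ => (Circle.norm_smul _ _).symm))
    (by simpa only [Circle.norm_smul] using hφ.summable_integral_norm_dyadicSymbol_mul f)
  simp only [← hφ.dyadicBlock_apply_eq_integral] at h
  suffices hfx : f x = ∫ ξ, ∑' j : ℤ, 𝐞 (inner ℝ ξ x) • (dyadicSymbol φ j ξ * 𝓕 f ξ) by
    rw [hfx]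
    exact h
  have hf : f x = 𝓕⁻ (𝓕 f) x := by simp
  rw [hf, fourierInv_coe, Real.fourierInv_eq]
  refine integral_congr_ae ?_
  filter_upwards [Measure.ae_ne volume (0 : Rd d)] with ξ hξ
  have h1 := congrArg (fun x : ℝ => (x : ℂ)) (hφ.tsum_eq_one ξ hξ)
  simp only [Complex.ofReal_tsum, Complex.ofReal_one] at h1
  simp only [Circle.smul_def, tsum_const_smul'', tsum_mul_right]
  change _ = _ • ((∑' j : ℤ, (φ (((2:ℝ) ^ (-j)) • ξ) : ℂ)) * _)
  rw [h1, one_mul]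

/-- The product of two Schwartz functions. -/
abbrev _root_.SchwartzMap.mulPair (f g : 𝓢(Rd d, ℂ)) : 𝓢(Rd d, ℂ) :=
  pairing (ContinuousLinearMap.mul ℂ ℂ) f g

theorem hasSum_dyadicBlock_mulPair (hd : 0 < d) (hφ : IsDyadicCutoff φ) (j : ℤ)
    (a b : 𝓢(Rd d, ℂ)) (x : Rd d) :
    HasSum (fun kl : ℤ × ℤ =>
      dyadicBlock φ j (mulPair (dyadicBlock φ kl.1 a) (dyadicBlock φ kl.2 b)) x)
      (dyadicBlock φ j (mulPair a b) x) := by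
  simp only [hφ.dyadicBlock_apply j, pairing_apply_apply, ContinuousLinearMap.mul_apply']
  set A := fun k : ℤ => ∫ ξ, ‖dyadicSymbol φ k ξ * 𝓕 a ξ‖
  set B := fun k : ℤ => ∫ ξ, ‖dyadicSymbol φ k ξ * 𝓕 b ξ‖
  have hA : Summable A := hφ.summable_integral_norm_dyadicSymbol_mul a
  have hB : Summable B := hφ.summable_integral_norm_dyadicSymbol_mul b
  have hA0 : ∀ k, 0 ≤ A k := fun k => by positivity
  have hB0 : ∀ k, 0 ≤ B k := fun k => by positivity
  have hAB : Summable fun kl : ℤ × ℤ => A kl.1 * B kl.2 := hA.mul_of_nonneg hB hA0 hB0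
  refine hasSum_integral_of_dominated_convergence
    (fun kl y => ‖hφ.kernel j y‖ * (A kl.1 * B kl.2)) (fun kl => ?_) (fun kl => ?_) ?_ ?_ ?_
  · exact Continuous.aestronglyMeasurable (by fun_prop)
  · refine .of_forall fun y => ?_
    rw [norm_mul, norm_mul]
    gcongr
    · exact hφ.norm_dyadicBlock_apply_le _ _ _
    · exact hφ.norm_dyadicBlock_apply_le _ _ _
  · exact .of_forall fun y => hAB.mul_left _
  · simp only [tsum_mul_left]
    exact (hφ.kernel j).integrable.norm.mul_const _
  · refine .of_forall fun y => ?_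
    have hs : Summable fun kl : ℤ × ℤ =>
        dyadicBlock φ kl.1 a (x - y) * dyadicBlock φ kl.2 b (x - y) := by
      refine Summable.of_norm_bounded hAB fun kl => ?_
      rw [norm_mul]
      gcongr
      · exact hφ.norm_dyadicBlock_apply_le _ _ _
      · exact hφ.norm_dyadicBlock_apply_le _ _ _
    have hm := hasSum_mul_of_hasSum (hφ.hasSum_dyadicBlock_apply hd a (x - y))
      (hφ.hasSum_dyadicBlock_apply hd b (x - y)) hs
    exact hm.mul_left (hφ.kernel j y)

theorem eLpNorm_dyadicBlock_mulPair_le_tsum (hd : 0 < d) (hφ : IsDyadicCutoff φ) (j : ℤ)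
    (a b : 𝓢(Rd d, ℂ)) {q : ℝ≥0∞} (hq : 1 ≤ q) :
    eLpNorm (dyadicBlock φ j (mulPair a b)) q volume ≤ ∑' kl : ℤ × ℤ, eLpNorm
      (dyadicBlock φ j (mulPair (dyadicBlock φ kl.1 a) (dyadicBlock φ kl.2 b))) q volume := by
  refine Lp.eLpNorm_le_of_ae_tendsto (u := Filter.atTop)
    (f := fun s : Finset (ℤ × ℤ) => ∑ kl ∈ s,
      (dyadicBlock φ j (mulPair (dyadicBlock φ kl.1 a) (dyadicBlock φ kl.2 b)) : Rd d → ℂ))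
    (.of_forall fun s => ?_) (fun s => ?_) (.of_forall fun x => ?_)
  · exact (eLpNorm_sum_le (fun j _ => (SchwartzMap.continuous _).aestronglyMeasurable) hq).trans
      (ENNReal.sum_le_tsum s)
  · exact Finset.aestronglyMeasurable_sum _
      fun j _ => (SchwartzMap.continuous _).aestronglyMeasurable
  · simpa only [Finset.sum_apply, HasSum, SummationFilter.unconditional_filter] using
      hφ.hasSum_dyadicBlock_mulPair hd j a b x

theorem fourier_mulPair_apply (f g : 𝓢(Rd d, ℂ)) (ζ : Rd d) :
    𝓕 (mulPair f g) ζ = ∫ t, 𝓕 f (-t) * 𝓕 g (ζ + t) := by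
  have h := SchwartzMap.convolution_apply (ContinuousLinearMap.mul ℂ ℂ) (𝓕⁻ f) (𝓕⁻ g) (-ζ)
  have h1 : SchwartzMap.convolution (ContinuousLinearMap.mul ℂ ℂ) (𝓕⁻ f) (𝓕⁻ g) = 𝓕⁻ (mulPair f g) := by
    change 𝓕⁻ (pairing (ContinuousLinearMap.mul ℂ ℂ) (𝓕 (𝓕⁻ f)) (𝓕 (𝓕⁻ g))) = _
    simp
  rw [h1, fourierInv_coe, Real.fourierInv_eq_fourier_neg, neg_neg, ← fourier_coe] at h
  rw [h, MeasureTheory.convolution]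
  simp only [ContinuousLinearMap.mul_apply', fourierInv_coe, Real.fourierInv_eq_fourier_neg,
    ← fourier_coe, neg_sub, sub_neg_eq_add, add_comm]

theorem dyadicBlock_mulPair_eq_zero (hφ : IsDyadicCutoff φ) {j k l : ℤ} (a b : 𝓢(Rd d, ℂ))
    (h : ∀ ξ η, dyadicSymbol φ k ξ ≠ 0 → dyadicSymbol φ l η ≠ 0 →
      dyadicSymbol φ j (ξ + η) = 0) :
    dyadicBlock φ j (mulPair (dyadicBlock φ k a) (dyadicBlock φ l b)) = 0 := by
  have h0 : 𝓕 (dyadicBlock φ j (mulPair (dyadicBlock φ k a) (dyadicBlock φ l b))) = 0 := by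
    ext ζ
    rw [hφ.fourier_dyadicBlock, fourier_mulPair_apply, ← integral_const_mul]
    refine integral_eq_zero_of_ae (.of_forall fun t => ?_)
    simp only [hφ.fourier_dyadicBlock, Pi.zero_apply]
    by_cases hk : dyadicSymbol φ k (-t) = 0
    · simp [hk]
    by_cases hl : dyadicSymbol φ l (ζ + t) = 0
    · simp [hl]
    have := h _ _ hk hl
    rw [show -t + (ζ + t) = ζ by abel] at this
    simp [this]
  simpa using congrArg (fun g : 𝓢(Rd d, ℂ) => 𝓕⁻ g) h0

/-- Interaction of frequencies in a product. -/
theorem frequency_trichotomy (hφ : IsDyadicCutoff φ) {j k l : ℤ} {a b : 𝓢(Rd d, ℂ)}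
    (h : dyadicBlock φ j (mulPair (dyadicBlock φ k a) (dyadicBlock φ l b)) ≠ 0) :
    (k ≤ l - 3 ∧ |l - j| ≤ 2) ∨ (l ≤ k - 3 ∧ |k - j| ≤ 2) ∨ (|l - k| ≤ 2 ∧ j - 4 ≤ k) := by
  obtain ⟨ξ, η, hk, hl, hj⟩ : ∃ ξ η, dyadicSymbol φ k ξ ≠ 0 ∧ dyadicSymbol φ l η ≠ 0 ∧
      dyadicSymbol φ j (ξ + η) ≠ 0 := by
    by_contra! h'
    exact h (hφ.dyadicBlock_mulPair_eq_zero a b h')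
  obtain ⟨hk1, hk2⟩ := hφ.norm_bounds hk
  obtain ⟨hl1, hl2⟩ := hφ.norm_bounds hl
  obtain ⟨hj1, hj2⟩ := hφ.norm_bounds hj
  have hadd : ‖ξ + η‖ ≤ ‖ξ‖ + ‖η‖ := norm_add_le _ _
  have hsub : ‖ξ‖ ≤ ‖ξ + η‖ + ‖η‖ := by simpa using norm_sub_le (ξ + η) η
  have hsub' : ‖η‖ ≤ ‖ξ + η‖ + ‖ξ‖ := by simpa using norm_sub_le (ξ + η) ξ
  have pow_pos : ∀ n : ℤ, (0:ℝ) < 2 ^ n := fun n => by positivity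
  have pow_le : ∀ m n : ℤ, m + 3 ≤ n → 8 * (2:ℝ) ^ m ≤ 2 ^ n := by
    intro m n hmn
    have := zpow_le_zpow_right₀ (one_le_two (α := ℝ)) hmn
    rw [zpow_add₀ two_ne_zero] at this
    norm_num at this
    linarith
  have hj0 := pow_pos j
  have hk0 := pow_pos k
  have hl0 := pow_pos l
  by_cases h1 : k + 3 ≤ l
  · left
    have := pow_le _ _ h1
    refine ⟨by omega, abs_le.2 ⟨?_, ?_⟩⟩
    · by_contra! h2
      have := pow_le l j (by omega)
      linarith
    · by_contra! h2
      have := pow_le j l (by omega)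
      linarith
  by_cases h2 : l + 3 ≤ k
  · right; left
    have := pow_le _ _ h2
    refine ⟨by omega, abs_le.2 ⟨?_, ?_⟩⟩
    · by_contra! h2
      have := pow_le k j (by omega)
      linarith
    · by_contra! h2
      have := pow_le j k (by omega)
      linarith
  · right; right
    refine ⟨abs_le.2 ⟨by omega, by omega⟩, ?_⟩
    by_contra! h3
    have h4 := pow_le (k + 2) j (by omega)
    have h5 : (2:ℝ) ^ l ≤ 2 ^ (k + 2) := zpow_le_zpow_right₀ one_le_two (by omega)
    rw [zpow_add₀ two_ne_zero] at h4 h5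
    norm_num at h4 h5
    linarith

end IsDyadicCutoff

end Decomposition

section ProductEstimate

variable {d : ℕ} {φ : Rd d → ℝ}

theorem two_rpow_add (x y : ℝ) : (2:ℝ≥0∞) ^ (x + y) = 2 ^ x * 2 ^ y :=
  ENNReal.rpow_add _ _ two_ne_zero ENNReal.ofNat_ne_top

theorem le_two_rpow_neg_mul {x : ℝ} {u v : ℝ≥0∞} (h : 2 ^ x * u ≤ v) : u ≤ 2 ^ (-x) * v := by
  calc u = 2 ^ (-x) * (2 ^ x * u) := by
        rw [← mul_assoc, ← two_rpow_add, neg_add_cancel, ENNReal.rpow_zero, one_mul]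
    _ ≤ _ := by gcongr

theorem mulPair_comm (f g : 𝓢(Rd d, ℂ)) : mulPair f g = mulPair g f := by
  ext x
  simp [mul_comm]

/-- Hölder's inequality, with exponents given by their reciprocals. -/
theorem eLpNorm_mulPair_le (f g : 𝓢(Rd d, ℂ)) {ρ θ : ℝ} (hρ : 0 ≤ ρ) (hθ : 0 ≤ θ) :
    eLpNorm (mulPair f g) (ENNReal.ofReal (ρ + θ))⁻¹ volume ≤
      eLpNorm f (ENNReal.ofReal ρ)⁻¹ volume * eLpNorm g (ENNReal.ofReal θ)⁻¹ volume := by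
  have : ENNReal.HolderTriple (ENNReal.ofReal ρ)⁻¹ (ENNReal.ofReal θ)⁻¹
      (ENNReal.ofReal (ρ + θ))⁻¹ := ⟨by simp [ENNReal.ofReal_add hρ hθ]⟩
  have h : (mulPair f g : Rd d → ℂ) = (f : Rd d → ℂ) • (g : Rd d → ℂ) := by
    ext x
    simp
  rw [h]
  exact eLpNorm_smul_le_mul_eLpNorm g.continuous.aestronglyMeasurable
    f.continuous.aestronglyMeasurable

namespace IsDyadicCutoff

theorem exists_eLpNorm_dyadicBlock_mulPair_le (hφ : IsDyadicCutoff φ) : ∃ c : ℝ≥0∞, c ≠ ∞ ∧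
    ∀ (j k l : ℤ) (a b : 𝓢(Rd d, ℂ)) {P Q σ : ℝ}, 0 < P → P ≤ 1 → 0 ≤ Q → Q ≤ σ → σ ≤ 1 →
      P ≤ σ → σ ≤ 2 * P →
      eLpNorm (dyadicBlock φ j (mulPair (dyadicBlock φ k a) (dyadicBlock φ l b)))
          (ENNReal.ofReal Q)⁻¹ volume ≤
        c * (2 ^ (j * (d * (σ - Q))) * 2 ^ (k * (d * (2 * P - σ)))) *
          (eLpNorm (dyadicBlock φ k a) (ENNReal.ofReal P)⁻¹ volume *
            eLpNorm (dyadicBlock φ l b) (ENNReal.ofReal P)⁻¹ volume) := by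
  obtain ⟨c₁, hc₁, h₁⟩ := hφ.exists_bernstein
  obtain ⟨c₂, hc₂, h₂⟩ := hφ.exists_bernstein_dyadicBlock
  refine ⟨c₁ * c₂, ENNReal.mul_ne_top hc₁ hc₂, fun j k l a b P Q σ hP hP1 hQ hQσ hσ1 hPσ hσP => ?_⟩
  have hH := eLpNorm_mulPair_le (dyadicBlock φ k a) (dyadicBlock φ l b) (sub_nonneg.2 hPσ) hP.le
  rw [sub_add_cancel] at hH
  have hB := h₂ k a hP hP1 (sub_nonneg.2 hPσ) (by linarith : σ - P ≤ P)
  rw [show P - (σ - P) = 2 * P - σ by ring] at hB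
  calc _ ≤ _ := h₁ j _ (hP.trans_le hPσ) hσ1 hQ hQσ
    _ ≤ c₁ * 2 ^ (j * (d * (σ - Q))) * ((c₂ * 2 ^ (k * (d * (2 * P - σ))) *
          eLpNorm (dyadicBlock φ k a) (ENNReal.ofReal P)⁻¹ volume) *
            eLpNorm (dyadicBlock φ l b) (ENNReal.ofReal P)⁻¹ volume) := by
      gcongr
      exact hH.trans (by gcongr)
    _ = _ := by ring

/-- The contribution of a pair of blocks, measured in scaling-invariant norms. -/
theorem exists_weighted_eLpNorm_le (hφ : IsDyadicCutoff φ) : ∃ c : ℝ≥0∞, c ≠ ∞ ∧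
    ∀ (j m n : ℤ) (a b : 𝓢(Rd d, ℂ)) {P Q σ : ℝ} {A B : ℝ≥0∞}, 0 < P → P ≤ 1 → 0 ≤ Q → Q ≤ σ →
      σ ≤ 1 → P ≤ σ → σ ≤ 2 * P →
      (∀ k : ℤ, 2 ^ (k * (d * P - 2)) *
        eLpNorm (dyadicBlock φ k a) (ENNReal.ofReal P)⁻¹ volume ≤ A) →
      (∀ k : ℤ, 2 ^ (k * (d * P)) *
        eLpNorm (dyadicBlock φ k b) (ENNReal.ofReal P)⁻¹ volume ≤ B) →
      2 ^ (j * (d * Q - 2)) * eLpNorm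
          (dyadicBlock φ j (mulPair (dyadicBlock φ (j + m) a) (dyadicBlock φ (j + n) b)))
          (ENNReal.ofReal Q)⁻¹ volume ≤
        c * 2 ^ (m * (d * (P - σ) + 2) - n * (d * P)) * (A * B) := by
  obtain ⟨c, hc, h⟩ := hφ.exists_eLpNorm_dyadicBlock_mulPair_le
  refine ⟨c, hc, fun j m n a b P Q σ A B hP hP1 hQ hQσ hσ1 hPσ hσP hA hB => ?_⟩
  calc _ ≤ (2:ℝ≥0∞) ^ (j * (d * Q - 2)) * (c * (2 ^ (j * (d * (σ - Q))) *
          2 ^ ((j + m : ℤ) * (d * (2 * P - σ)))) *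
          ((2 ^ (-((j + m : ℤ) * (d * P - 2))) * A) * (2 ^ (-((j + n : ℤ) * (d * P))) * B))) := by
        gcongr
        refine (h j (j + m) (j + n) a b hP hP1 hQ hQσ hσ1 hPσ hσP).trans ?_
        gcongr
        · exact le_two_rpow_neg_mul (hA _)
        · exact le_two_rpow_neg_mul (hB _)
    _ = c * (2 ^ (j * (d * Q - 2)) * 2 ^ (j * (d * (σ - Q))) *
          2 ^ ((j + m : ℤ) * (d * (2 * P - σ))) * 2 ^ (-((j + m : ℤ) * (d * P - 2))) *
          2 ^ (-((j + n : ℤ) * (d * P)))) * (A * B) := by ring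
    _ = _ := by
      simp only [← two_rpow_add]
      push_cast
      congr 3
      ring

/-- The off-diagonal decay of the contribution of a pair of blocks. -/
theorem exists_weighted_eLpNorm_le_decay (hd : 3 ≤ d) (hφ : IsDyadicCutoff φ) {P Q : ℝ}
    (hP : 0 < P) (hQ1 : Q ≤ 1) (hPQ : P ≤ Q) (hQP : Q ≤ 2 * P) (hdP : 1 < d * P)
    (hdPQ : d * (Q - P) < 2) : ∃ c : ℝ≥0∞, c ≠ ∞ ∧ ∃ δ : ℝ, 0 < δ ∧
    ∀ (j m n : ℤ) (a b : 𝓢(Rd d, ℂ)) {A A' B B' : ℝ≥0∞},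
      (∀ k : ℤ, 2 ^ (k * (d * P - 2)) *
        eLpNorm (dyadicBlock φ k a) (ENNReal.ofReal P)⁻¹ volume ≤ A) →
      (∀ k : ℤ, 2 ^ (k * (d * P)) *
        eLpNorm (dyadicBlock φ k a) (ENNReal.ofReal P)⁻¹ volume ≤ A') →
      (∀ k : ℤ, 2 ^ (k * (d * P - 2)) *
        eLpNorm (dyadicBlock φ k b) (ENNReal.ofReal P)⁻¹ volume ≤ B) →
      (∀ k : ℤ, 2 ^ (k * (d * P)) *
        eLpNorm (dyadicBlock φ k b) (ENNReal.ofReal P)⁻¹ volume ≤ B') →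
      2 ^ (j * (d * Q - 2)) * eLpNorm
          (dyadicBlock φ j (mulPair (dyadicBlock φ (j + m) a) (dyadicBlock φ (j + n) b)))
          (ENNReal.ofReal Q)⁻¹ volume ≤
        c * (2 ^ (-δ * |(m : ℝ)|) * 2 ^ (-δ * |(n : ℝ)|)) * (A * B' + B * A') := by
  obtain ⟨c, hc, h⟩ := hφ.exists_weighted_eLpNorm_le
  set σ := min 1 (2 * P) with hσ
  have hdR : (3:ℝ) ≤ d := by exact_mod_cast hd
  set ε := d * (P - Q) + 2 with hε
  set η := d * σ - 2 with hη
  have hε0 : 0 < ε := by rw [hε]; linarith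
  have hη0 : 0 < η := by
    rw [hη, hσ]
    rcases min_cases (1:ℝ) (2 * P) with h | h <;> rw [h.1] <;> linarith
  have hσ1 : σ ≤ 1 := min_le_left _ _
  have hσP : σ ≤ 2 * P := min_le_right _ _
  have hQσ : Q ≤ σ := le_min hQ1 hQP
  have hPσ : P ≤ σ := hPQ.trans hQσ
  have hP1 : P ≤ 1 := hPQ.trans hQ1
  have hQ0 : 0 ≤ Q := hP.le.trans hPQ
  set δ := min ε (η / 2) with hδ
  have hδ0 : 0 < δ := lt_min hε0 (by linarith)
  have hδε : δ ≤ ε := min_le_left _ _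
  have hδη : δ ≤ η / 2 := min_le_right _ _
  set N := 2 * (d * P) + 2 * ε + 9 * η with hN
  have hpara : ∀ m n : ℤ, m ≤ n - 3 → |n| ≤ 2 →
      m * (d * (P - Q) + 2) - n * (d * P) ≤ N + (-δ * |(m : ℝ)| + -δ * |(n : ℝ)|) := by
    intro m n hmn hn
    have hn' : |(n : ℝ)| ≤ 2 := by exact_mod_cast hn
    have hm' : (m : ℝ) ≤ -1 := by
      rw [abs_le] at hn
      exact_mod_cast (by omega : m ≤ -1)
    rw [abs_of_neg (by linarith : (m : ℝ) < 0), ← hε, hN]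
    have := (abs_le.1 hn').1
    nlinarith
  have hrem : ∀ m n : ℤ, |n - m| ≤ 2 → -4 ≤ m →
      m * (d * (P - σ) + 2) - n * (d * P) ≤ N + (-δ * |(m : ℝ)| + -δ * |(n : ℝ)|) := by
    intro m n hmn hm
    have hmn' : |(n : ℝ) - m| ≤ 2 := by exact_mod_cast hmn
    have hm' : (-4 : ℝ) ≤ m := by exact_mod_cast hm
    rw [abs_le] at hmn'
    have h1 : |(m : ℝ)| ≤ m + 8 := abs_le.2 ⟨by linarith, by linarith⟩
    have h2 : |(n : ℝ)| ≤ m + 10 := abs_le.2 ⟨by linarith, by linarith⟩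
    have h3 : δ * (|(m : ℝ)| + |(n : ℝ)|) ≤ η / 2 * (2 * m + 18) :=
      mul_le_mul hδη (by linarith) (by positivity) (by linarith)
    have h4 : (m - n) * (d * P) ≤ 2 * (d * P) := by
      gcongr
      linarith
    rw [hN]
    linarith
  have hexp : ∀ {x : ℝ} {m n : ℤ} (u : ℝ≥0∞),
      x ≤ N + (-δ * |(m : ℝ)| + -δ * |(n : ℝ)|) →
      c * 2 ^ x * u ≤ c * 2 ^ N * (2 ^ (-δ * |(m : ℝ)|) * 2 ^ (-δ * |(n : ℝ)|)) * u := by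
    intro x m n u hx
    rw [mul_assoc c (2 ^ N), ← two_rpow_add, ← two_rpow_add]
    gcongr
    exact one_le_two
  refine ⟨c * 2 ^ N, ENNReal.mul_ne_top hc
    (ENNReal.rpow_ne_top_of_ne_zero two_ne_zero ENNReal.ofNat_ne_top), δ, hδ0,
    fun j m n a b A A' B B' hA hA' hB hB' => ?_⟩
  by_cases h0 : dyadicBlock φ j (mulPair (dyadicBlock φ (j + m) a) (dyadicBlock φ (j + n) b)) = 0
  · have h00 : ((0 : 𝓢(Rd d, ℂ)) : Rd d → ℂ) = 0 := rfl
    rw [h0, h00, eLpNorm_zero, mul_zero]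
    exact zero_le
  rcases hφ.frequency_trichotomy h0 with ⟨h1, h2⟩ | ⟨h1, h2⟩ | ⟨h1, h2⟩
  · refine (h j m n a b hP hP1 hQ0 le_rfl hQ1 hPQ hQP hA hB').trans ?_
    refine (hexp _ (hpara m n (by omega) (by simpa using h2))).trans ?_
    gcongr
    exact le_self_add
  · rw [mulPair_comm]
    refine (h j n m b a hP hP1 hQ0 le_rfl hQ1 hPQ hQP hB hA').trans ?_
    refine (hexp _ (hpara n m (by omega) (by simpa using h2))).trans ?_
    rw [mul_comm (2 ^ (-δ * |(n : ℝ)|))]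
    gcongr
    exact le_add_self
  · refine (h j m n a b hP hP1 hQ0 hQσ hσ1 hPσ hσP hA hB').trans ?_
    refine (hexp _ (hrem m n (by simpa using h1) (by omega))).trans ?_
    gcongr
    exact le_self_add

end IsDyadicCutoff

theorem tsum_two_rpow_neg_mul_abs_ne_top {δ : ℝ} (hδ : 0 < δ) :
    ∑' m : ℤ, (2:ℝ≥0∞) ^ (-δ * |(m : ℝ)|) ≠ ∞ := by
  have hr : (2:ℝ) ^ (-δ) < 1 := Real.rpow_lt_one_of_one_lt_of_neg one_lt_two (by linarith)
  have hg : Summable fun n : ℕ => ((2:ℝ) ^ (-δ)) ^ n :=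
    summable_geometric_of_lt_one (by positivity) hr
  have hs : Summable fun m : ℤ => (2:ℝ) ^ (-δ * |(m : ℝ)|) := by
    refine Summable.of_nat_of_neg (hg.congr fun n => ?_) (hg.congr fun n => ?_) <;>
    · rw [← Real.rpow_natCast, ← Real.rpow_mul zero_le_two]
      simp
  have heq : ∀ m : ℤ, (2:ℝ≥0∞) ^ (-δ * |(m : ℝ)|) = ENNReal.ofReal (2 ^ (-δ * |(m : ℝ)|)) := by
    intro m
    rw [← ENNReal.ofReal_rpow_of_pos zero_lt_two]
    simp
  simp only [heq]
  exact hs.tsum_ofReal_ne_top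

theorem besovNorm_top_eq (hφ : IsDyadicCutoff φ) (s : ℝ) {p : ℝ} (hp : 0 < p)
    (f : 𝓢(Rd d, ℂ)) :
    besovNorm d φ s (ENNReal.ofReal p) ∞ f = ⨆ j : ℤ,
      2 ^ (j * s) * eLpNorm (dyadicBlock φ j f) (ENNReal.ofReal p⁻¹)⁻¹ volume := by
  simp only [besovNorm, seqNorm, if_true, hφ.LPblock_eq, ENNReal.ofReal_inv_of_pos hp, inv_inv]
  congr 1
  ext j
  rw [← ENNReal.ofReal_rpow_of_pos zero_lt_two]
  simp

end ProductEstimate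

/-- Product estimate: for d ≥ 3, 1 ≤ q ≤ p ≤ 2q, p < d and 1/q < 1/p + 2/d,
‖ab‖_{Ḃ^{d/q−2}_{q,∞}} ≲ ‖a‖_{Ḃ^{d/p−2}_{p,∞}}‖b‖_{Ḃ^{d/p}_{p,∞}}
 + ‖b‖_{Ḃ^{d/p−2}_{p,∞}}‖a‖_{Ḃ^{d/p}_{p,∞}} for Schwartz functions a, b. -/
theorem product_estimate
    (d : ℕ) (hd : 3 ≤ d) (φ : Rd d → ℝ)
    (hφ1 : ContDiff ℝ (⊤ : ℕ∞) φ)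
    (hφ2 : ∀ x y : Rd d, ‖x‖ = ‖y‖ → φ x = φ y)
    (hφ3 : ∀ x : Rd d, φ x ≠ 0 → 3/4 ≤ ‖x‖ ∧ ‖x‖ ≤ 8/3)
    (hφ4 : ∀ ξ : Rd d, ξ ≠ 0 → ∑' j : ℤ, φ (((2:ℝ) ^ (-j)) • ξ) = 1)
    (p q : ℝ) (hq1 : 1 ≤ q) (hqp : q ≤ p) (hp2q : p ≤ 2 * q)
    (hpd : p < d) (hpq : 1/q < 1/p + 2/(d : ℝ)) :
    ∃ C : ℝ, 0 < C ∧ ∀ a b : 𝓢(Rd d, ℂ),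
      besovNorm d φ ((d : ℝ)/q - 2) (ENNReal.ofReal q) ∞ (fun x => a x * b x)
        ≤ ENNReal.ofReal C *
            (besovNorm d φ ((d : ℝ)/p - 2) (ENNReal.ofReal p) ∞ a
                * besovNorm d φ ((d : ℝ)/p) (ENNReal.ofReal p) ∞ b
              + besovNorm d φ ((d : ℝ)/p - 2) (ENNReal.ofReal p) ∞ b
                * besovNorm d φ ((d : ℝ)/p) (ENNReal.ofReal p) ∞ a) := by
  have hφ : IsDyadicCutoff φ := ⟨hφ1, hφ3, hφ4⟩
  have hq0 : 0 < q := by linarith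
  have hp0 : 0 < p := by linarith
  have hd0 : (0:ℝ) < d := by exact_mod_cast (by omega : 0 < d)
  have hpinv : 0 < p⁻¹ := by positivity
  have hqinv : q⁻¹ ≤ 1 := inv_le_one_of_one_le₀ hq1
  have hpqinv : p⁻¹ ≤ q⁻¹ := inv_anti₀ hq0 hqp
  have hqpinv : q⁻¹ ≤ 2 * p⁻¹ := by
    rw [← div_eq_mul_inv, inv_eq_one_div, div_le_div_iff₀ hq0 hp0]
    linarith
  have hdp : 1 < d * p⁻¹ := by rwa [← div_eq_mul_inv, one_lt_div hp0]
  have hdpq : d * (q⁻¹ - p⁻¹) < 2 := by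
    rw [one_div, one_div, ← sub_lt_iff_lt_add', lt_div_iff₀ hd0] at hpq
    linarith
  obtain ⟨c, hc, δ, hδ, h⟩ :=
    hφ.exists_weighted_eLpNorm_le_decay hd hpinv hqinv hpqinv hqpinv hdp hdpq
  set G := ∑' m : ℤ, (2:ℝ≥0∞) ^ (-δ * |(m : ℝ)|) with hG
  have hGt : G ≠ ∞ := tsum_two_rpow_neg_mul_abs_ne_top hδ
  have hCt : c * (G * G) ≠ ∞ := ENNReal.mul_ne_top hc (ENNReal.mul_ne_top hGt hGt)
  refine ⟨(c * (G * G)).toReal + 1, by positivity, fun a b => ?_⟩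
  have hab : (fun x => a x * b x) = (mulPair a b : Rd d → ℂ) := by
    ext x
    simp
  rw [hab, besovNorm_top_eq hφ _ hq0, besovNorm_top_eq hφ _ hp0, besovNorm_top_eq hφ _ hp0,
    besovNorm_top_eq hφ _ hp0, besovNorm_top_eq hφ _ hp0]
  simp only [div_eq_mul_inv]
  refine iSup_le fun j => ?_
  set normLowA := ⨆ k : ℤ, (2:ℝ≥0∞) ^ (k * (d * p⁻¹ - 2)) *
    eLpNorm (dyadicBlock φ k a) (ENNReal.ofReal p⁻¹)⁻¹ volume
  set normLowB := ⨆ k : ℤ, (2:ℝ≥0∞) ^ (k * (d * p⁻¹ - 2)) *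
    eLpNorm (dyadicBlock φ k b) (ENNReal.ofReal p⁻¹)⁻¹ volume
  set normHighA := ⨆ k : ℤ, (2:ℝ≥0∞) ^ (k * (d * p⁻¹)) *
    eLpNorm (dyadicBlock φ k a) (ENNReal.ofReal p⁻¹)⁻¹ volume
  set normHighB := ⨆ k : ℤ, (2:ℝ≥0∞) ^ (k * (d * p⁻¹)) *
    eLpNorm (dyadicBlock φ k b) (ENNReal.ofReal p⁻¹)⁻¹ volume
  set W := normLowA * normHighB + normLowB * normHighA
  have hC : c * (G * G) ≤ ENNReal.ofReal ((c * (G * G)).toReal + 1) := by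
    refine (ENNReal.ofReal_toReal hCt).symm.le.trans (ENNReal.ofReal_le_ofReal ?_)
    simp
  calc _ ≤ 2 ^ (j * (d * q⁻¹ - 2)) * ∑' kl : ℤ × ℤ, eLpNorm
        (dyadicBlock φ j (mulPair (dyadicBlock φ kl.1 a) (dyadicBlock φ kl.2 b)))
        (ENNReal.ofReal q⁻¹)⁻¹ volume := by
        gcongr
        exact hφ.eLpNorm_dyadicBlock_mulPair_le_tsum (by omega) j a b
          (by rwa [ENNReal.one_le_inv, ENNReal.ofReal_le_one])
    _ = ∑' mn : ℤ × ℤ, 2 ^ (j * (d * q⁻¹ - 2)) * eLpNorm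
        (dyadicBlock φ j (mulPair (dyadicBlock φ (j + mn.1) a) (dyadicBlock φ (j + mn.2) b)))
        (ENNReal.ofReal q⁻¹)⁻¹ volume := by
      rw [← ENNReal.tsum_mul_left]
      exact (((Equiv.addLeft j).prodCongr (Equiv.addLeft j)).tsum_eq fun kl : ℤ × ℤ =>
        2 ^ (j * (d * q⁻¹ - 2)) * eLpNorm
        (dyadicBlock φ j (mulPair (dyadicBlock φ kl.1 a) (dyadicBlock φ kl.2 b)))
        (ENNReal.ofReal q⁻¹)⁻¹ volume).symm
    _ ≤ ∑' mn : ℤ × ℤ, c * (2 ^ (-δ * |(mn.1 : ℝ)|) * 2 ^ (-δ * |(mn.2 : ℝ)|)) * W := by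
      refine ENNReal.tsum_le_tsum fun mn => h j mn.1 mn.2 a b ?_ ?_ ?_ ?_ <;>
        exact fun k => le_iSup (fun k : ℤ => _ * eLpNorm (dyadicBlock φ k _) _ _) k
    _ = c * (G * G) * W := by
      rw [ENNReal.tsum_mul_right, ENNReal.tsum_mul_left, ENNReal.tsum_prod']
      simp only [ENNReal.tsum_mul_left, ENNReal.tsum_mul_right, ← hG]
    _ ≤ _ := by gcongr
end
end

section
/- Let d ≥ 3, T > 0, let ρ, ρ₁, ρ₂, ρ̄₁, ρ̄₂ ∈ [1,∞] satisfy 1/ρ = 1/ρ₁ + 1/ρ₂ = 1/ρ̄₁ + 1/ρ̄₂, and let 1 ≤ q ≤ p ≤ 2q with p < d and 1/q < 1/p + 2/d. Then there exists a constant C > 0 such that for all time-dependent functions a, b on [0,T]×ℝ^d (Schwartz in x for each t, measurable in t, with all the norms below finite), ‖ab‖_{L̃^ρ_T(Ḃ^{d/q−2}_{q,∞})} ≤ C·( ‖a‖_{L̃^{ρ₁}_T(Ḃ^{d/p−2}_{p,∞})}·‖b‖_{L̃^{ρ₂}_T(Ḃ^{d/p}_{p,∞})} + ‖b‖_{L̃^{ρ̄₁}_T(Ḃ^{d/p−2}_{p,∞})}·‖a‖_{L̃^{ρ̄₂}_T(Ḃ^{d/p}_{p,∞})}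 ). -/
open MeasureTheory SchwartzMap Real
open scoped FourierTransform ENNReal NNReal

noncomputable section

/-- L^ρ norm in time on [0,T] of an ℝ≥0∞-valued function. -/
def timeLp (ρ : ℝ≥0∞) (T : ℝ) (g : ℝ → ℝ≥0∞) : ℝ≥0∞ :=
  if ρ = ∞ then essSup g (volume.restrict (Set.Icc (0:ℝ) T))
  else (∫⁻ t in Set.Icc (0:ℝ) T, g t ^ ρ.toReal) ^ (1 / ρ.toReal)

/-- Chemin–Lerner norm ‖f‖_{L̃^ρ_T(Ḃ^s_{p,r})}. -/
def cheminLerner (d : ℕ) (φ : Rd d → ℝ) (T : ℝ) (ρ : ℝ≥0∞) (s : ℝ) (p r : ℝ≥0∞)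
    (f : ℝ → Rd d → ℂ) : ℝ≥0∞ :=
  seqNorm r fun j =>
    ENNReal.ofReal ((2:ℝ) ^ ((j : ℝ) * s)) *
      timeLp ρ T fun t => eLpNorm (LPblock d φ j (f t)) p volume

/-! ### Lebesgue norms: countable Minkowski and Hölder inequalities -/

section LebesgueNorms

variable {α : Type*} {mα : MeasurableSpace α} {μ : Measure α}

/-- Minkowski's inequality for countable sums of extended nonnegative functions. -/
lemma eLpNorm_tsum_le_tsum {ι : Type*} [Countable ι] {p : ℝ≥0∞} (hp : 1 ≤ p)
    {g : ι → α → ℝ≥0∞} (hg : ∀ i, Measurable (g i)) :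
    eLpNorm (fun x => ∑' i, g i x) p μ ≤ ∑' i, eLpNorm (g i) p μ := by
  by_cases hpt : p = ∞
  · subst hpt
    simp only [eLpNorm_exponent_top]
    refine essSup_le_of_ae_le _ ?_
    have h : ∀ᵐ x ∂μ, ∀ i, g i x ≤ eLpNormEssSup (g i) μ :=
      ae_all_iff.2 fun i => by simpa using enorm_ae_le_eLpNormEssSup (g i) μ
    filter_upwards [h] with x hx
    simpa using ENNReal.tsum_le_tsum hx
  · have hp0 : p ≠ 0 := (zero_lt_one.trans_le hp).ne'
    have hpr : 0 < p.toReal := ENNReal.toReal_pos hp0 hpt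
    classical
    have hsup : eLpNorm (fun x => ∑' i, g i x) p μ
        = ⨆ s : Finset ι, eLpNorm (fun x => ∑ i ∈ s, g i x) p μ := by
      simp only [eLpNorm_eq_lintegral_rpow_enorm_toReal hp0 hpt, enorm_eq_self]
      have hpt : ∀ x, (∑' i, g i x) ^ p.toReal
          = ⨆ s : Finset ι, (∑ i ∈ s, g i x) ^ p.toReal := fun x => by
        rw [ENNReal.tsum_eq_iSup_sum]
        exact (ENNReal.orderIsoRpow p.toReal hpr).map_iSup _
      simp only [hpt]
      rw [lintegral_iSup_directed]
      · exact (ENNReal.orderIsoRpow (1 / p.toReal) (by positivity)).map_iSup _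
      · intro s
        exact ((Finset.measurable_sum s fun i _ => hg i).pow_const _).aemeasurable
      · refine Monotone.directed_le fun s t hst x => ?_
        exact ENNReal.rpow_le_rpow (Finset.sum_le_sum_of_subset hst) hpr.le
    rw [hsup]
    refine iSup_le fun s => ?_
    calc eLpNorm (fun x => ∑ i ∈ s, g i x) p μ
        = eLpNorm (∑ i ∈ s, g i) p μ := by congr 1; ext x; simp
      _ ≤ ∑ i ∈ s, eLpNorm (g i) p μ :=
          eLpNorm_sum_le (fun i _ => (hg i).aestronglyMeasurable) hp
      _ ≤ _ := ENNReal.sum_le_tsum s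

lemma eLpNorm_const_mul_le (c : ℝ≥0∞) (hc : c ≠ ∞) (g : α → ℝ≥0∞) (p : ℝ≥0∞) :
    eLpNorm (fun x => c * g x) p μ ≤ c * eLpNorm g p μ := by
  lift c to ℝ≥0 using hc
  exact eLpNorm_le_nnreal_smul_eLpNorm_of_ae_le_mul' (c := c) (by simp) p

lemma mul_eLpNorm_le {c : ℝ≥0∞} (hc0 : c ≠ 0)
    (hc : c ≠ ∞) (g : α → ℝ≥0∞) (p : ℝ≥0∞) :
    c * eLpNorm g p μ ≤ eLpNorm (fun x => c * g x) p μ := by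
  have h := eLpNorm_const_mul_le (μ := μ) c⁻¹ (ENNReal.inv_ne_top.2 hc0) (fun x => c * g x) p
  simp only [← mul_assoc, ENNReal.inv_mul_cancel hc0 hc, one_mul] at h
  calc c * eLpNorm g p μ ≤ c * (c⁻¹ * eLpNorm (fun x => c * g x) p μ) := by gcongr
    _ = _ := by rw [← mul_assoc, ENNReal.mul_inv_cancel hc0 hc, one_mul]

/-- Hölder's inequality for almost everywhere finite extended nonnegative functions. -/
lemma eLpNorm_mul_le_mul_eLpNorm {p q r : ℝ≥0∞} (hpqr : 1 / r = 1 / p + 1 / q)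
    {f g : α → ℝ≥0∞} (hf : Measurable f) (hg : Measurable g)
    (hf' : ∀ᵐ x ∂μ, f x ≠ ∞) (hg' : ∀ᵐ x ∂μ, g x ≠ ∞) :
    eLpNorm (fun x => f x * g x) r μ ≤ eLpNorm f p μ * eLpNorm g q μ := by
  have : ENNReal.HolderTriple p q r := ⟨by simpa using hpqr.symm⟩
  have key := eLpNorm_smul_le_mul_eLpNorm (μ := μ) (p := p) (q := q) (r := r)
    (φ := fun x => (f x).toReal) (f := fun x => (g x).toReal)
    hg.ennreal_toReal.aestronglyMeasurable hf.ennreal_toReal.aestronglyMeasurable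
  have hfe : eLpNorm (fun x => (f x).toReal) p μ = eLpNorm f p μ :=
    eLpNorm_congr_enorm_ae (by filter_upwards [hf'] with x hx; simp [hx])
  have hge : eLpNorm (fun x => (g x).toReal) q μ = eLpNorm g q μ :=
    eLpNorm_congr_enorm_ae (by filter_upwards [hg'] with x hx; simp [hx])
  rw [hfe, hge] at key
  refine le_trans (le_of_eq (eLpNorm_congr_enorm_ae ?_)) key
  filter_upwards [hf', hg'] with x hx hx'
  simp [enorm_mul, hx, hx']

/-- Interpolation between `L^r` and `L^∞`, with exponents written through their inverses. -/
lemma eLpNorm_interpolate {a b : ℝ} (ha : 0 < a) (hb : 0 ≤ b) (hba : b ≤ a)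
    {u : α → ℂ} {X Y : ℝ≥0∞} (hYt : Y ≠ ∞)
    (hX : eLpNorm u (ENNReal.ofReal a)⁻¹ μ ≤ X) (hY : ∀ x, ‖u x‖ₑ ≤ Y) :
    eLpNorm u (ENNReal.ofReal b)⁻¹ μ ≤ X ^ (b / a) * Y ^ (1 - b / a) := by
  rcases hb.eq_or_lt with rfl | hb0
  · simp only [ENNReal.ofReal_zero, ENNReal.inv_zero, eLpNorm_exponent_top, zero_div,
      ENNReal.rpow_zero, sub_zero, ENNReal.rpow_one, one_mul]
    exact essSup_le_of_ae_le _ (.of_forall hY)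
  have hexp : ∀ c : ℝ, 0 < c → eLpNorm u (ENNReal.ofReal c)⁻¹ μ
      = (∫⁻ x, ‖u x‖ₑ ^ c⁻¹ ∂μ) ^ c := fun c hc => by
    rw [eLpNorm_eq_lintegral_rpow_enorm_toReal (by simp) (by simpa using hc)]
    simp [ENNReal.toReal_ofReal hc.le]
  rw [hexp a ha] at hX
  rw [hexp b hb0]
  have h1 : ∫⁻ x, ‖u x‖ₑ ^ b⁻¹ ∂μ ≤ Y ^ (b⁻¹ - a⁻¹) * ∫⁻ x, ‖u x‖ₑ ^ a⁻¹ ∂μ := by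
    have hab : 0 ≤ b⁻¹ - a⁻¹ := sub_nonneg.2 (inv_anti₀ hb0 hba)
    calc ∫⁻ x, ‖u x‖ₑ ^ b⁻¹ ∂μ ≤ ∫⁻ x, Y ^ (b⁻¹ - a⁻¹) * ‖u x‖ₑ ^ a⁻¹ ∂μ := by
          refine lintegral_mono fun x => ?_
          calc ‖u x‖ₑ ^ b⁻¹ = ‖u x‖ₑ ^ (b⁻¹ - a⁻¹) * ‖u x‖ₑ ^ a⁻¹ := by
                rw [← ENNReal.rpow_add_of_nonneg _ _ hab (by positivity)]; simp
            _ ≤ _ := by gcongr; exact hY x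
      _ = _ := lintegral_const_mul' _ _ (ENNReal.rpow_ne_top_of_nonneg hab hYt)
  calc (∫⁻ x, ‖u x‖ₑ ^ b⁻¹ ∂μ) ^ b
      ≤ (Y ^ (b⁻¹ - a⁻¹) * ∫⁻ x, ‖u x‖ₑ ^ a⁻¹ ∂μ) ^ b := by gcongr
    _ = ((∫⁻ x, ‖u x‖ₑ ^ a⁻¹ ∂μ) ^ a) ^ (b / a) * Y ^ (1 - b / a) := by
        rw [ENNReal.mul_rpow_of_nonneg _ _ hb, ← ENNReal.rpow_mul, ← ENNReal.rpow_mul, mul_comm]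
        congr 2 <;> field_simp
    _ ≤ _ := by gcongr

end LebesgueNorms

/-! ### Dyadic Fourier multipliers on Schwartz functions -/

section Multipliers

variable {d : ℕ}

/-- The weight `2 ^ x` as an extended nonnegative real. -/
def twoPow (x : ℝ) : ℝ≥0∞ := ENNReal.ofReal ((2 : ℝ) ^ x)

lemma twoPow_add (x y : ℝ) : twoPow (x + y) = twoPow x * twoPow y := by
  rw [twoPow, Real.rpow_add two_pos, ENNReal.ofReal_mul (by positivity)]; rfl

lemma twoPow_ne_top (x : ℝ) : twoPow x ≠ ∞ := ENNReal.ofReal_ne_top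

lemma twoPow_mono {x y : ℝ} (h : x ≤ y) : twoPow x ≤ twoPow y :=
  ENNReal.ofReal_le_ofReal (Real.rpow_le_rpow_of_exponent_le one_le_two h)

lemma twoPow_rpow (x y : ℝ) : twoPow x ^ y = twoPow (x * y) := by
  rw [twoPow, ENNReal.ofReal_rpow_of_pos (by positivity), ← Real.rpow_mul two_pos.le]; rfl

/-- The dilated symbol `ψ (2 ^ (-j) • ·)`. -/
def dilate (j : ℤ) (ψ : 𝓢(Rd d, ℂ)) : 𝓢(Rd d, ℂ) :=
  compCLMOfContinuousLinearEquiv ℂ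
    (ContinuousLinearEquiv.smulLeft (Units.mk0 ((2 : ℝ) ^ (-j)) (by positivity))) ψ

lemma dilate_apply (j : ℤ) (ψ : 𝓢(Rd d, ℂ)) (ξ : Rd d) :
    dilate j ψ ξ = ψ (((2 : ℝ) ^ (-j)) • ξ) := rfl

/-- The pointwise product of two Schwartz functions. -/
def schwartzMul (f g : 𝓢(Rd d, ℂ)) : 𝓢(Rd d, ℂ) := pairing (ContinuousLinearMap.mul ℂ ℂ) f g

@[simp] lemma schwartzMul_apply (f g : 𝓢(Rd d, ℂ)) (x : Rd d) :
    schwartzMul f g x = f x * g x := rfl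

/-- The Fourier multiplier with symbol `ψ (2 ^ (-j) • ·)`. -/
def freqBlock (ψ : 𝓢(Rd d, ℂ)) (j : ℤ) (f : 𝓢(Rd d, ℂ)) : 𝓢(Rd d, ℂ) :=
  𝓕⁻ (schwartzMul (dilate j ψ) (𝓕 f))

lemma fourier_freqBlock (ψ : 𝓢(Rd d, ℂ)) (j : ℤ) (f : 𝓢(Rd d, ℂ)) :
    𝓕 (freqBlock ψ j f) = schwartzMul (dilate j ψ) (𝓕 f) := by
  simp [freqBlock]

lemma freqBlock_apply (ψ : 𝓢(Rd d, ℂ)) (j : ℤ) (f : 𝓢(Rd d, ℂ)) (x : Rd d) :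
    freqBlock ψ j f x = ∫ y, 𝓕⁻ (dilate j ψ) y * f (x - y) := by
  have h : freqBlock ψ j f
      = SchwartzMap.convolution (ContinuousLinearMap.mul ℂ ℂ) (𝓕⁻ (dilate j ψ)) f := by
    simp [freqBlock, SchwartzMap.convolution, schwartzMul]
  rw [h, SchwartzMap.convolution_apply]
  rfl

lemma fourierInv_dilate_apply (ψ : 𝓢(Rd d, ℂ)) (j : ℤ) (x : Rd d) :
    𝓕⁻ (dilate j ψ) x = (((2 : ℝ) ^ j) ^ d) • 𝓕⁻ ψ (((2 : ℝ) ^ j) • x) := by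
  simp only [fourierInv_coe, Real.fourierInv_eq]
  have h := Measure.integral_comp_smul (volume : Measure (Rd d))
    (fun v => 𝐞 (inner ℝ v (((2 : ℝ) ^ j) • x)) • ψ v) ((2 : ℝ) ^ (-j))
  have h2 : |(((2 : ℝ) ^ (-j)) ^ Module.finrank ℝ (Rd d))⁻¹| = ((2 : ℝ) ^ j) ^ d := by
    rw [abs_of_pos (by positivity)]; simp [zpow_neg]
  rw [h2] at h
  rw [← h]
  refine integral_congr_ae (.of_forall fun v => ?_)
  simp only [dilate_apply, inner_smul_left, inner_smul_right]
  congr 2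
  have htwo : (2 : ℝ) ^ j ≠ 0 := by positivity
  simp [htwo]

lemma exists_kernel_bound (ψ : 𝓢(Rd d, ℂ)) : ∃ M : ℝ≥0∞, M ≠ ∞ ∧ ∀ j : ℤ,
    (∫⁻ x, ‖𝓕⁻ (dilate j ψ) x‖ₑ) ≤ M ∧
      ∀ x, ‖𝓕⁻ (dilate j ψ) x‖ₑ ≤ M * twoPow (j * d) := by
  set K := 𝓕⁻ ψ with hK
  obtain ⟨B, hB0, hB⟩ := K.decay 0 0
  have hB' : ∀ x, ‖K x‖ ≤ B := fun x => by simpa using hB x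
  refine ⟨max (∫⁻ x, ‖K x‖ₑ) (ENNReal.ofReal B), ?_, fun j => ⟨?_, fun x => ?_⟩⟩
  · exact (max_lt K.integrable.2 ENNReal.ofReal_lt_top).ne
  · refine le_trans (le_of_eq ?_) (le_max_left _ _)
    rw [← ofReal_integral_norm_eq_lintegral_enorm (𝓕⁻ (dilate j ψ)).integrable,
      ← ofReal_integral_norm_eq_lintegral_enorm K.integrable]
    congr 1
    simp only [fourierInv_dilate_apply, norm_smul, integral_const_mul]
    rw [Measure.integral_comp_smul volume (fun x => ‖𝓕⁻ ψ x‖) ((2 : ℝ) ^ j)]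
    have h2 : |(((2 : ℝ) ^ j) ^ Module.finrank ℝ (Rd d))⁻¹| = (((2 : ℝ) ^ j) ^ d)⁻¹ := by
      rw [abs_of_pos (by positivity)]; simp
    rw [h2, smul_eq_mul, ← mul_assoc, Real.norm_of_nonneg (by positivity),
      mul_inv_cancel₀ (by positivity), one_mul]
  · refine le_trans ?_ (mul_le_mul_left (le_max_right _ _) _)
    rw [fourierInv_dilate_apply, twoPow, ← ENNReal.ofReal_mul hB0.le, ← ofReal_norm]
    refine ENNReal.ofReal_le_ofReal ?_
    rw [norm_smul, Real.norm_of_nonneg (by positivity), mul_comm, Real.rpow_mul two_pos.le,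
      Real.rpow_intCast, Real.rpow_natCast]
    gcongr
    exact hB' _

/-- Bernstein's inequality for dyadic Fourier multipliers, with Lebesgue exponents written
through their inverses. -/
lemma exists_eLpNorm_freqBlock_le (ψ : 𝓢(Rd d, ℂ)) : ∃ M : ℝ≥0∞, M ≠ ∞ ∧
    ∀ a b : ℝ, 0 < a → a ≤ 1 → 0 ≤ b → b ≤ a → ∀ (j : ℤ) (f : 𝓢(Rd d, ℂ)),
      eLpNorm (freqBlock ψ j f) (ENNReal.ofReal b)⁻¹ volume
        ≤ M * twoPow (j * d * (a - b)) * eLpNorm f (ENNReal.ofReal a)⁻¹ volume := by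
  obtain ⟨M, hM, hMb⟩ := exists_kernel_bound ψ
  refine ⟨M, hM, fun a b ha ha1 hb hba j f => ?_⟩
  obtain ⟨hM1, hM2⟩ := hMb j
  set K := 𝓕⁻ (dilate j ψ) with hK
  set X := eLpNorm f (ENNReal.ofReal a)⁻¹ volume with hX
  have hXt : X ≠ ∞ := (f.eLpNorm_lt_top _ _).ne
  have hfin : (ENNReal.ofReal a)⁻¹.toReal = a⁻¹ := by simp [ENNReal.toReal_ofReal ha.le]
  have hXe : X = (∫⁻ x, ‖f x‖ₑ ^ a⁻¹) ^ a := by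
    rw [hX, eLpNorm_eq_lintegral_rpow_enorm_toReal (by simp) (by simpa using ha)]
    simp [hfin]
  set ν : Measure (Rd d) := volume.withDensity fun y => ‖K y‖ₑ with hν
  have hKm : Measurable fun y => ‖K y‖ₑ := K.continuous.enorm.measurable
  have hνu : ν Set.univ ≤ M := by simpa [hν] using hM1
  have hfm : ∀ x, Measurable fun y => ‖f (x - y)‖ₑ := fun x =>
    (f.continuous.comp (by fun_prop)).enorm.measurable
  have hpt : ∀ x, ‖freqBlock ψ j f x‖ₑ
      ≤ (∫⁻ y, ‖K y‖ₑ * ‖f (x - y)‖ₑ ^ a⁻¹) ^ a * M ^ (1 - a) := fun x => by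
    calc ‖freqBlock ψ j f x‖ₑ ≤ ∫⁻ y, ‖K y * f (x - y)‖ₑ := by
          rw [freqBlock_apply]; exact enorm_integral_le_lintegral_enorm _
      _ = eLpNorm (fun y => f (x - y)) 1 ν := by
          rw [eLpNorm_one_eq_lintegral_enorm, hν,
            lintegral_withDensity_eq_lintegral_mul _ hKm (hfm x)]
          simp [enorm_mul]
      _ ≤ eLpNorm (fun y => f (x - y)) (ENNReal.ofReal a)⁻¹ ν * ν Set.univ ^ (1 - a) := by
          have := eLpNorm_le_eLpNorm_mul_rpow_measure_univ (μ := ν) (p := 1)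
            (q := (ENNReal.ofReal a)⁻¹) (f := fun y => f (x - y))
            (by simpa using ha1)
            (f.continuous.comp (by fun_prop)).aestronglyMeasurable
          simpa [hfin] using this
      _ ≤ _ := by
          gcongr
          · rw [eLpNorm_eq_lintegral_rpow_enorm_toReal (by simp) (by simpa using ha), hfin, hν,
              lintegral_withDensity_eq_lintegral_mul _ hKm ((hfm x).pow_const _)]
            simp
  have hMM : M ^ a * M ^ (1 - a) = M := by
    rw [← ENNReal.rpow_add_of_nonneg _ _ ha.le (by linarith)]; simp
  have hsup : ∀ x, ‖freqBlock ψ j f x‖ₑ ≤ M * twoPow (j * d * a) * X := fun x => by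
    refine (hpt x).trans ?_
    calc (∫⁻ y, ‖K y‖ₑ * ‖f (x - y)‖ₑ ^ a⁻¹) ^ a * M ^ (1 - a)
        ≤ (∫⁻ y, M * twoPow (j * d) * ‖f (x - y)‖ₑ ^ a⁻¹) ^ a * M ^ (1 - a) := by
          gcongr with y
          exact hM2 y
      _ = (M * twoPow (j * d) * ∫⁻ y, ‖f y‖ₑ ^ a⁻¹) ^ a * M ^ (1 - a) := by
          rw [lintegral_const_mul' _ _ (ENNReal.mul_ne_top hM (twoPow_ne_top _)),
            lintegral_sub_left_eq_self (fun y => ‖f y‖ₑ ^ a⁻¹) x]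
      _ = (M ^ a * M ^ (1 - a)) * twoPow (j * d * a) * X := by
          rw [ENNReal.mul_rpow_of_nonneg _ _ ha.le, ENNReal.mul_rpow_of_nonneg _ _ ha.le,
            twoPow_rpow, hXe]
          ring
      _ = _ := by rw [hMM]
  have hLr : eLpNorm (freqBlock ψ j f) (ENNReal.ofReal a)⁻¹ volume ≤ M * X := by
    rw [eLpNorm_eq_lintegral_rpow_enorm_toReal (by simp) (by simpa using ha), hfin]
    simp only [one_div, inv_inv]
    calc (∫⁻ x, ‖freqBlock ψ j f x‖ₑ ^ a⁻¹) ^ a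
        ≤ (∫⁻ x, (∫⁻ y, ‖K y‖ₑ * ‖f (x - y)‖ₑ ^ a⁻¹) * (M ^ (1 - a)) ^ a⁻¹) ^ a := by
          gcongr with x
          calc ‖freqBlock ψ j f x‖ₑ ^ a⁻¹ ≤ _ := ENNReal.rpow_le_rpow (hpt x) (by positivity)
            _ = _ := by
              rw [ENNReal.mul_rpow_of_nonneg _ _ (by positivity), ← ENNReal.rpow_mul _ a,
                mul_inv_cancel₀ ha.ne', ENNReal.rpow_one]
      _ = ((∫⁻ y, ‖K y‖ₑ) * (∫⁻ y, ‖f y‖ₑ ^ a⁻¹) * (M ^ (1 - a)) ^ a⁻¹) ^ a := by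
          have hc : (M ^ (1 - a)) ^ a⁻¹ ≠ ∞ :=
            ENNReal.rpow_ne_top_of_nonneg (by positivity)
              (ENNReal.rpow_ne_top_of_nonneg (by linarith) hM)
          rw [lintegral_mul_const' _ _ hc, lintegral_lintegral_swap]
          · congr 2
            rw [← lintegral_mul_const _ hKm]
            refine lintegral_congr fun y => ?_
            rw [lintegral_const_mul' _ _ enorm_ne_top,
              lintegral_sub_right_eq_self (fun x => ‖f x‖ₑ ^ a⁻¹) y]
          · refine Measurable.aemeasurable ?_
            refine (hKm.comp measurable_snd).mul (Measurable.pow_const ?_ _)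
            exact (f.continuous.comp (by fun_prop)).enorm.measurable
      _ ≤ (M * (∫⁻ y, ‖f y‖ₑ ^ a⁻¹) * (M ^ (1 - a)) ^ a⁻¹) ^ a := by gcongr
      _ = (M ^ a * M ^ (1 - a)) * X := by
          rw [ENNReal.mul_rpow_of_nonneg _ _ ha.le, ENNReal.mul_rpow_of_nonneg _ _ ha.le,
            ← ENNReal.rpow_mul _ a⁻¹ a, inv_mul_cancel₀ ha.ne', ENNReal.rpow_one, hXe]
          ring
      _ = _ := by rw [hMM]
  have hθ0 : 0 ≤ b / a := by positivity
  have hθ1 : 0 ≤ 1 - b / a := sub_nonneg.2 ((div_le_one ha).2 hba)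
  refine (eLpNorm_interpolate ha hb hba
    (ENNReal.mul_ne_top (ENNReal.mul_ne_top hM (twoPow_ne_top _)) hXt) hLr hsup).trans
    (le_of_eq ?_)
  have hZ : M * twoPow (j * d * a) * X = (M * X) * twoPow (j * d * a) := by ring
  rw [hZ, ENNReal.mul_rpow_of_nonneg (M * X) _ hθ1, ← mul_assoc,
    ← ENNReal.rpow_add_of_nonneg _ _ hθ0 hθ1, twoPow_rpow]
  have h1 : b / a + (1 - b / a) = 1 := by ring
  have h2 : (j * d * a : ℝ) * (1 - b / a) = j * d * (a - b) := by field_simp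
  rw [h1, h2, ENNReal.rpow_one]
  ring

end Multipliers

/-! ### The Littlewood–Paley decomposition of a product -/

section Decomposition

variable {d : ℕ}

lemma fourier_schwartzMul_apply (u v : 𝓢(Rd d, ℂ)) (ξ : Rd d) :
    𝓕 (schwartzMul u v) ξ = ∫ η, 𝓕 u η * 𝓕 v (ξ - η) := by
  have h : schwartzMul u v
      = 𝓕⁻ (SchwartzMap.convolution (ContinuousLinearMap.mul ℂ ℂ) (𝓕 u) (𝓕 v)) := by
    ext x
    have hu : u x = 𝓕 (𝓕 u) (-x) := by
      have := DFunLike.congr_fun (fourierInv_apply_eq (𝓕 u)) x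
      simpa using this
    have hv : v x = 𝓕 (𝓕 v) (-x) := by
      have := DFunLike.congr_fun (fourierInv_apply_eq (𝓕 v)) x
      simpa using this
    rw [fourierInv_apply_eq, fourier_convolution, schwartzMul_apply, hu, hv]
    simp
  rw [h, FourierTransform.fourier_fourierInv_eq, SchwartzMap.convolution_apply]
  rfl

lemma freqBlock_schwartzMul_eq_zero (Φ : 𝓢(Rd d, ℂ)) (j k l : ℤ)
    (h : ∀ ξ η : Rd d, dilate k Φ η ≠ 0 → dilate l Φ (ξ - η) ≠ 0 → dilate j Φ ξ = 0)
    (f g : 𝓢(Rd d, ℂ)) :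
    freqBlock Φ j (schwartzMul (freqBlock Φ k f) (freqBlock Φ l g)) = 0 := by
  have h0 : schwartzMul (dilate j Φ)
      (𝓕 (schwartzMul (freqBlock Φ k f) (freqBlock Φ l g))) = 0 := by
    ext ξ
    rw [schwartzMul_apply, fourier_schwartzMul_apply, ← integral_const_mul]
    simp only [fourier_freqBlock, schwartzMul_apply]
    refine integral_eq_zero_of_ae (.of_forall fun η => ?_)
    by_cases h1 : dilate k Φ η = 0
    · simp [h1]
    by_cases h2 : dilate l Φ (ξ - η) = 0
    · simp [h2]
    simp [h ξ η h1 h2]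
  rw [freqBlock, h0]
  exact map_zero (FourierTransform.fourierInvCLM ℂ 𝓢(Rd d, ℂ))

lemma freqBlock_freqBlock_of_eq_one {Φ χ : 𝓢(Rd d, ℂ)} (h : ∀ ξ, Φ ξ ≠ 0 → χ ξ = 1)
    (k : ℤ) (f : 𝓢(Rd d, ℂ)) : freqBlock χ k (freqBlock Φ k f) = freqBlock Φ k f := by
  rw [freqBlock, fourier_freqBlock]
  conv_rhs => rw [freqBlock]
  congr 1
  ext ξ
  simp only [schwartzMul_apply, dilate_apply]
  by_cases h0 : Φ (((2 : ℝ) ^ (-k)) • ξ) = 0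
  · rw [h0, zero_mul, mul_zero]
  · rw [h _ h0, one_mul]

/-- The symbol is supported in the annulus `3 / 4 ≤ ‖ξ‖ ≤ 8 / 3`. -/
def AnnulusSupported (Φ : 𝓢(Rd d, ℂ)) : Prop :=
  ∀ ξ, Φ ξ ≠ 0 → 3 / 4 ≤ ‖ξ‖ ∧ ‖ξ‖ ≤ 8 / 3

lemma AnnulusSupported.norm_dilate {Φ : 𝓢(Rd d, ℂ)} (hΦ : AnnulusSupported Φ) {k : ℤ} {ξ : Rd d}
    (h : dilate k Φ ξ ≠ 0) : 3 / 4 * (2 : ℝ) ^ k ≤ ‖ξ‖ ∧ ‖ξ‖ ≤ 8 / 3 * (2 : ℝ) ^ k := by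
  rw [dilate_apply] at h
  obtain ⟨h1, h2⟩ := hΦ _ h
  have hk : (0 : ℝ) < 2 ^ k := by positivity
  rw [norm_smul, Real.norm_of_nonneg (by positivity), zpow_neg, inv_mul_eq_div] at h1 h2
  exact ⟨(le_div_iff₀ hk).1 h1, (div_le_iff₀ hk).1 h2⟩

lemma AnnulusSupported.le_add_one {Φ : 𝓢(Rd d, ℂ)} (hΦ : AnnulusSupported Φ) {k l : ℤ} {ξ : Rd d}
    (hk : dilate k Φ ξ ≠ 0) (hl : dilate l Φ ξ ≠ 0) : k ≤ l + 1 := by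
  by_contra! hlt
  have h1 := (hΦ.norm_dilate hk).1
  have h2 := (hΦ.norm_dilate hl).2
  have h3 : (2 : ℝ) ^ (l + 2) ≤ 2 ^ k := zpow_le_zpow_right₀ one_le_two (by omega)
  rw [zpow_add₀ two_ne_zero] at h3
  have hl0 : (0 : ℝ) < 2 ^ l := by positivity
  norm_num at h3
  linarith

lemma AnnulusSupported.exists_finset {Φ : 𝓢(Rd d, ℂ)} (hΦ : AnnulusSupported Φ) (ξ : Rd d) :
    ∃ s : Finset ℤ, s.card ≤ 3 ∧ ∀ k ∉ s, dilate k Φ ξ = 0 := by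
  by_cases h : ∃ k, dilate k Φ ξ ≠ 0
  · obtain ⟨k, hk⟩ := h
    refine ⟨Finset.Icc (k - 1) (k + 1), by simp; omega, fun l hl => ?_⟩
    by_contra h0
    have h1 := hΦ.le_add_one hk h0
    have h2 := hΦ.le_add_one h0 hk
    exact hl (Finset.mem_Icc.2 ⟨by omega, by omega⟩)
  · push Not at h
    exact ⟨∅, by simp, fun k _ => h k⟩

lemma AnnulusSupported.tsum_lintegral_lt_top {Φ : 𝓢(Rd d, ℂ)} (hΦ : AnnulusSupported Φ)
    (f : 𝓢(Rd d, ℂ)) : ∑' k : ℤ, ∫⁻ ξ, ‖dilate k Φ ξ * 𝓕 f ξ‖ₑ < ∞ := by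
  obtain ⟨B, hB0, hB⟩ := Φ.decay 0 0
  have hB' : ∀ k ξ, ‖dilate k Φ ξ‖ₑ ≤ ENNReal.ofReal B := fun k ξ => by
    rw [← ofReal_norm, dilate_apply]
    exact ENNReal.ofReal_le_ofReal (by simpa using hB (((2 : ℝ) ^ (-k)) • ξ))
  have hmeas : ∀ k : ℤ, AEMeasurable (fun ξ => ‖dilate k Φ ξ * 𝓕 f ξ‖ₑ) volume := fun k =>
    (schwartzMul (dilate k Φ) (𝓕 f)).continuous.enorm.measurable.aemeasurable
  rw [← lintegral_tsum hmeas]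
  calc ∫⁻ ξ, ∑' k : ℤ, ‖dilate k Φ ξ * 𝓕 f ξ‖ₑ
      ≤ ∫⁻ ξ, 3 * ENNReal.ofReal B * ‖𝓕 f ξ‖ₑ := by
        refine lintegral_mono fun ξ => ?_
        obtain ⟨s, hs, hs0⟩ := hΦ.exists_finset ξ
        rw [tsum_eq_sum (s := s) fun k hk => by simp [hs0 k hk]]
        calc ∑ k ∈ s, ‖dilate k Φ ξ * 𝓕 f ξ‖ₑ
            ≤ ∑ k ∈ s, ENNReal.ofReal B * ‖𝓕 f ξ‖ₑ := by
              refine Finset.sum_le_sum fun k _ => ?_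
              rw [enorm_mul]; gcongr; exact hB' k ξ
          _ = s.card * (ENNReal.ofReal B * ‖𝓕 f ξ‖ₑ) := by simp
          _ ≤ 3 * (ENNReal.ofReal B * ‖𝓕 f ξ‖ₑ) := by gcongr; exact_mod_cast hs
          _ = _ := by ring
    _ = 3 * ENNReal.ofReal B * ∫⁻ ξ, ‖𝓕 f ξ‖ₑ :=
        lintegral_const_mul' _ _ (ENNReal.mul_ne_top (by simp) ENNReal.ofReal_ne_top)
    _ < ∞ := ENNReal.mul_lt_top (ENNReal.mul_lt_top (by simp) ENNReal.ofReal_lt_top)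
        (𝓕 f).integrable.2

lemma AnnulusSupported.summable_integral {Φ : 𝓢(Rd d, ℂ)} (hΦ : AnnulusSupported Φ)
    (f : 𝓢(Rd d, ℂ)) : Summable fun k : ℤ => ∫ ξ, ‖dilate k Φ ξ * 𝓕 f ξ‖ := by
  have h := ENNReal.summable_toReal (hΦ.tsum_lintegral_lt_top f).ne
  refine h.congr fun k => ?_
  rw [integral_norm_eq_lintegral_enorm]
  exact (schwartzMul (dilate k Φ) (𝓕 f)).continuous.aestronglyMeasurable

lemma freqBlock_apply_eq_integral (Φ : 𝓢(Rd d, ℂ)) (k : ℤ) (f : 𝓢(Rd d, ℂ)) (x : Rd d) :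
    freqBlock Φ k f x = ∫ ξ, 𝐞 (inner ℝ ξ x) • (dilate k Φ ξ * 𝓕 f ξ) := by
  rw [freqBlock, fourierInv_coe, Real.fourierInv_eq]
  rfl

lemma norm_freqBlock_le (Φ : 𝓢(Rd d, ℂ)) (k : ℤ) (f : 𝓢(Rd d, ℂ)) (x : Rd d) :
    ‖freqBlock Φ k f x‖ ≤ ∫ ξ, ‖dilate k Φ ξ * 𝓕 f ξ‖ := by
  rw [freqBlock_apply_eq_integral]
  refine (norm_integral_le_integral_norm _).trans (le_of_eq ?_)
  simp only [Circle.norm_smul]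

/-- The homogeneous Littlewood–Paley decomposition of a Schwartz function. -/
lemma AnnulusSupported.hasSum_freqBlock [NeZero d] {Φ : 𝓢(Rd d, ℂ)} (hΦ : AnnulusSupported Φ)
    (hsum : ∀ ξ : Rd d, ξ ≠ 0 → ∑' k : ℤ, Φ (((2 : ℝ) ^ (-k)) • ξ) = 1)
    (f : 𝓢(Rd d, ℂ)) (x : Rd d) : HasSum (fun k : ℤ => freqBlock Φ k f x) (f x) := by
  have hintegrable : ∀ k : ℤ, Integrable fun ξ : Rd d => 𝐞 (inner ℝ ξ x) • (dilate k Φ ξ * 𝓕 f ξ) :=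
    fun k => by
      have h := (Real.fourierIntegral_convergent_iff (-x)).2
        ((schwartzMul (dilate k Φ) (𝓕 f)).integrable (μ := volume))
      simpa using h
  have h := hasSum_integral_of_summable_integral_norm hintegrable
    (by simpa only [Circle.norm_smul] using hΦ.summable_integral f)
  simp only [← freqBlock_apply_eq_integral] at h
  have hf : f x = ∫ ξ, 𝐞 (inner ℝ ξ x) • 𝓕 f ξ := by
    have hinv : 𝓕⁻ (𝓕 f) = f := FourierTransform.fourierInv_fourier_eq f
    conv_lhs => rw [← hinv]
    rw [fourierInv_coe, Real.fourierInv_eq]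
  suffices hfx : f x = ∫ ξ, ∑' k : ℤ, 𝐞 (inner ℝ ξ x) • (dilate k Φ ξ * 𝓕 f ξ) by
    rw [hfx]; exact h
  rw [hf]
  refine integral_congr_ae ?_
  have : Nontrivial (Rd d) := inferInstance
  filter_upwards [(measure_singleton (0 : Rd d) : volume {(0 : Rd d)} = 0) |> compl_mem_ae_iff.2]
    with ξ hξ
  obtain ⟨s, -, hs0⟩ := hΦ.exists_finset ξ
  have h1 : ∑' k : ℤ, dilate k Φ ξ = 1 := hsum ξ hξ
  rw [tsum_eq_sum (s := s) fun k hk => hs0 k hk] at h1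
  rw [tsum_eq_sum (s := s) fun k hk => by simp [hs0 k hk], ← Finset.smul_sum, ← Finset.sum_mul]
  rw [h1, one_mul]

lemma tsum_mul_eq_of_hasSum {u v : ℤ → ℂ} {a b : ℂ} (hu : HasSum u a) (hv : HasSum v b) :
    ∑' n : ℤ × ℤ, u n.1 * v n.2 = a * b := by
  rw [← hu.tsum_eq, ← hv.tsum_eq]
  exact (tsum_mul_tsum_of_summable_norm hu.summable.norm hv.summable.norm).symm

/-- The block of a product is controlled by the blocks of the products of blocks. -/
lemma AnnulusSupported.enorm_freqBlock_schwartzMul_le [NeZero d] {Φ : 𝓢(Rd d, ℂ)}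
    (hΦ : AnnulusSupported Φ)
    (hsum : ∀ ξ : Rd d, ξ ≠ 0 → ∑' k : ℤ, Φ (((2 : ℝ) ^ (-k)) • ξ) = 1)
    (f g : 𝓢(Rd d, ℂ)) (j : ℤ) (x : Rd d) :
    ‖freqBlock Φ j (schwartzMul f g) x‖ₑ
      ≤ ∑' n : ℤ × ℤ, ‖freqBlock Φ j (schwartzMul (freqBlock Φ n.1 f) (freqBlock Φ n.2 g)) x‖ₑ := by
  set K := 𝓕⁻ (dilate j Φ) with hK
  set F : ℤ × ℤ → Rd d → ℂ := fun n y =>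
    K y * schwartzMul (freqBlock Φ n.1 f) (freqBlock Φ n.2 g) (x - y) with hF
  have hbound : ∀ n y, ‖F n y‖ ≤ ‖K y‖ * ((∫ ξ, ‖dilate n.1 Φ ξ * 𝓕 f ξ‖) *
      ∫ ξ, ‖dilate n.2 Φ ξ * 𝓕 g ξ‖) := fun n y => by
    rw [hF, norm_mul, schwartzMul_apply, norm_mul]
    gcongr <;> exact norm_freqBlock_le _ _ _ _
  have hFint : ∀ n, Integrable (F n) := fun n => by
    refine Integrable.mono' (K.integrable.norm.mul_const _) ?_ (.of_forall (hbound n))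
    exact (K.continuous.mul ((SchwartzMap.continuous _).comp (by fun_prop))).aestronglyMeasurable
  have hsm : Summable fun n => ∫ y, ‖F n y‖ := by
    refine Summable.of_nonneg_of_le (fun n => integral_nonneg fun y => norm_nonneg _)
      (fun n => ?_) (((hΦ.summable_integral f).mul_of_nonneg (hΦ.summable_integral g)
        (fun k => integral_nonneg fun y => norm_nonneg _)
        (fun k => integral_nonneg fun y => norm_nonneg _)).mul_left (∫ y, ‖K y‖))
    rw [← integral_mul_const]
    exact integral_mono (hFint n).norm (K.integrable.norm.mul_const _) (hbound n)
  have h := hasSum_integral_of_summable_integral_norm hFint hsm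
  have hval : ∫ y, ∑' n, F n y = freqBlock Φ j (schwartzMul f g) x := by
    rw [freqBlock_apply]
    refine integral_congr_ae (.of_forall fun y => ?_)
    have hfg := tsum_mul_eq_of_hasSum (hΦ.hasSum_freqBlock hsum f (x - y))
      (hΦ.hasSum_freqBlock hsum g (x - y))
    simp only [hF, schwartzMul_apply]
    rw [tsum_mul_left, hfg]
  rw [← hval, ← h.tsum_eq]
  refine (enorm_tsum_le_tsum_enorm).trans (le_of_eq ?_)
  simp only [freqBlock_apply, hF, hK]

end Decomposition

/-! ### Estimates for the dyadic pieces of a product -/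

section Pieces

variable {d : ℕ}

lemma exists_schwartz_eq_one (d : ℕ) (r : ℝ) (hr : 0 < r) :
    ∃ χ : 𝓢(Rd d, ℂ), ∀ ξ, ‖ξ‖ ≤ r → χ ξ = 1 := by
  let B : ContDiffBump (0 : Rd d) := ⟨r, r + 1, hr, by linarith⟩
  have hc : HasCompactSupport fun ξ => (B ξ : ℂ) :=
    B.hasCompactSupport.comp_left Complex.ofReal_zero
  have hs : ContDiff ℝ (⊤ : ℕ∞) fun ξ => (B ξ : ℂ) := Complex.ofRealCLM.contDiff.comp B.contDiff
  refine ⟨hc.toSchwartzMap hs, fun ξ hξ => ?_⟩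
  have h1 : B ξ = 1 := B.one_of_mem_closedBall (by simpa [B] using hξ)
  simp [h1]

/-- Bernstein's inequality for a single dyadic block. -/
lemma AnnulusSupported.exists_eLpNorm_le {Φ : 𝓢(Rd d, ℂ)} (hΦ : AnnulusSupported Φ) :
    ∃ M : ℝ≥0∞, M ≠ ∞ ∧ ∀ a b : ℝ, 0 < a → a ≤ 1 → 0 ≤ b → b ≤ a → ∀ (j : ℤ) (f : 𝓢(Rd d, ℂ)),
      eLpNorm (freqBlock Φ j f) (ENNReal.ofReal b)⁻¹ volume
        ≤ M * twoPow (j * d * (a - b))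
          * eLpNorm (freqBlock Φ j f) (ENNReal.ofReal a)⁻¹ volume := by
  obtain ⟨χ, hχ⟩ := exists_schwartz_eq_one d (8 / 3) (by norm_num)
  obtain ⟨M, hM, h⟩ := exists_eLpNorm_freqBlock_le χ
  refine ⟨M, hM, fun a b ha ha1 hb hba j f => ?_⟩
  have hfb := freqBlock_freqBlock_of_eq_one (fun ξ hξ => hχ ξ (hΦ ξ hξ).2) j f
  simpa only [hfb] using h a b ha ha1 hb hba j (freqBlock Φ j f)

lemma eLpNorm_schwartzMul_le {a b : ℝ} (ha : 0 ≤ a) (hb : 0 ≤ b) (u v : 𝓢(Rd d, ℂ)) :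
    eLpNorm (schwartzMul u v) (ENNReal.ofReal (a + b))⁻¹ volume
      ≤ eLpNorm u (ENNReal.ofReal a)⁻¹ volume * eLpNorm v (ENNReal.ofReal b)⁻¹ volume := by
  have : ENNReal.HolderTriple (ENNReal.ofReal a)⁻¹ (ENNReal.ofReal b)⁻¹
      (ENNReal.ofReal (a + b))⁻¹ := ⟨by simp [ENNReal.ofReal_add ha hb]⟩
  have hmul : (⇑(schwartzMul u v) : Rd d → ℂ) = (⇑u : Rd d → ℂ) • (⇑v : Rd d → ℂ) := by
    ext x; simp
  have hu : AEStronglyMeasurable (⇑u : Rd d → ℂ) volume := u.continuous.aestronglyMeasurable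
  have hv : AEStronglyMeasurable (⇑v : Rd d → ℂ) volume := v.continuous.aestronglyMeasurable
  rw [hmul]
  exact eLpNorm_smul_le_mul_eLpNorm hv hu

lemma AnnulusSupported.freqBlock_eq_zero {Φ : 𝓢(Rd d, ℂ)} (hΦ : AnnulusSupported Φ)
    {j k l : ℤ} (hkl : k ≤ l + 1) (h : l + 5 < j ∨ k ≤ l - 2 ∧ j < l - 5) (f g : 𝓢(Rd d, ℂ)) :
    freqBlock Φ j (schwartzMul (freqBlock Φ k f) (freqBlock Φ l g)) = 0 := by
  refine freqBlock_schwartzMul_eq_zero Φ j k l (fun ξ η hη hξη => ?_) f g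
  by_contra hξ
  obtain ⟨hk1, hk2⟩ := hΦ.norm_dilate hη
  obtain ⟨hl1, hl2⟩ := hΦ.norm_dilate hξη
  obtain ⟨hj1, hj2⟩ := hΦ.norm_dilate hξ
  have hmono : ∀ m n : ℤ, m ≤ n → (2 : ℝ) ^ m ≤ 2 ^ n := fun m n hmn =>
    zpow_le_zpow_right₀ one_le_two hmn
  have hl0 : (0 : ℝ) < 2 ^ l := by positivity
  have hadd : ∀ n : ℤ, (2 : ℝ) ^ (l + n) = 2 ^ l * 2 ^ n := fun n => zpow_add₀ two_ne_zero l n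
  rcases h with h | ⟨h, h'⟩
  · have h1 := norm_add_le (ξ - η) η
    rw [sub_add_cancel] at h1
    have h2 := hmono k (l + 1) hkl
    have h3 := hmono (l + 5) j h.le
    rw [hadd] at h2 h3
    norm_num at h2 h3
    linarith
  · have h1 := norm_sub_le ξ η
    have h2 := hmono k (l + -2) (by omega)
    have h3 := hmono j (l + -6) (by omega)
    rw [hadd] at h2 h3
    norm_num [zpow_neg] at h2 h3
    linarith

/-- Bernstein and Hölder for one piece of a product, through the exponent `1 / R`. -/
lemma eLpNorm_piece_le {Φ : 𝓢(Rd d, ℂ)} {M : ℝ≥0∞}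
    (hB : ∀ a b : ℝ, 0 < a → a ≤ 1 → 0 ≤ b → b ≤ a → ∀ (j : ℤ) (f : 𝓢(Rd d, ℂ)),
      eLpNorm (freqBlock Φ j f) (ENNReal.ofReal b)⁻¹ volume
        ≤ M * twoPow (j * d * (a - b)) * eLpNorm f (ENNReal.ofReal a)⁻¹ volume)
    (hB' : ∀ a b : ℝ, 0 < a → a ≤ 1 → 0 ≤ b → b ≤ a → ∀ (j : ℤ) (f : 𝓢(Rd d, ℂ)),
      eLpNorm (freqBlock Φ j f) (ENNReal.ofReal b)⁻¹ volume
        ≤ M * twoPow (j * d * (a - b)) * eLpNorm (freqBlock Φ j f) (ENNReal.ofReal a)⁻¹ volume)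
    {P Q R : ℝ} (hP : 0 < P) (hPR : P ≤ R) (hR : R ≤ 1) (hRP : R ≤ 2 * P) (hQ : 0 ≤ Q)
    (hQR : Q ≤ R) (j k l : ℤ) (f g : 𝓢(Rd d, ℂ)) :
    eLpNorm (freqBlock Φ j (schwartzMul (freqBlock Φ k f) (freqBlock Φ l g)))
        (ENNReal.ofReal Q)⁻¹ volume
      ≤ M * M * twoPow (j * d * (R - Q) + k * d * (2 * P - R))
        * (eLpNorm (freqBlock Φ k f) (ENNReal.ofReal P)⁻¹ volume
          * eLpNorm (freqBlock Φ l g) (ENNReal.ofReal P)⁻¹ volume) := by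
  set A := eLpNorm (freqBlock Φ k f) (ENNReal.ofReal P)⁻¹ volume
  set B := eLpNorm (freqBlock Φ l g) (ENNReal.ofReal P)⁻¹ volume
  have h1 := hB R Q (hP.trans_le hPR) hR hQ hQR j (schwartzMul (freqBlock Φ k f) (freqBlock Φ l g))
  have h2 := eLpNorm_schwartzMul_le (sub_nonneg.2 hPR) hP.le (freqBlock Φ k f) (freqBlock Φ l g)
  rw [sub_add_cancel] at h2
  have h3 := hB' P (R - P) hP (hPR.trans hR) (sub_nonneg.2 hPR) (by linarith) k f
  calc _ ≤ M * twoPow (j * d * (R - Q)) * ((M * twoPow (k * d * (P - (R - P))) * A) * B) :=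
        h1.trans (by gcongr; exact h2.trans (by gcongr))
    _ = _ := by
        rw [twoPow_add, show P - (R - P) = 2 * P - R by ring]; ring

/-- The pieces of a product decay geometrically away from the output frequency. -/
lemma AnnulusSupported.exists_piece_le {Φ : 𝓢(Rd d, ℂ)} (hΦ : AnnulusSupported Φ) (hd : 3 ≤ d)
    {P Q : ℝ} (hP : 1 < d * P) (hPQ : P ≤ Q) (hQ : Q ≤ 1) (hQP : Q ≤ 2 * P)
    (hQP' : d * (Q - P) < 2) :
    ∃ C : ℝ≥0∞, C ≠ ∞ ∧ ∃ ε : ℝ, 0 < ε ∧ ∀ (j k l : ℤ) (f g : 𝓢(Rd d, ℂ)), k ≤ l + 1 →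
      twoPow (j * (d * Q - 2))
        * eLpNorm (freqBlock Φ j (schwartzMul (freqBlock Φ k f) (freqBlock Φ l g)))
          (ENNReal.ofReal Q)⁻¹ volume
      ≤ C * (twoPow (-ε * |(k - j : ℤ)|) * twoPow (-ε * |(l - j : ℤ)|))
        * ((twoPow (k * (d * P - 2)) * eLpNorm (freqBlock Φ k f) (ENNReal.ofReal P)⁻¹ volume)
          * (twoPow (l * (d * P)) * eLpNorm (freqBlock Φ l g) (ENNReal.ofReal P)⁻¹ volume)) := by
  obtain ⟨M₁, hM₁, hB₁⟩ := exists_eLpNorm_freqBlock_le Φ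
  obtain ⟨M₂, hM₂, hB₂⟩ := hΦ.exists_eLpNorm_le
  set M := max M₁ M₂
  have hd0 : (3 : ℝ) ≤ d := by exact_mod_cast hd
  have hP0 : 0 < P := by
    by_contra! h
    nlinarith
  set R := min 1 (2 * P) with hRdef
  set σ := 2 - d * (Q - P) with hσ
  set τ := d * R - 2 with hτ
  have hσ0 : 0 < σ := by linarith
  have hτ0 : 0 < τ := by
    rcases min_choice 1 (2 * P) with h | h <;> rw [hτ, hRdef, h] <;> linarith
  set ε := min σ (τ / 2)
  have hε0 : 0 < ε := lt_min hσ0 (by linarith)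
  have hεσ : ε ≤ σ := min_le_left _ _
  have hετ : ε ≤ τ / 2 := min_le_right _ _
  set E := 6 * σ + 5 * (d * P) + 12 * τ + 6 * ε
  have key : ∀ (S : ℝ), P ≤ S → S ≤ 1 → S ≤ 2 * P → Q ≤ S → ∀ (j k l : ℤ) (f g : 𝓢(Rd d, ℂ)),
      j * (d * Q - 2) + (j * d * (S - Q) + k * d * (2 * P - S))
        ≤ E + (-ε * |(k - j : ℤ)| + -ε * |(l - j : ℤ)|)
          + (k * (d * P - 2) + l * (d * P)) →
      twoPow (j * (d * Q - 2))
        * eLpNorm (freqBlock Φ j (schwartzMul (freqBlock Φ k f) (freqBlock Φ l g)))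
          (ENNReal.ofReal Q)⁻¹ volume
      ≤ M * M * twoPow E * (twoPow (-ε * |(k - j : ℤ)|) * twoPow (-ε * |(l - j : ℤ)|))
        * ((twoPow (k * (d * P - 2)) * eLpNorm (freqBlock Φ k f) (ENNReal.ofReal P)⁻¹ volume)
          * (twoPow (l * (d * P)) * eLpNorm (freqBlock Φ l g) (ENNReal.ofReal P)⁻¹ volume)) := by
    intro S hPS hS hSP hQS j k l f g hexp
    have h := eLpNorm_piece_le (Φ := Φ) (M := M)
      (fun a b h1 h2 h3 h4 j f => (hB₁ a b h1 h2 h3 h4 j f).trans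
        (by gcongr; exact le_max_left _ _))
      (fun a b h1 h2 h3 h4 j f => (hB₂ a b h1 h2 h3 h4 j f).trans
        (by gcongr; exact le_max_right _ _))
      hP0 hPS hS hSP (hP0.le.trans hPQ) hQS j k l f g
    have h2 := twoPow_mono hexp
    rw [twoPow_add (j * (d * Q - 2)), twoPow_add (E + _), twoPow_add E, twoPow_add (-ε * _),
      twoPow_add (k * (d * P - 2))] at h2
    refine (mul_le_mul_right h _).trans ?_
    set X := eLpNorm (freqBlock Φ k f) (ENNReal.ofReal P)⁻¹ volume
    set Y := eLpNorm (freqBlock Φ l g) (ENNReal.ofReal P)⁻¹ volume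
    refine (le_of_eq ?_).trans ((mul_le_mul_right h2 (M * M * (X * Y))).trans (le_of_eq ?_)) <;>
      ring
  refine ⟨M * M * twoPow E, ?_, ε, hε0, fun j k l f g hkl => ?_⟩
  · have hMt : M ≠ ∞ := (max_lt hM₁.lt_top hM₂.lt_top).ne
    exact ENNReal.mul_ne_top (ENNReal.mul_ne_top hMt hMt) (twoPow_ne_top _)
  by_cases hz : l + 5 < j ∨ k ≤ l - 2 ∧ j < l - 5
  · rw [hΦ.freqBlock_eq_zero hkl hz f g]
    have h0 : eLpNorm (⇑(0 : 𝓢(Rd d, ℂ))) (ENNReal.ofReal Q)⁻¹ volume = 0 := eLpNorm_zero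
    rw [h0, mul_zero]
    exact zero_le
  push Not at hz
  obtain ⟨hz1, hz2⟩ := hz
  have hz1' : (j : ℝ) ≤ l + 5 := by exact_mod_cast hz1
  have hkl' : (k : ℝ) ≤ l + 1 := by exact_mod_cast hkl
  by_cases hlow : k ≤ l - 2
  · have hlj : (l : ℝ) ≤ j + 5 := by exact_mod_cast (by linarith [hz2 hlow] : l ≤ j + 5)
    have hkj : (k : ℝ) ≤ j + 3 := by exact_mod_cast (by linarith [hz2 hlow] : k ≤ j + 3)
    refine key Q hPQ hQ hQP le_rfl j k l f g ?_
    push_cast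
    have h1 : |(l : ℝ) - j| ≤ 5 := abs_le.2 ⟨by linarith, by linarith⟩
    have h2 : |(k : ℝ) - j| ≤ 6 - (k - j) := abs_le.2 ⟨by linarith, by linarith⟩
    have h3 : ε * |(l : ℝ) - j| ≤ ε * 5 := by gcongr
    have h4 : ε * |(k : ℝ) - j| ≤ σ * (6 - (k - j)) := by gcongr
    have h5 : ((j : ℝ) - l) * (d * P) ≤ 5 * (d * P) := by gcongr; linarith
    have h6 : j * (d * Q - 2) + (j * d * (Q - Q) + k * d * (2 * P - Q))
      = (k - j) * σ + (j - l) * (d * P) + (k * (d * P - 2) + l * (d * P)) := by rw [hσ]; ring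
    rw [h6]
    linarith
  · have hlk : (l : ℝ) ≤ k + 1 := by exact_mod_cast (by omega : l ≤ k + 1)
    have hRP : R ≤ 2 * P := min_le_right _ _
    have hQR : Q ≤ R := le_min hQ hQP
    refine key R (hPQ.trans hQR) (min_le_left _ _) hRP hQR j k l f g ?_
    push_cast
    have h1 : |(k : ℝ) - j| ≤ 12 - (j - k) := abs_le.2 ⟨by linarith, by linarith⟩
    have h2 : |(l : ℝ) - j| ≤ |(k : ℝ) - j| + 1 := by
      rw [show (l : ℝ) - j = (k - j) + (l - k) by ring]
      refine (abs_add_le _ _).trans ?_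
      gcongr
      exact abs_le.2 ⟨by linarith, by linarith⟩
    have h3 : ε * |(l : ℝ) - j| ≤ ε * (|(k : ℝ) - j| + 1) := by gcongr
    have h4 : ε * |(k : ℝ) - j| ≤ τ / 2 * (12 - (j - k)) := by gcongr
    have h5 : ((k : ℝ) - l) * (d * P) ≤ 1 * (d * P) := by gcongr; linarith
    have h6 : j * (d * Q - 2) + (j * d * (R - Q) + k * d * (2 * P - R))
      = (j - k) * τ + (k - l) * (d * P) + (k * (d * P - 2) + l * (d * P)) := by rw [hτ]; ring
    rw [h6]
    linarith

end Pieces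

/-! ### Summation over the pieces and integration in time -/

section Assembly

variable {d : ℕ}

lemma tsum_twoPow_ne_top {ε : ℝ} (hε : 0 < ε) : ∑' m : ℤ, twoPow (-ε * |m|) ≠ ∞ := by
  have hgeo : Summable fun n : ℕ => (2 : ℝ) ^ (-ε * n) := by
    simp only [Real.rpow_mul two_pos.le, Real.rpow_natCast]
    exact summable_geometric_of_lt_one (by positivity)
      (Real.rpow_lt_one_of_one_lt_of_neg one_lt_two (by linarith))
  exact Summable.tsum_ofReal_ne_top (.of_nat_of_neg (by simpa using hgeo) (by simpa using hgeo))

lemma tsum_prod_twoPow (C : ℝ≥0∞) (ε : ℝ) (j : ℤ) :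
    ∑' n : ℤ × ℤ, C * (twoPow (-ε * |(n.1 - j : ℤ)|) * twoPow (-ε * |(n.2 - j : ℤ)|))
      = C * ((∑' m : ℤ, twoPow (-ε * |m|)) * ∑' m : ℤ, twoPow (-ε * |m|)) := by
  have h : ∑' m : ℤ, twoPow (-ε * |(m - j : ℤ)|) = ∑' m : ℤ, twoPow (-ε * |m|) :=
    (Equiv.subRight j).tsum_eq fun m : ℤ => twoPow (-ε * |m|)
  rw [ENNReal.tsum_mul_left, ENNReal.tsum_prod']
  simp only [ENNReal.tsum_mul_left, ENNReal.tsum_mul_right, h]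

lemma schwartzMul_comm (f g : 𝓢(Rd d, ℂ)) : schwartzMul f g = schwartzMul g f := by
  ext x; simp [mul_comm]

lemma eLpNorm_freqBlock_schwartzMul_le [NeZero d] {Φ : 𝓢(Rd d, ℂ)} (hΦ : AnnulusSupported Φ)
    (hsum : ∀ ξ : Rd d, ξ ≠ 0 → ∑' k : ℤ, Φ (((2 : ℝ) ^ (-k)) • ξ) = 1)
    {q : ℝ≥0∞} (hq : 1 ≤ q) (f g : 𝓢(Rd d, ℂ)) (j : ℤ) :
    eLpNorm (freqBlock Φ j (schwartzMul f g)) q volume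
      ≤ ∑' n : ℤ × ℤ, eLpNorm (freqBlock Φ j
          (schwartzMul (freqBlock Φ n.1 f) (freqBlock Φ n.2 g))) q volume := by
  set F : ℤ × ℤ → Rd d → ℝ≥0∞ := fun n x =>
    ‖freqBlock Φ j (schwartzMul (freqBlock Φ n.1 f) (freqBlock Φ n.2 g)) x‖ₑ with hF
  have h1 : eLpNorm (freqBlock Φ j (schwartzMul f g)) q volume
      ≤ eLpNorm (fun x => ∑' n, F n x) q volume :=
    eLpNorm_mono_enorm fun x => by
      simpa using hΦ.enorm_freqBlock_schwartzMul_le hsum f g j x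
  have hm : ∀ n, Measurable (F n) := fun n => (SchwartzMap.continuous _).enorm.measurable
  refine (h1.trans (eLpNorm_tsum_le_tsum hq hm)).trans (ENNReal.tsum_le_tsum fun n => ?_)
  exact (eLpNorm_enorm _).le

/-- Hölder in time and summation over pairs of frequencies. -/
lemma eLpNorm_le_tsum_mul {α : Type*} [MeasurableSpace α] {μ : Measure α}
    {ρ ρ₁ ρ₂ ρb₁ ρb₂ : ℝ≥0∞} (hρ : 1 ≤ ρ) (hhol : 1 / ρ = 1 / ρ₁ + 1 / ρ₂)
    (hhol' : 1 / ρ = 1 / ρb₁ + 1 / ρb₂) {W : α → ℝ≥0∞} {X Y : ℤ → α → ℝ≥0∞}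
    (hX : ∀ k, Measurable (X k)) (hY : ∀ k, Measurable (Y k))
    (hX' : ∀ k, ∀ᵐ t ∂μ, X k t ≠ ∞) (hY' : ∀ k, ∀ᵐ t ∂μ, Y k t ≠ ∞)
    {c : ℤ × ℤ → ℝ≥0∞} (hc : ∀ n, c n ≠ ∞) {u v : ℤ → ℝ≥0∞} (hu : ∀ k, u k ≠ ∞)
    (hv : ∀ k, v k ≠ ∞) {A₁ A₂ B₁ B₂ : ℝ≥0∞}
    (hA₁ : ∀ k, u k * eLpNorm (X k) ρ₁ μ ≤ A₁) (hB₁ : ∀ k, v k * eLpNorm (Y k) ρ₂ μ ≤ B₁)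
    (hB₂ : ∀ k, u k * eLpNorm (Y k) ρb₁ μ ≤ B₂) (hA₂ : ∀ k, v k * eLpNorm (X k) ρb₂ μ ≤ A₂)
    (hW : ∀ᵐ t ∂μ, W t ≤ ∑' n : ℤ × ℤ, c n *
      ((u n.1 * X n.1 t) * (v n.2 * Y n.2 t) + (u n.2 * Y n.2 t) * (v n.1 * X n.1 t))) :
    eLpNorm W ρ μ ≤ (∑' n, c n) * (A₁ * B₁ + B₂ * A₂) := by
  have huv : ∀ {r s : ℝ≥0∞} {Z Z' : α → ℝ≥0∞} {z z' N N' : ℝ≥0∞}, 1 / ρ = 1 / r + 1 / s →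
      Measurable Z → Measurable Z' → (∀ᵐ t ∂μ, Z t ≠ ∞) → (∀ᵐ t ∂μ, Z' t ≠ ∞) → z ≠ ∞ → z' ≠ ∞ →
      z * eLpNorm Z r μ ≤ N → z' * eLpNorm Z' s μ ≤ N' →
      eLpNorm (fun t => (z * Z t) * (z' * Z' t)) ρ μ ≤ N * N' := by
    intro r s Z Z' z z' N N' hrs hZ hZ' hZt hZt' hz hz' hN hN'
    refine (eLpNorm_mul_le_mul_eLpNorm hrs (hZ.const_mul z) (hZ'.const_mul z')
      (hZt.mono fun t ht => ENNReal.mul_ne_top hz ht)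
      (hZt'.mono fun t ht => ENNReal.mul_ne_top hz' ht)).trans ?_
    exact mul_le_mul' ((eLpNorm_const_mul_le z hz Z r).trans hN)
      ((eLpNorm_const_mul_le z' hz' Z' s).trans hN')
  have hm : ∀ n : ℤ × ℤ, Measurable fun t =>
      (u n.1 * X n.1 t) * (v n.2 * Y n.2 t) + (u n.2 * Y n.2 t) * (v n.1 * X n.1 t) := fun n => by
    fun_prop
  calc eLpNorm W ρ μ ≤ eLpNorm (fun t => ∑' n : ℤ × ℤ, c n *
      ((u n.1 * X n.1 t) * (v n.2 * Y n.2 t) + (u n.2 * Y n.2 t) * (v n.1 * X n.1 t))) ρ μ :=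
        eLpNorm_mono_enorm_ae (by simpa using hW)
    _ ≤ ∑' n : ℤ × ℤ, eLpNorm (fun t => c n *
      ((u n.1 * X n.1 t) * (v n.2 * Y n.2 t) + (u n.2 * Y n.2 t) * (v n.1 * X n.1 t))) ρ μ :=
        eLpNorm_tsum_le_tsum hρ fun n => (hm n).const_mul _
    _ ≤ ∑' n, c n * (A₁ * B₁ + B₂ * A₂) := by
        refine ENNReal.tsum_le_tsum fun n => (eLpNorm_const_mul_le _ (hc n) _ _).trans ?_
        gcongr
        refine (eLpNorm_add_le ?_ ?_ hρ).trans (add_le_add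
          (huv hhol (hX _) (hY _) (hX' _) (hY' _) (hu _) (hv _) (hA₁ _) (hB₁ _))
          (huv hhol' (hY _) (hX _) (hY' _) (hX' _) (hu _) (hv _) (hB₂ _) (hA₂ _)))
        · exact Measurable.aestronglyMeasurable (by fun_prop)
        · exact Measurable.aestronglyMeasurable (by fun_prop)
    _ = _ := ENNReal.tsum_mul_right

lemma timeLp_eq_eLpNorm {ρ : ℝ≥0∞} (hρ : ρ ≠ 0) (T : ℝ) (g : ℝ → ℝ≥0∞) :
    timeLp ρ T g = eLpNorm g ρ (volume.restrict (Set.Icc (0 : ℝ) T)) := by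
  by_cases h : ρ = ∞
  · simp [timeLp, h, eLpNorm_exponent_top, eLpNormEssSup]
  · simp [timeLp, h, eLpNorm_eq_lintegral_rpow_enorm_toReal hρ h]

lemma le_cheminLerner_top {ρ : ℝ≥0∞} (hρ : ρ ≠ 0) (φ : Rd d → ℝ) (T s : ℝ) (p : ℝ≥0∞)
    (f : ℝ → Rd d → ℂ) (k : ℤ) :
    twoPow (k * s) * eLpNorm (fun t => eLpNorm (LPblock d φ k (f t)) p volume) ρ
        (volume.restrict (Set.Icc (0 : ℝ) T))
      ≤ cheminLerner d φ T ρ s p ∞ f := by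
  rw [← timeLp_eq_eLpNorm hρ, cheminLerner, seqNorm, if_pos rfl]
  exact le_iSup (fun j : ℤ => ENNReal.ofReal ((2 : ℝ) ^ ((j : ℝ) * s)) *
    timeLp ρ T fun t => eLpNorm (LPblock d φ j (f t)) p volume) k

lemma LPblock_eq_freqBlock {φ : Rd d → ℝ} {Φ : 𝓢(Rd d, ℂ)} (h : ∀ ξ, Φ ξ = φ ξ) (j : ℤ)
    (f : 𝓢(Rd d, ℂ)) : LPblock d φ j f = freqBlock Φ j f := by
  rw [LPblock, freqBlock, fourierInv_coe]
  congr 1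
  ext ξ
  rw [schwartzMul_apply, dilate_apply, h, fourier_coe]

lemma measurable_fourierIntegral {F : ℝ × Rd d → ℂ} (hF : Measurable F) :
    Measurable fun z : ℝ × Rd d => 𝓕 (fun y => F (z.1, y)) z.2 := by
  simp only [Real.fourier_eq]
  have h : Measurable fun w : (ℝ × Rd d) × Rd d =>
      𝐞 (-inner ℝ w.2 w.1.2) • F (w.1.1, w.2) := by
    simp only [Circle.smul_def]
    fun_prop
  exact (h.stronglyMeasurable.integral_prod_right).measurable

lemma measurable_eLpNorm_LPblock {φ : Rd d → ℝ} (hφ : Continuous φ) {p : ℝ} (hp : 0 < p)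
    {a : ℝ → Rd d → ℂ} (ha : Measurable fun z : ℝ × Rd d => a z.1 z.2) (k : ℤ) :
    Measurable fun t => eLpNorm (LPblock d φ k (a t)) (ENNReal.ofReal p) volume := by
  have h1 : Measurable fun z : ℝ × Rd d =>
      (φ (((2 : ℝ) ^ (-k)) • z.2) : ℂ) * 𝓕 (a z.1) z.2 := by
    have h := measurable_fourierIntegral ha
    refine Measurable.mul ?_ h
    have : Continuous fun z : ℝ × Rd d => (φ (((2 : ℝ) ^ (-k)) • z.2) : ℂ) := by fun_prop
    exact this.measurable
  have h2 : Measurable fun z : ℝ × Rd d => LPblock d φ k (a z.1) z.2 := by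
    have h := (measurable_fourierIntegral h1).comp (measurable_fst.prodMk measurable_snd.neg)
    simpa [LPblock, Function.comp_def, Real.fourierInv_eq_fourier_neg] using h
  have hp0 : ENNReal.ofReal p ≠ 0 := by simpa using hp
  simp only [eLpNorm_eq_lintegral_rpow_enorm_toReal hp0 ENNReal.ofReal_ne_top]
  exact (Measurable.lintegral_prod_right (h2.enorm.pow_const _)).pow_const _

/-- The product estimate at a fixed time, as a double series of products of dyadic blocks. -/
lemma AnnulusSupported.exists_product_le {Φ : 𝓢(Rd d, ℂ)} (hΦ : AnnulusSupported Φ) (hd : 3 ≤ d)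
    (hsum : ∀ ξ : Rd d, ξ ≠ 0 → ∑' k : ℤ, Φ (((2 : ℝ) ^ (-k)) • ξ) = 1)
    {P Q : ℝ} (hP : 1 < d * P) (hPQ : P ≤ Q) (hQ : Q ≤ 1) (hQP : Q ≤ 2 * P)
    (hQP' : d * (Q - P) < 2) :
    ∃ C : ℝ≥0∞, C ≠ ∞ ∧ ∃ ε : ℝ, 0 < ε ∧ ∀ (j : ℤ) (f g : 𝓢(Rd d, ℂ)),
      twoPow (j * (d * Q - 2))
        * eLpNorm (freqBlock Φ j (schwartzMul f g)) (ENNReal.ofReal Q)⁻¹ volume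
      ≤ ∑' n : ℤ × ℤ, C * (twoPow (-ε * |(n.1 - j : ℤ)|) * twoPow (-ε * |(n.2 - j : ℤ)|)) *
        ((twoPow (n.1 * (d * P - 2)) * eLpNorm (freqBlock Φ n.1 f) (ENNReal.ofReal P)⁻¹ volume)
          * (twoPow (n.2 * (d * P)) * eLpNorm (freqBlock Φ n.2 g) (ENNReal.ofReal P)⁻¹ volume)
        + (twoPow (n.2 * (d * P - 2)) * eLpNorm (freqBlock Φ n.2 g) (ENNReal.ofReal P)⁻¹ volume)
          * (twoPow (n.1 * (d * P)) * eLpNorm (freqBlock Φ n.1 f) (ENNReal.ofReal P)⁻¹ volume))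
      := by
  have : NeZero d := ⟨by omega⟩
  obtain ⟨C, hC, ε, hε, h⟩ := hΦ.exists_piece_le hd hP hPQ hQ hQP hQP'
  refine ⟨C, hC, ε, hε, fun j f g => ?_⟩
  have hq : 1 ≤ (ENNReal.ofReal Q)⁻¹ := by
    rw [ENNReal.one_le_inv]
    exact ENNReal.ofReal_le_one.2 hQ
  refine (mul_le_mul_right (eLpNorm_freqBlock_schwartzMul_le hΦ hsum hq f g j) _).trans ?_
  rw [← ENNReal.tsum_mul_left]
  refine ENNReal.tsum_le_tsum fun ⟨k, l⟩ => ?_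
  rcases le_or_gt k (l + 1) with hkl | hkl
  · exact (h j k l f g hkl).trans (mul_le_mul_right le_self_add _)
  · have h' := h j l k g f (by omega)
    rw [schwartzMul_comm, mul_comm (twoPow (-ε * |(l - j : ℤ)|))] at h'
    exact h'.trans (mul_le_mul_right le_add_self _)

end Assembly

/-- Chemin–Lerner product estimate: for d ≥ 3, exponents 1/ρ = 1/ρ₁ + 1/ρ₂ = 1/ρ̄₁ + 1/ρ̄₂
in [1,∞], and 1 ≤ q ≤ p ≤ 2q with p < d, 1/q < 1/p + 2/d,
‖ab‖_{L̃^ρ_T(Ḃ^{d/q−2}_{q,∞})} ≲ ‖a‖_{L̃^{ρ₁}_T(Ḃ^{d/p−2}_{p,∞})}‖b‖_{L̃^{ρ₂}_T(Ḃ^{d/p}_{p,∞})}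
 + ‖b‖_{L̃^{ρ̄₁}_T(Ḃ^{d/p−2}_{p,∞})}‖a‖_{L̃^{ρ̄₂}_T(Ḃ^{d/p}_{p,∞})}. -/
theorem cheminLerner_product_estimate
    (d : ℕ) (hd : 3 ≤ d) (φ : Rd d → ℝ)
    (hφ1 : ContDiff ℝ (⊤ : ℕ∞) φ)
    (hφ2 : ∀ x y : Rd d, ‖x‖ = ‖y‖ → φ x = φ y)
    (hφ3 : ∀ x : Rd d, φ x ≠ 0 → 3/4 ≤ ‖x‖ ∧ ‖x‖ ≤ 8/3)
    (hφ4 : ∀ ξ : Rd d, ξ ≠ 0 → ∑' j : ℤ, φ (((2:ℝ) ^ (-j)) • ξ) = 1)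
    (T : ℝ) (hT : 0 < T)
    (ρ ρ₁ ρ₂ ρb₁ ρb₂ : ℝ≥0∞)
    (hρ : 1 ≤ ρ) (hρ₁ : 1 ≤ ρ₁) (hρ₂ : 1 ≤ ρ₂) (hρb₁ : 1 ≤ ρb₁) (hρb₂ : 1 ≤ ρb₂)
    (hhol : 1/ρ = 1/ρ₁ + 1/ρ₂) (hhol' : 1/ρ = 1/ρb₁ + 1/ρb₂)
    (p q : ℝ) (hq1 : 1 ≤ q) (hqp : q ≤ p) (hp2q : p ≤ 2 * q)
    (hpd : p < d) (hpq : 1/q < 1/p + 2/(d : ℝ)) :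
    ∃ C : ℝ, 0 < C ∧ ∀ a b : ℝ → Rd d → ℂ,
      (∀ t ∈ Set.Icc (0:ℝ) T, ∃ S : 𝓢(Rd d, ℂ), a t = ⇑S) →
      (∀ t ∈ Set.Icc (0:ℝ) T, ∃ S : 𝓢(Rd d, ℂ), b t = ⇑S) →
      Measurable (fun z : ℝ × Rd d => a z.1 z.2) →
      Measurable (fun z : ℝ × Rd d => b z.1 z.2) →
      cheminLerner d φ T ρ₁ ((d : ℝ)/p - 2) (ENNReal.ofReal p) ∞ a ≠ ∞ →
      cheminLerner d φ T ρ₂ ((d : ℝ)/p) (ENNReal.ofReal p) ∞ b ≠ ∞ →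
      cheminLerner d φ T ρb₁ ((d : ℝ)/p - 2) (ENNReal.ofReal p) ∞ b ≠ ∞ →
      cheminLerner d φ T ρb₂ ((d : ℝ)/p) (ENNReal.ofReal p) ∞ a ≠ ∞ →
      cheminLerner d φ T ρ ((d : ℝ)/q - 2) (ENNReal.ofReal q) ∞ (fun t x => a t x * b t x)
        ≤ ENNReal.ofReal C *
            (cheminLerner d φ T ρ₁ ((d : ℝ)/p - 2) (ENNReal.ofReal p) ∞ a
                * cheminLerner d φ T ρ₂ ((d : ℝ)/p) (ENNReal.ofReal p) ∞ b
              + cheminLerner d φ T ρb₁ ((d : ℝ)/p - 2) (ENNReal.ofReal p) ∞ b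
                * cheminLerner d φ T ρb₂ ((d : ℝ)/p) (ENNReal.ofReal p) ∞ a) := by
  have hq0 : 0 < q := by linarith
  have hp0 : 0 < p := by linarith
  have hd0 : (0 : ℝ) < d := by linarith
  have hcs : HasCompactSupport fun ξ => (φ ξ : ℂ) := by
    refine HasCompactSupport.intro (isCompact_closedBall (0 : Rd d) (8 / 3)) fun ξ hξ => ?_
    by_contra h
    exact hξ (by simpa using (hφ3 ξ (by simpa using h)).2)
  set Φ : 𝓢(Rd d, ℂ) := hcs.toSchwartzMap (Complex.ofRealCLM.contDiff.comp hφ1)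
  have hΦφ : ∀ ξ, Φ ξ = φ ξ := fun ξ => rfl
  have hΦ : AnnulusSupported Φ := fun ξ hξ => hφ3 ξ (by simpa [hΦφ] using hξ)
  have hsum : ∀ ξ : Rd d, ξ ≠ 0 → ∑' k : ℤ, Φ (((2 : ℝ) ^ (-k)) • ξ) = 1 := fun ξ hξ => by
    simp only [hΦφ]
    rw [← Complex.ofReal_tsum, hφ4 ξ hξ, Complex.ofReal_one]
  have hexp : ∀ r : ℝ, 0 < r → (ENNReal.ofReal r⁻¹)⁻¹ = ENNReal.ofReal r := fun r hr => by
    rw [ENNReal.ofReal_inv_of_pos hr, inv_inv]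
  obtain ⟨C, hC, ε, hε, hprod⟩ := hΦ.exists_product_le hd hsum (P := p⁻¹) (Q := q⁻¹)
    (by rw [← div_eq_mul_inv]; exact (one_lt_div hp0).2 hpd)
    (by gcongr) (inv_le_one_of_one_le₀ hq1)
    (by rw [← div_eq_mul_inv, inv_eq_one_div, div_le_div_iff₀ hq0 hp0]; linarith)
    (by
      rw [← lt_div_iff₀' hd0, ← one_div, ← one_div]
      linarith)
  rw [hexp p hp0, hexp q hq0] at hprod
  simp only [← div_eq_mul_inv] at hprod
  set D := C * ((∑' m : ℤ, twoPow (-ε * |m|)) * ∑' m : ℤ, twoPow (-ε * |m|)) with hD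
  have hDt : D ≠ ∞ := ENNReal.mul_ne_top hC
    (ENNReal.mul_ne_top (tsum_twoPow_ne_top hε) (tsum_twoPow_ne_top hε))
  refine ⟨D.toReal + 1, by positivity, fun a b ha hb ham hbm _ _ _ _ => ?_⟩
  have hDC : D ≤ ENNReal.ofReal (D.toReal + 1) := by
    rw [ENNReal.le_ofReal_iff_toReal_le hDt (by positivity)]
    linarith
  refine le_trans ?_ (mul_le_mul_left hDC _)
  have hfin : ∀ f : ℝ → Rd d → ℂ, (∀ t ∈ Set.Icc (0:ℝ) T, ∃ S : 𝓢(Rd d, ℂ), f t = ⇑S) →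
      ∀ k, ∀ᵐ t ∂(volume.restrict (Set.Icc (0 : ℝ) T)),
        eLpNorm (LPblock d φ k (f t)) (ENNReal.ofReal p) volume ≠ ∞ := fun f hf k => by
    filter_upwards [ae_restrict_mem measurableSet_Icc] with t ht
    obtain ⟨S, hS⟩ := hf t ht
    rw [hS, LPblock_eq_freqBlock hΦφ]
    exact ((freqBlock Φ k S).memLp _ _).eLpNorm_ne_top
  have h0 : ∀ {r : ℝ≥0∞}, 1 ≤ r → r ≠ 0 := fun hr => (zero_lt_one.trans_le hr).ne'
  rw [cheminLerner, seqNorm, if_pos rfl]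
  refine iSup_le fun j => ?_
  rw [timeLp_eq_eLpNorm (h0 hρ), hD, ← tsum_prod_twoPow C ε j]
  refine (mul_eLpNorm_le (by positivity) ENNReal.ofReal_ne_top _ _).trans ?_
  refine eLpNorm_le_tsum_mul (μ := volume.restrict (Set.Icc (0 : ℝ) T)) hρ hhol hhol'
    (X := fun k t => eLpNorm (LPblock d φ k (a t)) (ENNReal.ofReal p) volume)
    (Y := fun k t => eLpNorm (LPblock d φ k (b t)) (ENNReal.ofReal p) volume)
    (u := fun k => twoPow (k * (d / p - 2))) (v := fun k => twoPow (k * (d / p)))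
    (measurable_eLpNorm_LPblock hφ1.continuous hp0 ham)
    (measurable_eLpNorm_LPblock hφ1.continuous hp0 hbm) (hfin a ha) (hfin b hb)
    (fun n => ENNReal.mul_ne_top hC (ENNReal.mul_ne_top (twoPow_ne_top _) (twoPow_ne_top _)))
    (fun k => twoPow_ne_top _) (fun k => twoPow_ne_top _)
    (le_cheminLerner_top (h0 hρ₁) φ T _ _ a) (le_cheminLerner_top (h0 hρ₂) φ T _ _ b)
    (le_cheminLerner_top (h0 hρb₁) φ T _ _ b) (le_cheminLerner_top (h0 hρb₂) φ T _ _ a) ?_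
  filter_upwards [ae_restrict_mem measurableSet_Icc] with t ht
  obtain ⟨f, hf⟩ := ha t ht
  obtain ⟨g, hg⟩ := hb t ht
  have hfg : LPblock d φ j (fun x => f x * g x) = freqBlock Φ j (schwartzMul f g) :=
    LPblock_eq_freqBlock hΦφ j (schwartzMul f g)
  simp only [hf, hg, hfg, LPblock_eq_freqBlock hΦφ]
  exact hprod j f g
end
end
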